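/- Let G be an Artin group of large type satisfying the (3,3,m)-hypothesis (no pairwise distinct indices i, j, k with m_{ij} = m_{ik} = 3 and m_{jk} < ∞), and let 𝒫 ⊆ G × G be the set of permissible factorisations. There exists a polynomial P_1 with nonnegative coefficients such that for all k, l ∈ ℕ and every g ∈ G with ℓ(g) = k + l, the number of pairs (g_1, g_2) ∈ 𝒫 with g_1 g_2 = g, ℓ(g_1) = k and ℓ(g_2) = l is at most P_1(min(k,l)). -/

import Mathlib

namespace ArtinRD

/-- The alternating product `xyxy...` with `m` factors, starting with `x`. -/
def altProd {G : Type*} [Monoid G] : ℕ → G → G → G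
  | 0, _, _ => 1
  | n + 1, x, y => x * altProd n y x

/-- The Artin relators determined by a Coxeter-type matrix `M` (`⊤` meaning `∞`). -/
def artinRels (n : ℕ) (M : Fin n → Fin n → ℕ∞) : Set (FreeGroup (Fin n)) :=
  {r | ∃ i j : Fin n, i ≠ j ∧ ∃ m : ℕ, M i j = (m : ℕ∞) ∧
    r = altProd m (FreeGroup.of i) (FreeGroup.of j) *
        (altProd m (FreeGroup.of j) (FreeGroup.of i))⁻¹}

/-- The Artin group associated to the matrix `M`. -/
abbrev ArtinGroup (n : ℕ) (M : Fin n → Fin n → ℕ∞) : Type := PresentedGroup (artinRels n M)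

/-- The standard generator `x_i` of the Artin group. -/
def gen (n : ℕ) (M : Fin n → Fin n → ℕ∞) (i : Fin n) : ArtinGroup n M := PresentedGroup.of i

/-- The set `A = {x_1^{±1}, ..., x_n^{±1}}` of standard letters. -/
def genSet (n : ℕ) (M : Fin n → Fin n → ℕ∞) : Set (ArtinGroup n M) :=
  {g | ∃ i : Fin n, g = gen n M i ∨ g = (gen n M i)⁻¹}

/-- Word length of `g` with respect to a set `S`: the least `N` such that `g` is a
product of `N` elements of `S`. -/
noncomputable def wordLength {G : Type*} [Group G] (S : Set G) (g : G) : ℕ :=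
  sInf {N : ℕ | ∃ w : List G, (∀ a ∈ w, a ∈ S) ∧ w.length = N ∧ w.prod = g}

/-- The word length on an Artin group with respect to the standard letters. -/
noncomputable def ℓA (n : ℕ) (M : Fin n → Fin n → ℕ∞) : ArtinGroup n M → ℕ :=
  wordLength (genSet n M)

/-- A letter: a generator index together with a sign (`true` = positive). -/
abbrev Letter (n : ℕ) := Fin n × Bool

/-- The group element corresponding to a letter. -/
def toGen (n : ℕ) (M : Fin n → Fin n → ℕ∞) (l : Letter n) : ArtinGroup n M :=
  if l.2 then gen n M l.1 else (gen n M l.1)⁻¹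

/-- The group element represented by a word over the letters. -/
def wordElt (n : ℕ) (M : Fin n → Fin n → ℕ∞) (w : List (Letter n)) : ArtinGroup n M :=
  (w.map (toGen n M)).prod

/-- A word is geodesic if its length equals the word length of the element it represents. -/
def IsGeodesic (n : ℕ) (M : Fin n → Fin n → ℕ∞) (w : List (Letter n)) : Prop :=
  wordLength (genSet n M) (wordElt n M w) = w.length

/-- `h` is a left divisor of `g`: the factorisation `g = h ⬝ (h⁻¹ g)` is geodesic. -/
def IsLeftDiv {G : Type*} [Group G] (ℓ : G → ℕ) (h g : G) : Prop :=
  ℓ h + ℓ (h⁻¹ * g) = ℓ g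

/-- `h` is a right divisor of `g`: the factorisation `g = (g h⁻¹) ⬝ h` is geodesic. -/
def IsRightDiv {G : Type*} [Group G] (ℓ : G → ℕ) (h g : G) : Prop :=
  ℓ (g * h⁻¹) + ℓ h = ℓ g

/-- The two-generator ("dihedral") subgroup `G(i,j)`. -/
def Gij (n : ℕ) (M : Fin n → Fin n → ℕ∞) (i j : Fin n) : Subgroup (ArtinGroup n M) :=
  Subgroup.closure {gen n M i, gen n M j}

/-- The letters `x_i^{±1}, x_j^{±1}` as group elements. -/
def lettersIJ (n : ℕ) (M : Fin n → Fin n → ℕ∞) (i j : Fin n) : Set (ArtinGroup n M) :=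
  {gen n M i, (gen n M i)⁻¹, gen n M j, (gen n M j)⁻¹}

/-- The maximal `{x_i,x_j}`-prefix of a word. -/
def ijPrefix (n : ℕ) (i j : Fin n) (w : List (Letter n)) : List (Letter n) :=
  w.takeWhile (fun l => l.1 == i || l.1 == j)

/-- `h` is a left divisor of `g` lying in `G(i,j)` of maximal word length. -/
def IsMaxLD (n : ℕ) (M : Fin n → Fin n → ℕ∞) (i j : Fin n) (g h : ArtinGroup n M) : Prop :=
  h ∈ Gij n M i j ∧ IsLeftDiv (ℓA n M) h g ∧
    ∀ h' ∈ Gij n M i j, IsLeftDiv (ℓA n M) h' g → ℓA n M h' ≤ ℓA n M h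

/-- `h` is a right divisor of `g` lying in `G(i,j)` of maximal word length. -/
def IsMaxRD (n : ℕ) (M : Fin n → Fin n → ℕ∞) (i j : Fin n) (g h : ArtinGroup n M) : Prop :=
  h ∈ Gij n M i j ∧ IsRightDiv (ℓA n M) h g ∧
    ∀ h' ∈ Gij n M i j, IsRightDiv (ℓA n M) h' g → ℓA n M h' ≤ ℓA n M h

/-- A positive element of `G(i,j)`: a product of the generators `x_i, x_j`. -/
def posIJ (n : ℕ) (M : Fin n → Fin n → ℕ∞) (i j : Fin n) (h : ArtinGroup n M) : Prop :=
  h ∈ Submonoid.closure ({gen n M i, gen n M j} : Set (ArtinGroup n M))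

/-- A negative element of `G(i,j)`: a product of the inverses of `x_i, x_j`. -/
def negIJ (n : ℕ) (M : Fin n → Fin n → ℕ∞) (i j : Fin n) (h : ArtinGroup n M) : Prop :=
  h ∈ Submonoid.closure ({(gen n M i)⁻¹, (gen n M j)⁻¹} : Set (ArtinGroup n M))

/-- The Garside element `Δ_{ij} = ₘ(x_i,x_j)` (for `m = m_{ij}`). -/
def DeltaIJ (n : ℕ) (M : Fin n → Fin n → ℕ∞) (i j : Fin n) (m : ℕ) : ArtinGroup n M :=
  altProd m (gen n M i) (gen n M j)

/-- `k` is the largest exponent such that `Δ_{ij}^k` is a left divisor of `h`. -/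
def IsMaxDPowIJ (n : ℕ) (M : Fin n → Fin n → ℕ∞) (i j : Fin n) (m k : ℕ)
    (h : ArtinGroup n M) : Prop :=
  IsLeftDiv (ℓA n M) (DeltaIJ n M i j m ^ k) h ∧
    ∀ k' : ℕ, IsLeftDiv (ℓA n M) (DeltaIJ n M i j m ^ k') h → k' ≤ k

/-- `k` is the largest exponent such that `Δ_{ij}^{-k}` is a left divisor of `h`. -/
def IsMaxNegDPowIJ (n : ℕ) (M : Fin n → Fin n → ℕ∞) (i j : Fin n) (m k : ℕ)
    (h : ArtinGroup n M) : Prop :=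
  IsLeftDiv (ℓA n M) ((DeltaIJ n M i j m)⁻¹ ^ k) h ∧
    ∀ k' : ℕ, IsLeftDiv (ℓA n M) ((DeltaIJ n M i j m)⁻¹ ^ k') h → k' ≤ k

/-- `h` has a representative of the form `a^s b^t` with `a, b ∈ {x_i^{±1}, x_j^{±1}}`. -/
def TwoSyllIJ (n : ℕ) (M : Fin n → Fin n → ℕ∞) (i j : Fin n) (h : ArtinGroup n M) : Prop :=
  ∃ a ∈ lettersIJ n M i j, ∃ b ∈ lettersIJ n M i j, ∃ s t : ℕ, h = a ^ s * b ^ t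

/-- The permissible factorisations `𝒫_{ij}` in the dihedral subgroup `G(i,j)`:
geodesic factorisations `(h₁, h₂)` of `h₁h₂` into elements of `G(i,j)` such that, if
`m_{ij} < ∞` and the product is positive or negative, additionally one of the two
factors has at most two syllables or the factorisation is not `Δ_{ij}`-decreasing. -/
def PijMem (n : ℕ) (M : Fin n → Fin n → ℕ∞) (i j : Fin n)
    (h₁ h₂ : ArtinGroup n M) : Prop :=
  h₁ ∈ Gij n M i j ∧ h₂ ∈ Gij n M i j ∧
  ℓA n M h₁ + ℓA n M h₂ = ℓA n M (h₁ * h₂) ∧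
  (∀ m : ℕ, M i j = (m : ℕ∞) → (posIJ n M i j (h₁ * h₂) ∨ negIJ n M i j (h₁ * h₂)) →
    (TwoSyllIJ n M i j h₁ ∨ TwoSyllIJ n M i j h₂ ∨
     (posIJ n M i j (h₁ * h₂) ∧ posIJ n M i j h₁ ∧ posIJ n M i j h₂ ∧
       ∃ k₁ k₂ : ℕ, IsMaxDPowIJ n M i j m k₁ h₁ ∧ IsMaxDPowIJ n M i j m k₂ h₂ ∧
         IsMaxDPowIJ n M i j m (k₁ + k₂) (h₁ * h₂)) ∨
     (negIJ n M i j (h₁ * h₂) ∧ negIJ n M i j h₁ ∧ negIJ n M i j h₂ ∧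
       ∃ k₁ k₂ : ℕ, IsMaxNegDPowIJ n M i j m k₁ h₁ ∧ IsMaxNegDPowIJ n M i j m k₂ h₂ ∧
         IsMaxNegDPowIJ n M i j m (k₁ + k₂) (h₁ * h₂))))

/-- The set `𝒫` of permissible factorisations of elements of `G`: geodesic
factorisations `(g₁, g₂)` such that for every pair `i ≠ j`, the pair
`(RD_{ij}(g₁), LD_{ij}(g₂))` is a permissible factorisation in `G(i,j)`. -/
def PMem (n : ℕ) (M : Fin n → Fin n → ℕ∞)
    (LD RD : Fin n → Fin n → ArtinGroup n M → ArtinGroup n M)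
    (q : ArtinGroup n M × ArtinGroup n M) : Prop :=
  ℓA n M q.1 + ℓA n M q.2 = ℓA n M (q.1 * q.2) ∧
  ∀ i j : Fin n, i ≠ j → PijMem n M i j (RD i j q.1) (LD i j q.2)

/-! ### Dihedral Artin groups: the Garside state machine -/

/-- A state `Δ^k * w`, `w` a positive word without long alternating subwords, recorded by its last
letter `z` and the stack `L` of lengths of its maximal alternating segments. -/
@[ext] structure St where
  k : ℤ
  z : Bool
  L : List ℕ

namespace St

def nrm (k : ℤ) (z : Bool) : List ℕ → St
  | [] => ⟨k, true, []⟩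
  | l :: L => ⟨k, z, l :: L⟩

def mulP (m : ℕ) (b : Bool) : St → St
  | ⟨k, _, []⟩ => ⟨k, b, [1]⟩
  | ⟨k, z, l :: L⟩ =>
    if z = b then ⟨k, b, 1 :: l :: L⟩
    else if l + 1 < m then ⟨k, b, (l + 1) :: L⟩ else nrm (k + 1) z L

def mulN (m : ℕ) (b : Bool) : St → St
  | ⟨k, _, []⟩ => ⟨k - 1, !b, [m - 1]⟩
  | ⟨k, z, l :: L⟩ =>
    if z = b then (if 2 ≤ l then ⟨k, !b, (l - 1) :: L⟩ else nrm k z L)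
    else ⟨k - 1, !b, (m - 1) :: l :: L⟩

def Valid (m : ℕ) (s : St) : Prop :=
  (∀ l ∈ s.L, 1 ≤ l ∧ l + 1 ≤ m) ∧ (s.L = [] → s.z = true)

@[simp] theorem nrm_L (k z L) : (nrm k z L).L = L := by cases L <;> rfl
@[simp] theorem nrm_k (k z L) : (nrm k z L).k = k := by cases L <;> rfl

theorem nrm_valid {m k z} {L : List ℕ} (h : ∀ l ∈ L, 1 ≤ l ∧ l + 1 ≤ m) : Valid m (nrm k z L) := by
  cases L with
  | nil => exact ⟨by simp [nrm], fun _ => rfl⟩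
  | cons l L => exact ⟨by simpa [nrm] using h, by simp [nrm]⟩

theorem mulP_valid {m : ℕ} (hm : 3 ≤ m) (b : Bool) {s : St} (h : Valid m s) :
    Valid m (mulP m b s) := by
  rcases s with ⟨k, z, _ | ⟨l, L⟩⟩
  · refine ⟨?_, ?_⟩ <;> simp [mulP]; omega
  · have h1 := h.1
    simp only [List.mem_cons, forall_eq_or_imp] at h1
    simp only [mulP]
    split_ifs with h2 h3
    · refine ⟨?_, by simp⟩
      simp only [List.mem_cons, forall_eq_or_imp]
      exact ⟨⟨le_refl _, by omega⟩, h1.1, h1.2⟩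
    · refine ⟨?_, by simp⟩
      simp only [List.mem_cons, forall_eq_or_imp]
      exact ⟨⟨by omega, by omega⟩, h1.2⟩
    · exact nrm_valid h1.2

theorem mulN_valid {m : ℕ} (hm : 3 ≤ m) (b : Bool) {s : St} (h : Valid m s) :
    Valid m (mulN m b s) := by
  rcases s with ⟨k, z, _ | ⟨l, L⟩⟩
  · refine ⟨?_, ?_⟩ <;> simp [mulN]; omega
  · have h1 := h.1
    simp only [List.mem_cons, forall_eq_or_imp] at h1
    simp only [mulN]
    split_ifs with h2 h3
    · refine ⟨?_, by simp⟩
      simp only [List.mem_cons, forall_eq_or_imp]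
      exact ⟨⟨by omega, by omega⟩, h1.2⟩
    · exact nrm_valid h1.2
    · refine ⟨?_, by simp⟩
      simp only [List.mem_cons, forall_eq_or_imp]
      exact ⟨⟨by omega, by omega⟩, h1.1, h1.2⟩

theorem mulN_mulP {m : ℕ} (hm : 3 ≤ m) (b : Bool) {s : St} (h : Valid m s) :
    mulN m b (mulP m b s) = s := by
  rcases s with ⟨k, z, _ | ⟨l, L⟩⟩
  · have := h.2 rfl
    simp only at this
    simp [mulP, mulN, nrm, this]
  · have h1 := h.1
    simp only [List.mem_cons, forall_eq_or_imp] at h1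
    simp only [mulP]
    split_ifs with h2 h3
    · subst h2; simp [mulN, nrm]
    · have h5 : (!b) = z := by cases b <;> cases z <;> simp_all
      have : 2 ≤ l + 1 := by omega
      simp [mulN, this, h5]
    · have h4 : l = m - 1 := by omega
      have h5 : (!b) = z := by cases b <;> cases z <;> simp_all
      cases L with
      | nil => simp [nrm, mulN, h4, h5]
      | cons l' L' => simp [nrm, mulN, h2, h4, h5]

theorem mulP_mulN {m : ℕ} (hm : 3 ≤ m) (b : Bool) {s : St} (h : Valid m s) :
    mulP m b (mulN m b s) = s := by
  rcases s with ⟨k, z, _ | ⟨l, L⟩⟩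
  · have := h.2 rfl
    simp only at this
    have h6 : ¬ (m - 1 + 1 < m) := by omega
    simp [mulP, mulN, nrm, this, h6]
  · have h1 := h.1
    simp only [List.mem_cons, forall_eq_or_imp] at h1
    simp only [mulN]
    split_ifs with h2 h3
    · subst h2
      have h4 : l - 1 + 1 < m := by omega
      have h5 : l - 1 + 1 = l := by omega
      have h6 : l < m := by omega
      simp [mulP, h5, h6]
    · have h4 : l = 1 := by omega
      cases L with
      | nil => simp [nrm, mulP, h4, h2]
      | cons l' L' => simp [nrm, mulP, h2, h4]
    · have h5 : (!b) = z := by cases b <;> cases z <;> simp_all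
      have h6 : ¬ (m - 1 + 1 < m) := by omega
      simp [mulP, nrm, h5, h6, h2]

/-- act by the alternating word of length `j` starting with `b`. -/
def act (m : ℕ) : ℕ → Bool → St → St
  | 0, _, s => s
  | j + 1, b, s => act m j (!b) (mulP m b s)

theorem act_succ' (m j : ℕ) (b : Bool) (s : St) :
    act m (j + 1) b s = mulP m (Bool.not^[j] b) (act m j b s) := by
  induction j generalizing b s with
  | zero => rfl
  | succ j ih => 
    rw [act, ih, Function.iterate_succ_apply]; rfl

theorem act_grow (m : ℕ) (k : ℤ) (z : Bool) (L : List ℕ) (j l : ℕ) (h : l + j < m) :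
    act m j (!z) ⟨k, z, l :: L⟩ = ⟨k, Bool.not^[j] z, (l + j) :: L⟩ := by
  induction j generalizing z l with
  | zero => rfl
  | succ j ih =>
    have h1 : l + 1 < m := by omega
    have h2 : ¬ (z = !z) := by cases z <;> simp
    rw [act]
    simp only [mulP, h2, if_false, h1, if_true]
    rw [ih (!z) (l + 1) (by omega)]
    rw [Function.iterate_succ_apply]
    congr 2; omega

theorem not_iter_add_two (j : ℕ) (z : Bool) : Bool.not^[j+2] z = Bool.not^[j] z := by
  rw [Function.iterate_succ_apply, Function.iterate_succ_apply, Bool.not_not]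

theorem not_iter_not (j : ℕ) (z : Bool) : Bool.not^[j] (!z) = !(Bool.not^[j] z) := by
  rw [← Function.iterate_succ_apply, Function.iterate_succ_apply']

theorem not_iter_iter (j : ℕ) (z : Bool) : Bool.not^[j] (Bool.not^[j] z) = z := by
  induction j generalizing z with
  | zero => rfl
  | succ j ih => rw [Function.iterate_succ_apply, ← not_iter_not, Function.iterate_succ_apply, Bool.not_not, ih]

theorem act_add (m i j : ℕ) (b : Bool) (s : St) :
    act m (i + j) b s = act m j (Bool.not^[i] b) (act m i b s) := by
  induction i generalizing b s with
  | zero => simp [act]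
  | succ i ih =>
    rw [show i + 1 + j = (i + j) + 1 by omega, act, ih, Function.iterate_succ_apply]; rfl

theorem mulP_push (m : ℕ) (k : ℤ) (z : Bool) (L : List ℕ) :
    mulP m z (nrm k z L) = ⟨k, z, 1 :: L⟩ := by
  cases L <;> simp [nrm, mulP]

theorem act_full_aux {m : ℕ} (hm : 3 ≤ m) (k : ℤ) (z : Bool) (L : List ℕ) :
    act m m z (nrm k z L) = nrm (k+1) (Bool.not^[m] z) L := by
  obtain ⟨p, rfl⟩ : ∃ p, m = p + 2 := ⟨m - 2, by omega⟩
  rw [act_succ', act, mulP_push, act_grow _ _ _ _ _ _ (by omega)]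
  have h2 : ¬ (Bool.not^[p] z = Bool.not^[p+1] z) := by
    rw [Function.iterate_succ_apply, not_iter_not]; cases Bool.not^[p] z <;> simp
  simp only [mulP, h2, if_false]
  rw [if_neg (by omega), not_iter_add_two]

theorem act_full {m : ℕ} (hm : 3 ≤ m) (b : Bool) {s : St} (h : Valid m s) :
    act m m b s = nrm (s.k + 1) (Bool.not^[m] s.z) s.L := by
  rcases s with ⟨k, z, _ | ⟨l, L⟩⟩
  · have := act_full_aux hm k b []
    have hz : z = true := h.2 rfl
    subst hz
    simpa [nrm] using this
  · by_cases hb : z = b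
    · subst hb; exact act_full_aux hm k z (l :: L)
    · have hb' : b = !z := by cases b <;> cases z <;> simp_all
      have h1 := h.1 l (by simp)
      obtain ⟨p, hp⟩ : ∃ p, m = p + 1 + l := ⟨m - 1 - l, by omega⟩
      obtain ⟨q, rfl⟩ : ∃ q, l = q + 1 := ⟨l - 1, by omega⟩
      have e1 : act m m b ⟨k, z, (q+1) :: L⟩ =
          act m (p + 1 + (q+1)) b ⟨k, z, (q+1) :: L⟩ := by rw [← hp]
      rw [e1, act_add, act_succ' m p b, hb', act_grow m k z L p (q+1) (by omega)]
      have h2 : ¬ (Bool.not^[p] z = Bool.not^[p] (!z)) := by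
        rw [not_iter_not]; cases Bool.not^[p] z <;> simp
      simp only [mulP, h2, if_false]
      rw [if_neg (by omega), act, Function.iterate_succ_apply, Bool.not_not, mulP_push, act_grow _ _ _ _ _ _ (by omega)]
      simp only [nrm]
      have h3 : Bool.not^[m] z = Bool.not^[q] (Bool.not^[p] z) := by
        rw [hp, show p + 1 + (q + 1) = (q + p) + 2 by omega, not_iter_add_two, Function.iterate_add_apply]
      rw [h3, show 1 + q = q + 1 by omega]

end St

/-- valid states -/
def VS (m : ℕ) := {s : St // s.Valid m}

def rho (m : ℕ) (hm : 3 ≤ m) (b : Bool) : Equiv.Perm (VS m) where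
  toFun s := ⟨s.1.mulP m b, St.mulP_valid hm b s.2⟩
  invFun s := ⟨s.1.mulN m b, St.mulN_valid hm b s.2⟩
  left_inv s := Subtype.ext (St.mulN_mulP hm b s.2)
  right_inv s := Subtype.ext (St.mulP_mulN hm b s.2)

/-- the dihedral Artin group -/
abbrev D2 (m : ℕ) : Type := PresentedGroup ({altProd m (FreeGroup.of true) (FreeGroup.of false) *
  (altProd m (FreeGroup.of false) (FreeGroup.of true))⁻¹} : Set (FreeGroup Bool))

theorem map_altProd {G H : Type*} [Monoid G] [Monoid H] (f : G →* H) (n : ℕ) (x y : G) :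
    f (altProd n x y) = altProd n (f x) (f y) := by
  induction n generalizing x y with
  | zero => simp [altProd]
  | succ n ih => simp [altProd, ih]

namespace D2
variable (m : ℕ)

def x (b : Bool) : D2 m := PresentedGroup.of b

theorem rel : altProd m (x m true) (x m false) = altProd m (x m false) (x m true) := by
  have h : PresentedGroup.mk ({altProd m (FreeGroup.of true) (FreeGroup.of false) *
  (altProd m (FreeGroup.of false) (FreeGroup.of true))⁻¹} : Set (FreeGroup Bool)) (altProd m (FreeGroup.of true) (FreeGroup.of false) *
  (altProd m (FreeGroup.of false) (FreeGroup.of true))⁻¹) = 1 := by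
    apply PresentedGroup.one_of_mem; simp
  rw [map_mul, map_inv, mul_inv_eq_one, map_altProd, map_altProd] at h
  exact h

theorem exists_lift {H : Type*} [Group H] (f : Bool → H)
    (hf : altProd m (f true) (f false) = altProd m (f false) (f true)) :
    ∃ φ : D2 m →* H, ∀ b, φ (x m b) = f b := by
  refine ⟨PresentedGroup.toGroup (f := f) ?_, fun b => PresentedGroup.toGroup.of _⟩
  rintro r rfl
  rw [map_mul, map_inv, mul_inv_eq_one, map_altProd, map_altProd]
  simpa using hf

theorem closure_x : Subgroup.closure (Set.range (x m)) = ⊤ := PresentedGroup.closure_range_of _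

end D2

theorem altProd_op_apply (m : ℕ) (hm : 3 ≤ m) (j : ℕ) (b : Bool) (s : VS m) :
    ((altProd j (MulOpposite.op (rho m hm b)) (MulOpposite.op (rho m hm (!b)))).unop s).1 =
      St.act m j b s.1 := by
  induction j generalizing b s with
  | zero => rfl
  | succ j ih =>
    rw [altProd, MulOpposite.unop_mul, Equiv.Perm.mul_apply]
    have := ih (!b) (rho m hm b s)
    rw [Bool.not_not] at this
    exact this

theorem exists_theta (m : ℕ) (hm : 3 ≤ m) :
    ∃ φ : D2 m →* (Equiv.Perm (VS m))ᵐᵒᵖ, ∀ b, φ (D2.x m b) = MulOpposite.op (rho m hm b) := by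
  apply D2.exists_lift
  apply MulOpposite.unop_injective
  ext1 s
  apply Subtype.ext
  have h1 := altProd_op_apply m hm m true s
  have h2 := altProd_op_apply m hm m false s
  rw [St.act_full hm _ s.2] at h1 h2
  exact h1.trans h2.symm

noncomputable def theta (m : ℕ) (hm : 3 ≤ m) := (exists_theta m hm).choose

/-- right action of the dihedral group on states -/
noncomputable def ra {m : ℕ} (hm : 3 ≤ m) (s : VS m) (v : D2 m) : VS m := (theta m hm v).unop s

section
variable {m : ℕ} (hm : 3 ≤ m)
theorem ra_x (s : VS m) (b : Bool) : (ra hm s (D2.x m b)).1 = s.1.mulP m b := by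
  rw [ra, theta, (exists_theta m hm).choose_spec]; rfl
theorem ra_mul (s : VS m) (v w : D2 m) : ra hm s (v * w) = ra hm (ra hm s v) w := by
  simp [ra]
theorem ra_one (s : VS m) : ra hm s 1 = s := by simp [ra]
theorem ra_x_inv (s : VS m) (b : Bool) : (ra hm s (D2.x m b)⁻¹).1 = s.1.mulN m b := by
  rw [ra, map_inv, theta, (exists_theta m hm).choose_spec]; rfl

def base (m : ℕ) : VS m := ⟨⟨0, true, []⟩, by simp [St.Valid]⟩

/-- state of an element -/
noncomputable def st (v : D2 m) : St := (ra hm (base m) v).1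
theorem st_valid (v : D2 m) : (st hm v).Valid m := (ra hm (base m) v).2
theorem st_one : st hm (1 : D2 m) = ⟨0, true, []⟩ := by rw [st, ra_one]; rfl
theorem st_mul_x (v : D2 m) (b : Bool) : st hm (v * D2.x m b) = (st hm v).mulP m b := by
  rw [st, ra_mul, ra_x]; rfl
theorem st_mul_x_inv (v : D2 m) (b : Bool) : st hm (v * (D2.x m b)⁻¹) = (st hm v).mulN m b := by
  rw [st, ra_mul, ra_x_inv]; rfl
end

/-! evaluation of states -/
section
variable (m : ℕ)
def altEnd : ℕ → Bool → D2 m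
  | 0, _ => 1
  | l + 1, z => altEnd l (!z) * D2.x m z

def Del : D2 m := altProd m (D2.x m true) (D2.x m false)

theorem Del_eq (b : Bool) : altProd m (D2.x m b) (D2.x m (!b)) = Del m := by
  cases b
  · exact (D2.rel m).symm
  · rfl

theorem altProd_succ_right {G : Type*} [Monoid G] (f : Bool → G) (j : ℕ) (b : Bool) :
    altProd (j+1) (f b) (f (!b)) = altProd j (f b) (f (!b)) * f (Bool.not^[j] b) := by
  induction j generalizing b with
  | zero => simp [altProd]
  | succ j ih =>
    have := ih (!b)
    rw [Bool.not_not] at this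
    rw [altProd, this, altProd, mul_assoc, Function.iterate_succ_apply]

theorem altEnd_eq (j : ℕ) (z : Bool) :
    altEnd m j z = altProd j (D2.x m (Bool.not^[j+1] z)) (D2.x m (!Bool.not^[j+1] z)) := by
  induction j generalizing z with
  | zero => simp [altEnd, altProd]
  | succ j ih =>
    rw [altEnd, ih, altProd_succ_right (D2.x m), ← Function.iterate_succ_apply, ← Function.iterate_add_apply]
    congr 2
    rw [show j + (j + 1 + 1) = (j + 1) + (j + 1) by omega, Function.iterate_add_apply, St.not_iter_iter]

theorem altEnd_full (z : Bool) : altEnd m m z = Del m := by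
  rw [altEnd_eq, Del_eq]

theorem x_mul_Del (z : Bool) : D2.x m (Bool.not^[m] z) * Del m = Del m * D2.x m z := by
  have h1 := altEnd_eq m (m+1) z
  rw [altEnd, altEnd_full, St.not_iter_add_two, altProd] at h1
  rw [h1]
  congr 1
  have := Del_eq m (!(Bool.not^[m] z))
  rw [Bool.not_not] at this
  exact this.symm

def Wd : Bool → List ℕ → D2 m
  | _, [] => 1
  | z, l :: L => Wd (Bool.not^[l+1] z) L * altEnd m l z

theorem Wd_mul_Del (z : Bool) (L : List ℕ) : Wd m (Bool.not^[m] z) L * Del m = Del m * Wd m z L := by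
  have hA : ∀ l z, altEnd m l (Bool.not^[m] z) * Del m = Del m * altEnd m l z := by
    intro l
    induction l with
    | zero => intro z; simp [altEnd]
    | succ l ih =>
      intro z
      rw [altEnd, altEnd, mul_assoc, x_mul_Del, ← mul_assoc, ← St.not_iter_not, ih, mul_assoc]
  induction L generalizing z with
  | nil => simp [Wd]
  | cons l L ih =>
    rw [Wd, Wd, mul_assoc, hA, ← mul_assoc, ← Function.iterate_add_apply, Nat.add_comm, Function.iterate_add_apply, ih, mul_assoc]

def ev (s : St) : D2 m := Del m ^ s.k * Wd m s.z s.L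

theorem ev_nrm (k z L) : ev m (St.nrm k z L) = Del m ^ k * Wd m z L := by
  cases L <;> rfl

theorem ev_mulP {s : St} (h : s.Valid m) (b : Bool) : ev m (s.mulP m b) = ev m s * D2.x m b := by
  rcases s with ⟨k, z, _ | ⟨l, L⟩⟩
  · simp [St.mulP, ev, Wd, altEnd]
  · simp only [St.mulP]
    split_ifs with h2 h3
    · subst h2; simp [ev, Wd, altEnd, mul_assoc]
    · have h5 : (!b) = z := by cases b <;> cases z <;> simp_all
      simp only [ev, Wd, altEnd, h5, mul_assoc]
      rw [show l + 1 + 1 = (l+1) + 1 by rfl, Function.iterate_succ_apply Bool.not (l+1) b, h5]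
    · have h5 : (!b) = z := by cases b <;> cases z <;> simp_all
      have h4 : l + 1 = m := by have := (h.1 l (by simp)).2; omega
      rw [ev_nrm]
      simp only [ev, Wd, mul_assoc]
      have e1 : altEnd m l z * D2.x m b = Del m := by
        rw [← altEnd_full m b, ← h4, altEnd, h5]
      rw [e1, h4, Wd_mul_Del, zpow_add, zpow_one, mul_assoc]

variable {m}
theorem ev_ra (hm : 3 ≤ m) (v : D2 m) (s : VS m) : ev m (ra hm s v).1 = ev m s.1 * v := by
  have hv : v ∈ Subgroup.closure (Set.range (D2.x m)) := by rw [D2.closure_x]; trivial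
  induction hv using Subgroup.closure_induction generalizing s with
  | mem y hy =>
    obtain ⟨b, rfl⟩ := hy
    rw [ra_x, ev_mulP m s.2]
  | one => simp [ra_one]
  | mul a b _ _ ha hb => rw [ra_mul, hb, ha, mul_assoc]
  | inv a _ ha =>
    have := ha (ra hm s a⁻¹)
    rw [← ra_mul, inv_mul_cancel, ra_one] at this
    rw [this, mul_inv_cancel_right]

theorem ev_st (hm : 3 ≤ m) (v : D2 m) : ev m (st hm v) = v := by
  rw [st, ev_ra]; simp [base, ev, Wd]

theorem st_injective (hm : 3 ≤ m) : Function.Injective (st hm) :=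
  Function.LeftInverse.injective (ev_st hm)
end

/-! ### Generalities on word length -/

/-- letters `x_i^{±1}` -/
def lset {ι G : Type*} [Group G] (x : ι → G) : Set G := {g | ∃ i, g = x i ∨ g = (x i)⁻¹}

/-- word length for a family of generators -/
noncomputable def wl {ι G : Type*} [Group G] (x : ι → G) (g : G) : ℕ := wordLength (lset x) g

section WL
variable {ι G : Type*} [Group G] {x : ι → G}

theorem lset_inv {s : G} (h : s ∈ lset x) : s⁻¹ ∈ lset x := by
  obtain ⟨i, h | h⟩ := h
  · exact ⟨i, Or.inr (by rw [h])⟩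
  · exact ⟨i, Or.inl (by rw [h, inv_inv])⟩

theorem mem_lset (i : ι) : x i ∈ lset x := ⟨i, Or.inl rfl⟩
theorem inv_mem_lset (i : ι) : (x i)⁻¹ ∈ lset x := ⟨i, Or.inr rfl⟩

theorem wl_le_length (w : List G) (h : ∀ a ∈ w, a ∈ lset x) : wl x w.prod ≤ w.length :=
  Nat.sInf_le ⟨w, h, rfl, rfl⟩

theorem wl_one : wl x (1 : G) = 0 := by
  have := wl_le_length (x := x) [] (by simp)
  simpa using this

theorem exists_word (hx : Subgroup.closure (Set.range x) = ⊤) (g : G) :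
    ∃ w : List G, (∀ a ∈ w, a ∈ lset x) ∧ w.prod = g := by
  have hg : g ∈ Subgroup.closure (Set.range x) := by rw [hx]; trivial
  induction hg using Subgroup.closure_induction with
  | mem y hy =>
    obtain ⟨i, rfl⟩ := hy
    exact ⟨[x i], by simp [mem_lset], by simp⟩
  | one => exact ⟨[], by simp, by simp⟩
  | mul a b _ _ ha hb =>
    obtain ⟨w, h1, h2⟩ := ha
    obtain ⟨w', h3, h4⟩ := hb
    refine ⟨w ++ w', ?_, by simp [h2, h4]⟩
    intro a ha
    rcases List.mem_append.1 ha with h | h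
    · exact h1 a h
    · exact h3 a h
  | inv a _ ha =>
    obtain ⟨w, h1, h2⟩ := ha
    refine ⟨(w.map (·⁻¹)).reverse, ?_, by rw [← List.prod_inv_reverse, h2]⟩
    intro a ha
    simp only [List.mem_reverse, List.mem_map] at ha
    obtain ⟨c, hc, rfl⟩ := ha
    exact lset_inv (h1 c hc)

theorem wl_spec (hx : Subgroup.closure (Set.range x) = ⊤) (g : G) :
    ∃ w : List G, (∀ a ∈ w, a ∈ lset x) ∧ w.length = wl x g ∧ w.prod = g := by
  have : {N : ℕ | ∃ w : List G, (∀ a ∈ w, a ∈ lset x) ∧ w.length = N ∧ w.prod = g}.Nonempty := by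
    obtain ⟨w, h1, h2⟩ := exists_word hx g
    exact ⟨_, w, h1, rfl, h2⟩
  exact Nat.sInf_mem this


theorem wl_mul_le (hx : Subgroup.closure (Set.range x) = ⊤) (g h : G) : wl x (g * h) ≤ wl x g + wl x h := by
  obtain ⟨w, h1, h2, h3⟩ := wl_spec hx g
  obtain ⟨w', h1', h2', h3'⟩ := wl_spec hx h
  have := wl_le_length (x := x) (w ++ w') (by
    intro a ha
    rcases List.mem_append.1 ha with h | h
    · exact h1 a h
    · exact h1' a h)
  rw [List.prod_append, List.length_append, h2, h2', h3, h3'] at this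
  exact this

theorem wl_inv_le (hx : Subgroup.closure (Set.range x) = ⊤) (g : G) : wl x g⁻¹ ≤ wl x g := by
  obtain ⟨w, h1, h2, h3⟩ := wl_spec hx g
  have := wl_le_length (x := x) ((w.map (·⁻¹)).reverse) (by
    intro a ha
    simp only [List.mem_reverse, List.mem_map] at ha
    obtain ⟨c, hc, rfl⟩ := ha
    exact lset_inv (h1 c hc))
  rw [← List.prod_inv_reverse, h3, List.length_reverse, List.length_map, h2] at this
  exact this

theorem wl_inv (hx : Subgroup.closure (Set.range x) = ⊤) (g : G) : wl x g⁻¹ = wl x g :=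
  le_antisymm (wl_inv_le hx g) (by simpa using wl_inv_le hx g⁻¹)

theorem wl_eq_zero (hx : Subgroup.closure (Set.range x) = ⊤) {g : G} (h : wl x g = 0) : g = 1 := by
  obtain ⟨w, h1, h2, h3⟩ := wl_spec hx g
  rw [h, List.length_eq_zero_iff] at h2
  rw [← h3, h2]; rfl

theorem wl_letter {s : G} (h : s ∈ lset x) : wl x s ≤ 1 := by
  have := wl_le_length (x := x) [s] (by simpa using h)
  simpa using this

theorem wl_mul_letter_le (hx : Subgroup.closure (Set.range x) = ⊤) {s : G} (h : s ∈ lset x) (g : G) : wl x (g * s) ≤ wl x g + 1 :=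
  (wl_mul_le hx g s).trans (by have := wl_letter h; omega)

theorem wl_le_mul_letter (hx : Subgroup.closure (Set.range x) = ⊤) {s : G} (h : s ∈ lset x) (g : G) : wl x g ≤ wl x (g * s) + 1 := by
  have := wl_mul_letter_le hx (lset_inv h) (g * s)
  rwa [mul_inv_cancel_right] at this

theorem wl_succ (hx : Subgroup.closure (Set.range x) = ⊤) {g : G} {N : ℕ} (h : wl x g = N + 1) :
    ∃ s ∈ lset x, wl x (g * s) = N := by
  obtain ⟨w, h1, h2, h3⟩ := wl_spec hx g
  rcases List.eq_nil_or_concat w with rfl | ⟨w', s, rfl⟩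
  · simp at h2; omega
  · have hs : s ∈ lset x := h1 s (by simp)
    refine ⟨s⁻¹, lset_inv hs, ?_⟩
    have e : g * s⁻¹ = w'.prod := by rw [← h3]; simp
    have := wl_le_length (x := x) w' (fun a ha => h1 a (by simp [ha]))
    rw [← e] at this
    have h4 := wl_le_mul_letter hx (lset_inv hs) g
    simp at h2
    omega

theorem wl_le_of_descent (hx : Subgroup.closure (Set.range x) = ⊤) (f : G → ℕ) (h : ∀ g, g ≠ 1 → ∃ s ∈ lset x, f (g * s) + 1 ≤ f g) (g : G) :
    wl x g ≤ f g := by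
  induction hn : f g using Nat.strong_induction_on generalizing g with
  | _ n ih =>
    by_cases hg : g = 1
    · rw [hg, wl_one]; omega
    · obtain ⟨s, hs, h1⟩ := h g hg
      have := ih (f (g * s)) (by omega) (g * s) rfl
      have h4 := wl_le_mul_letter hx hs g
      omega

theorem le_wl (hx : Subgroup.closure (Set.range x) = ⊤) (f : G → ℤ) (h1 : f 1 ≤ 0) (h : ∀ g, ∀ s ∈ lset x, f (g * s) ≤ f g + 1) (g : G) :
    f g ≤ wl x g := by
  induction hn : wl x g generalizing g with
  | zero => rw [wl_eq_zero hx hn]; simpa using h1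
  | succ n ih =>
    obtain ⟨s, hs, h2⟩ := wl_succ hx hn
    have h3 := ih (g * s) h2
    have h4 := h (g * s) _ (lset_inv hs)
    rw [mul_inv_cancel_right] at h4
    push_cast; omega

theorem wl_parity (hx : Subgroup.closure (Set.range x) = ⊤) (χ : G →* ℤˣ) (hχ : ∀ i, χ (x i) = -1) (g : G) : χ g = (-1) ^ wl x g := by
  have hl : ∀ s ∈ lset x, χ s = -1 := by
    rintro s ⟨i, rfl | rfl⟩
    · exact hχ i
    · rw [map_inv, hχ]; simp
  induction hn : wl x g generalizing g with
  | zero => rw [wl_eq_zero hx hn]; simp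
  | succ n ih =>
    obtain ⟨s, hs, h2⟩ := wl_succ hx hn
    have h3 := ih (g * s) h2
    rw [map_mul, hl s hs] at h3
    rw [pow_succ, ← h3]; simp

theorem wl_mul_letter_ne (hx : Subgroup.closure (Set.range x) = ⊤) (χ : G →* ℤˣ) (hχ : ∀ i, χ (x i) = -1) {s : G} (hs : s ∈ lset x) (g : G) :
    wl x (g * s) = wl x g + 1 ∨ wl x (g * s) + 1 = wl x g := by
  have h1 := wl_mul_letter_le hx hs g
  have h2 := wl_le_mul_letter hx hs g
  have h3 : wl x (g * s) ≠ wl x g := by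
    intro h
    have h4 := wl_parity hx χ hχ (g * s)
    rw [h, ← wl_parity hx χ hχ g, map_mul] at h4
    have h5 : χ s = 1 := by simpa using h4
    obtain ⟨i, rfl | rfl⟩ := hs
    · rw [hχ] at h5; exact absurd h5 (by decide)
    · rw [map_inv, hχ] at h5; exact absurd h5 (by decide)
  omega

theorem wl_zpow_le (hx : Subgroup.closure (Set.range x) = ⊤) (i : ι) (t : ℤ) : wl x (x i ^ t) ≤ t.natAbs := by
  have h : ∀ n : ℕ, wl x (x i ^ n) ≤ n := by
    intro n
    induction n with
    | zero => simp [wl_one]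
    | succ n ih => rw [pow_succ]; exact (wl_mul_letter_le hx (mem_lset i) _).trans (by omega)
  rcases Int.natAbs_eq t with h1 | h1
  · rw [h1, zpow_natCast, Int.natAbs_natCast]; exact h _
  · rw [h1, zpow_neg, zpow_natCast, Int.natAbs_neg, Int.natAbs_natCast, wl_inv hx]; exact h _

end WL

theorem int_nolocalmax (f : ℤ → ℕ) (h1 : ∀ t, f (t + 1) = f t + 1 ∨ f (t + 1) + 1 = f t)
    (h2 : ∀ t, f (t + 1) + 1 = f t → f t + 1 = f (t - 1)) :
    ∃ t0 : ℤ, ∀ t, f t = f t0 + (t - t0).natAbs := by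
  obtain ⟨t0, ht0⟩ : ∃ t0, ∀ t, f t0 ≤ f t := by
    exact ⟨Function.argmin f, fun t => Function.argmin_le f t⟩
  refine ⟨t0, ?_⟩
  have hr : ∀ n : ℕ, f (t0 + n) = f t0 + n ∧ f (t0 + n + 1) = f t0 + n + 1 := by
    intro n
    induction n with
    | zero =>
      have := h1 t0
      have := ht0 (t0 + 1)
      simp; omega
    | succ n ih =>
      push_cast
      rw [← add_assoc]
      refine ⟨by rw [ih.2]; omega, ?_⟩
      have h3 := h1 (t0 + n + 1)
      have h4 := h2 (t0 + n + 1)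
      rw [add_sub_cancel_right] at h4
      omega
  have hl : ∀ n : ℕ, f (t0 - n) = f t0 + n ∧ f (t0 - n - 1) = f t0 + n + 1 := by
    intro n
    induction n with
    | zero =>
      have := h1 (t0 - 1)
      have := ht0 (t0 - 1)
      rw [sub_add_cancel] at *
      simp; omega
    | succ n ih =>
      push_cast
      rw [← sub_sub]
      refine ⟨by rw [ih.2]; omega, ?_⟩
      have h3 := h1 (t0 - n - 1 - 1)
      have h4 := h2 (t0 - n - 1)
      rw [sub_add_cancel] at *
      omega
  intro t
  rcases le_total t0 t with h | h
  · have := (hr (t - t0).toNat).1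
    rw [show t0 + ((t - t0).toNat : ℤ) = t by omega] at this
    omega
  · have := (hl (t0 - t).toNat).1
    rw [show t0 - ((t0 - t).toNat : ℤ) = t by omega] at this
    omega

set_option linter.unusedVariables false

/-! ### Lengths in dihedral Artin groups -/
namespace St

/-- the linear functionals whose maximum is the word length -/
def F (m c : ℕ) (s : St) : ℤ :=
  -s.k * (m - 2 * c) + (s.L.map (fun l : ℕ => (c : ℤ) - |(l : ℤ) - c|)).sum

def lam (b : Bool) : St → ℕ
  | ⟨_, _, []⟩ => 0
  | ⟨_, z, l :: _⟩ => if z = b then 0 else l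

def mu (m : ℕ) (b : Bool) : St → ℕ
  | ⟨_, _, []⟩ => m - 1
  | ⟨_, z, l :: _⟩ => if z = b then l - 1 else m - 1

theorem F_nrm (m c : ℕ) (k z L) : F m c (nrm k z L) =
  -k * (m - 2 * c) + (L.map (fun l : ℕ => (c : ℤ) - |(l : ℤ) - c|)).sum := by simp [F]

theorem F_mulP {m : ℕ} (hm : 3 ≤ m) {c : ℕ} (hc : c ≤ m) (b : Bool) {s : St} (h : Valid m s) :
    F m c (mulP m b s) = F m c s + (if lam b s < c then 1 else -1) := by
  rcases s with ⟨k, z, _ | ⟨l, L⟩⟩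
  · simp only [mulP, F, lam, List.map_cons, List.map_nil, List.sum_cons, List.sum_nil]
    by_cases h0 : 0 < c
    · rw [abs_of_nonpos (by push_cast; omega)]; simp [h0]
    · have : c = 0 := by omega
      subst this; simp
  · have h1 := h.1 l (by simp)
    simp only [mulP, lam]
    by_cases h2 : z = b
    · simp only [h2, if_true]
      simp only [F, List.map_cons, List.sum_cons]
      split_ifs <;> [rw [abs_of_nonpos (a := ((1:ℕ):ℤ) - c) (by push_cast; omega)]; rw [abs_of_nonneg (a := ((1:ℕ):ℤ) - c) (by push_cast; omega)]]
      all_goals push_cast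
      all_goals ring_nf
      have : (c:ℤ) = 0 := by omega
      simp [this]
    · simp only [h2, if_false]
      split_ifs with h3 h4 h4
      · simp only [F, List.map_cons, List.sum_cons]
        rw [abs_of_nonpos (by push_cast; omega), abs_of_nonpos (by omega)]
        push_cast; ring
      · simp only [F, List.map_cons, List.sum_cons]
        rw [abs_of_nonneg (by push_cast; omega), abs_of_nonneg (by omega)]
        push_cast; ring
      · rw [F_nrm]
        simp only [F, List.map_cons, List.sum_cons]
        have h5 : c = m := by omega
        have h6 : (l:ℤ) = m - 1 := by omega
        rw [abs_of_nonpos (by omega), h6, h5]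
        ring
      · rw [F_nrm]
        simp only [F, List.map_cons, List.sum_cons]
        have h6 : (l:ℤ) = m - 1 := by omega
        rw [abs_of_nonneg (by omega), h6]
        ring

theorem lam_mulN {m : ℕ} (hm : 3 ≤ m) (b : Bool) {s : St} (h : Valid m s) :
    lam b (mulN m b s) = mu m b s := by
  rcases s with ⟨k, z, _ | ⟨l, L⟩⟩
  · simp [mulN, lam, mu]
  · have h1 := h.1 l (by simp)
    simp only [mulN, mu]
    split_ifs with h2 h3
    · simp [lam]
    · have : l = 1 := by omega
      cases L <;> simp [nrm, lam, h2, this]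
    · simp [lam]

theorem F_mulN {m : ℕ} (hm : 3 ≤ m) {c : ℕ} (hc : c ≤ m) (b : Bool) {s : St} (h : Valid m s) :
    F m c (mulN m b s) = F m c s - (if mu m b s < c then 1 else -1) := by
  have h1 := F_mulP hm hc b (mulN_valid hm b h)
  rw [mulP_mulN hm b h, lam_mulN hm b h] at h1
  linarith

theorem lam_le_mu {m : ℕ} (hm : 3 ≤ m) (b : Bool) {s : St} (h : Valid m s) :
    lam b s ≤ mu m b s := by
  rcases s with ⟨k, z, _ | ⟨l, L⟩⟩
  · simp [lam, mu]
  · have h1 := h.1 l (by simp)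
    simp only [lam, mu]
    split_ifs <;> omega

theorem mu_lt {m : ℕ} (hm : 3 ≤ m) (b : Bool) {s : St} (h : Valid m s) : mu m b s < m := by
  rcases s with ⟨k, z, _ | ⟨l, L⟩⟩
  · simp [mu]; omega
  · have h1 := h.1 l (by simp)
    simp only [mu]
    split_ifs <;> omega

/-- half the slope of `c ↦ F c` -/
def dF (c : ℕ) (s : St) : ℤ := s.k + (s.L.map (fun l : ℕ => if c < l then (1:ℤ) else 0)).sum

theorem F_succ (m c : ℕ) (s : St) : F m (c + 1) s = F m c s + 2 * dF c s := by
  rcases s with ⟨k, z, L⟩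
  simp only [F, dF]
  have : ∀ L : List ℕ, (L.map (fun l : ℕ => ((c+1:ℕ) : ℤ) - |(l : ℤ) - (c+1:ℕ)|)).sum =
    (L.map (fun l : ℕ => (c : ℤ) - |(l : ℤ) - c|)).sum +
      2 * (L.map (fun l : ℕ => if c < l then (1:ℤ) else 0)).sum := by
    intro L
    induction L with
    | nil => simp
    | cons l L ih =>
      simp only [List.map_cons, List.sum_cons, ih]
      split_ifs with h
      · rw [abs_of_nonneg (by push_cast; omega), abs_of_nonneg (by omega)]; push_cast; ring
      · rw [abs_of_nonpos (by push_cast; omega), abs_of_nonpos (by omega)]; push_cast; ring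
  rw [this]; push_cast; ring

theorem dF_anti (s : St) {c d : ℕ} (h : c ≤ d) : dF d s ≤ dF c s := by
  rcases s with ⟨k, z, L⟩
  simp only [dF]
  have : (L.map (fun l : ℕ => if d < l then (1:ℤ) else 0)).sum ≤
      (L.map (fun l : ℕ => if c < l then (1:ℤ) else 0)).sum := by
    induction L with
    | nil => simp
    | cons l L ih =>
      simp only [List.map_cons, List.sum_cons]
      split_ifs <;> omega
  omega

theorem dF_strict (k : ℤ) (z : Bool) (l : ℕ) (L : List ℕ) (hl : 1 ≤ l) :
    dF l ⟨k, z, l :: L⟩ + 1 ≤ dF (l - 1) ⟨k, z, l :: L⟩ := by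
  have := dF_anti ⟨k, z, L⟩ (show l - 1 ≤ l by omega)
  simp only [dF, List.map_cons, List.sum_cons] at *
  rw [if_neg (by omega), if_pos (by omega)]
  omega

/-- the length of a state -/
def N (m : ℕ) (s : St) : ℤ := (Finset.range (m + 1)).sup' ⟨0, by simp⟩ (fun c => F m c s)

theorem F_le_N {m c : ℕ} (h : c ≤ m) (s : St) : F m c s ≤ N m s :=
  Finset.le_sup' (fun c => F m c s) (by simp; omega)

theorem exists_N (m : ℕ) (s : St) : ∃ c ≤ m, N m s = F m c s := by
  obtain ⟨c, hc, h⟩ := Finset.exists_mem_eq_sup' (s := Finset.range (m + 1)) ⟨0, by simp⟩ (fun c => F m c s)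
  exact ⟨c, by simp at hc; omega, h⟩

theorem F_zero (m : ℕ) {s : St} : F m 0 s = - F m m s - (s.L.map (fun l : ℕ => (|(l:ℤ)| - m + |(l:ℤ) - m|))).sum := by
  rcases s with ⟨k, z, L⟩
  simp only [F]
  have : ∀ L : List ℕ, (L.map (fun l : ℕ => ((0:ℕ) : ℤ) - |(l : ℤ) - (0:ℕ)|)).sum =
    -(L.map (fun l : ℕ => (m : ℤ) - |(l : ℤ) - m|)).sum -
       (L.map (fun l : ℕ => (|(l:ℤ)| - m + |(l:ℤ) - m|))).sum := by
    intro L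
    induction L with
    | nil => simp
    | cons l L ih =>
      simp only [List.map_cons, List.sum_cons, ih]
      simp
      ring
  rw [this]; push_cast; ring

theorem F_zero_neg {m : ℕ} {s : St} (h : Valid m s) : F m 0 s = - F m m s := by
  have : (s.L.map (fun l : ℕ => (|(l:ℤ)| - m + |(l:ℤ) - m|))).sum = 0 := by
    apply List.sum_eq_zero
    simp only [List.mem_map]
    rintro x ⟨l, hl, rfl⟩
    have := h.1 l hl
    rw [abs_of_nonneg (by omega), abs_of_nonpos (by omega)]; ring
  rw [F_zero, this]; ring

theorem N_nonneg {m : ℕ} {s : St} (h : Valid m s) : 0 ≤ N m s := by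
  have h1 := F_le_N (m := m) (c := 0) (by omega) s
  have h2 := F_le_N (m := m) (c := m) (by omega) s
  have h3 := F_zero_neg h
  omega

theorem F_parity (m c d : ℕ) (s : St) (h : c ≤ d) : ∃ e, F m d s = F m c s + 2 * e := by
  induction d, h using Nat.le_induction with
  | base => exact ⟨0, by ring⟩
  | succ d _ ih =>
    obtain ⟨e, he⟩ := ih
    exact ⟨e + dF d s, by rw [F_succ, he]; ring⟩

theorem F_incr (m c d : ℕ) (s : St) (h : c ≤ d) (hd : ∀ e, c ≤ e → e < d → 1 ≤ dF e s) :
    F m c s + 2 * (d - c : ℕ) ≤ F m d s := by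
  induction d, h using Nat.le_induction with
  | base => simp
  | succ d hc ih =>
    have := ih (fun e h1 h2 => hd e h1 (by omega))
    have := hd d hc (by omega)
    rw [F_succ]; 
    have : ((d + 1 - c : ℕ) : ℤ) = (d - c : ℕ) + 1 := by omega
    omega

theorem F_decr (m c d : ℕ) (s : St) (h : c ≤ d) (hd : ∀ e, c ≤ e → e < d → dF e s ≤ -1) :
    F m d s + 2 * (d - c : ℕ) ≤ F m c s := by
  induction d, h using Nat.le_induction with
  | base => simp
  | succ d hc ih =>
    have := ih (fun e h1 h2 => hd e h1 (by omega))
    have := hd d hc (by omega)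
    rw [F_succ]; 
    have : ((d + 1 - c : ℕ) : ℤ) = (d - c : ℕ) + 1 := by omega
    omega

/-- A threshold for the set of maximisers gives a descent. -/
theorem N_descend {m : ℕ} {s s' : St} 
    (h : ∀ c ≤ m, F m c s' = F m c s - 1 ∨ (F m c s' = F m c s + 1 ∧ F m c s + 2 ≤ N m s)) :
    N m s' + 1 ≤ N m s := by
  obtain ⟨c, hc, e⟩ := exists_N m s'
  have h1 := F_le_N hc s
  have := h c hc
  omega

theorem exists_descend {m : ℕ} (hm : 3 ≤ m) {s : St} (h : Valid m s) (hs : s ≠ ⟨0, true, []⟩) :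
    ∃ b, N m (mulP m b s) + 1 ≤ N m s ∨ N m (mulN m b s) + 1 ≤ N m s := by
  rcases s with ⟨k, z, _ | ⟨l, L⟩⟩
  · have hz : z = true := h.2 rfl
    subst hz
    have hk : k ≠ 0 := by rintro rfl; exact hs rfl
    have hd : ∀ e, dF e ⟨k, true, []⟩ = k := by intro e; simp [dF]
    refine ⟨true, ?_⟩
    rcases lt_or_gt_of_ne hk with h1 | h1
    · left
      apply N_descend
      intro c hc
      rw [F_mulP hm hc true h]
      split_ifs with h2
      · right
        refine ⟨rfl, ?_⟩
        have h3 := F_decr m 0 c ⟨k, true, []⟩ (by omega) (fun e _ _ => by rw [hd]; omega)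
        have h4 := F_le_N (m := m) (c := 0) (by omega) ⟨k, true, []⟩
        omega
      · left; ring
    · right
      apply N_descend
      intro c hc
      rw [F_mulN hm hc true h]
      split_ifs with h2
      · left; ring
      · right
        refine ⟨by ring, ?_⟩
        have h3 := F_incr m c m ⟨k, true, []⟩ (by omega) (fun e _ _ => by rw [hd]; omega)
        have h4 := F_le_N (m := m) (c := m) (by omega) ⟨k, true, []⟩
        simp only [mu] at h2
        omega
  · have hl := h.1 l (by simp)
    have h5 := dF_strict k z l L hl.1
    by_cases h1 : dF l ⟨k, z, l :: L⟩ ≤ -1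
    · refine ⟨!z, Or.inl ?_⟩
      apply N_descend
      intro c hc
      rw [F_mulP hm hc _ h]
      split_ifs with h2
      · right
        refine ⟨rfl, ?_⟩
        have h6 : l < c := by simpa [lam] using h2
        have h3 := F_decr m l c ⟨k, z, l :: L⟩ (by omega) (fun e he _ => by
          have := dF_anti ⟨k, z, l :: L⟩ he; omega)
        have h4 := F_le_N (m := m) (c := l) (by omega) ⟨k, z, l :: L⟩
        omega
      · left; ring
    · refine ⟨z, Or.inr ?_⟩
      apply N_descend
      intro c hc
      rw [F_mulN hm hc _ h]
      split_ifs with h2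
      · left; ring
      · right
        refine ⟨by ring, ?_⟩
        have h6 : c ≤ l - 1 := by simpa [mu] using h2
        have h3 := F_incr m c l ⟨k, z, l :: L⟩ (by omega) (fun e _ he => by
          have := dF_anti ⟨k, z, l :: L⟩ (show e ≤ l - 1 by omega); omega)
        have h4 := F_le_N (m := m) (c := l) (by omega) ⟨k, z, l :: L⟩
        omega

end St

section
variable {m : ℕ} (hm : 3 ≤ m)

theorem F_le_wl {c : ℕ} (hc : c ≤ m) (v : D2 m) : (st hm v).F m c ≤ wl (D2.x m) v := by
  apply le_wl (D2.closure_x m) (fun v => (st hm v).F m c)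
  · simp [st_one, St.F]
  · rintro g s ⟨b, rfl | rfl⟩
    · simp only [st_mul_x, St.F_mulP hm hc b (st_valid hm g)]
      split_ifs <;> omega
    · simp only [st_mul_x_inv, St.F_mulN hm hc b (st_valid hm g)]
      split_ifs <;> omega

theorem wl_eq_N (v : D2 m) : (wl (D2.x m) v : ℤ) = (st hm v).N m := by
  apply le_antisymm
  · have := wl_le_of_descent (D2.closure_x m) (fun v => ((st hm v).N m).toNat) (by
      intro g hg
      have hs : st hm g ≠ ⟨0, true, []⟩ := by
        rw [← st_one hm]; exact fun h => hg (st_injective hm h)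
      obtain ⟨b, h | h⟩ := St.exists_descend hm (st_valid hm g) hs
      · refine ⟨_, mem_lset b, ?_⟩
        rw [← st_mul_x] at h
        have := St.N_nonneg (st_valid hm (g * D2.x m b))
        omega
      · refine ⟨_, inv_mem_lset b, ?_⟩
        rw [← st_mul_x_inv] at h
        have := St.N_nonneg (st_valid hm (g * (D2.x m b)⁻¹))
        omega) v
    have h2 := St.N_nonneg (st_valid hm v)
    omega
  · obtain ⟨c, hc, h⟩ := St.exists_N m (st hm v)
    rw [h]; exact F_le_wl hm hc v

theorem exists_F_eq (v : D2 m) : ∃ c ≤ m, (st hm v).F m c = wl (D2.x m) v := by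
  obtain ⟨c, hc, h⟩ := St.exists_N m (st hm v)
  exact ⟨c, hc, by rw [wl_eq_N hm, h]⟩

/-- no local maximum along cosets of `⟨x_b⟩` -/
theorem D2_nolocalmax {m : ℕ} (hm : 3 ≤ m) (v : D2 m) (b : Bool) (h1 : wl (D2.x m) (v * D2.x m b) < wl (D2.x m) v)
    (h2 : wl (D2.x m) (v * (D2.x m b)⁻¹) < wl (D2.x m) v) : False := by
  obtain ⟨c, hc, h⟩ := exists_F_eq hm v
  have h3 := F_le_wl hm hc (v * D2.x m b)
  have h4 := F_le_wl hm hc (v * (D2.x m b)⁻¹)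
  rw [st_mul_x, St.F_mulP hm hc b (st_valid hm v)] at h3
  rw [st_mul_x_inv, St.F_mulN hm hc b (st_valid hm v)] at h4
  have h5 := St.lam_le_mu hm b (st_valid hm v)
  split_ifs at h3 h4 <;> omega

end

/-! ### Syllables -/

/-- product of alternating syllables; the head of the list is the exponent of the last syllable -/
def sy {G : Type*} [Group G] (x : Bool → G) : Bool → List ℤ → G
  | _, [] => 1
  | b, e :: es => sy x (!b) es * x b ^ e

def Psum (es : List ℤ) : ℕ := (es.map Int.natAbs).sum
theorem Psum_cons (e : ℤ) (es : List ℤ) : Psum (e :: es) = e.natAbs + Psum es := by simp [Psum]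
def Pcnt (es : List ℤ) : ℕ := es.countP (fun e => decide (0 < e))
def Ncnt (es : List ℤ) : ℕ := es.countP (fun e => decide (e < 0))

theorem wl_sy_le {G : Type*} [Group G] {x : Bool → G} (hx : Subgroup.closure (Set.range x) = ⊤)
    (b : Bool) (es : List ℤ) : wl x (sy x b es) ≤ Psum es := by
  induction es generalizing b with
  | nil => simp [sy, wl_one]
  | cons e es ih =>
    have h1 := wl_mul_le hx (sy x (!b) es) (x b ^ e)
    have h2 := wl_zpow_le hx b e
    have h3 := ih (!b)
    simp only [sy, Psum, List.map_cons, List.sum_cons] at *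
    omega

def Ready (m : ℕ) (b : Bool) (p n : ℕ) (s : St) : Prop :=
  s.L = [] ∨ ∃ l L', s.L = l :: L' ∧ ((s.z = !b ∧ l ≤ p) ∨ (s.z = b ∧ m ≤ l + n))

def PosS (b : Bool) (p : ℕ) (s : St) : Prop := ∃ l L', s.L = l :: L' ∧ s.z = b ∧ l ≤ p + 1
def NegS (m : ℕ) (b : Bool) (n : ℕ) (s : St) : Prop :=
  ∃ l L', s.L = l :: L' ∧ s.z = !b ∧ m ≤ l + (n + 1)

section
variable {m : ℕ} (hm : 3 ≤ m)

theorem pos_step {b : Bool} {p n c : ℕ} {s : St} (hs : s.Valid m) (h : Ready m b p n s) (h1 : p < c) (h2 : c < m) :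
    s.lam b < c ∧ PosS b p (s.mulP m b) := by
  rcases s with ⟨k, z, _ | ⟨l, L⟩⟩
  · exact ⟨by simp [St.lam]; omega, 1, [], rfl, rfl, by omega⟩
  · rcases h with h | ⟨l', L', h, h3⟩
    · simp at h
    · simp only [List.cons.injEq] at h
      obtain ⟨rfl, rfl⟩ := h
      rcases h3 with ⟨h3, h4⟩ | ⟨h3, h4⟩
      · simp only at h3
        subst h3
        have h5 : l + 1 < m := by omega
        refine ⟨by simp [St.lam]; omega, ?_⟩
        simp only [St.mulP, Bool.not_eq_self, if_false, h5, if_true]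
        exact ⟨l + 1, L, rfl, rfl, by omega⟩
      · simp only at h3
        subst h3
        refine ⟨by simp [St.lam]; omega, ?_⟩
        simp only [St.mulP, if_true]
        exact ⟨1, l :: L, rfl, rfl, by omega⟩

theorem pos_step2 {b : Bool} {p c : ℕ} {s : St} (hs : s.Valid m) (h : PosS b p s) (h1 : p < c) :
    s.lam b < c ∧ PosS b p (s.mulP m b) := by
  obtain ⟨l, L', h2, h3, h4⟩ := h
  rcases s with ⟨k, z, L⟩
  simp only at h2 h3
  subst h2; subst h3
  refine ⟨by simp [St.lam]; omega, ?_⟩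
  simp only [St.mulP, if_true]
  exact ⟨1, l :: L', rfl, rfl, by omega⟩

theorem neg_step {b : Bool} {p n c : ℕ} {s : St} (hs : s.Valid m) (h : Ready m b p n s) (h0 : 1 ≤ c) (h1 : n + 1 + c ≤ m) :
    c ≤ s.mu m b ∧ NegS m b n (s.mulN m b) := by
  rcases s with ⟨k, z, _ | ⟨l, L⟩⟩
  · exact ⟨by simp [St.mu]; omega, m - 1, [], rfl, rfl, by omega⟩
  · rcases h with h | ⟨l', L', h, h3⟩
    · simp at h
    · simp only [List.cons.injEq] at h
      obtain ⟨rfl, rfl⟩ := h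
      rcases h3 with ⟨h3, h4⟩ | ⟨h3, h4⟩
      · simp only at h3
        subst h3
        refine ⟨by simp [St.mu]; omega, ?_⟩
        simp only [St.mulN, Bool.not_eq_self, if_false]
        exact ⟨m - 1, l :: L, rfl, rfl, by omega⟩
      · simp only at h3
        subst h3
        have h5 : 2 ≤ l := by omega
        refine ⟨by simp [St.mu]; omega, ?_⟩
        simp only [St.mulN, if_true, h5]
        exact ⟨l - 1, L, rfl, rfl, by omega⟩

theorem neg_step2 {b : Bool} {n c : ℕ} {s : St} (hs : s.Valid m) (h : NegS m b n s) (h1 : c < m) :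
    c ≤ s.mu m b ∧ NegS m b n (s.mulN m b) := by
  obtain ⟨l, L', h2, h3, h4⟩ := h
  rcases s with ⟨k, z, L⟩
  simp only at h2 h3
  subst h2; subst h3
  refine ⟨by simp [St.mu]; omega, ?_⟩
  simp only [St.mulN, Bool.not_eq_self, if_false]
  exact ⟨m - 1, l :: L', rfl, rfl, by omega⟩

theorem pos_syl (v : D2 m) {b : Bool} {p n c : ℕ} (h : Ready m b p n (st hm v)) (h1 : p < c) (h2 : c < m) (e : ℕ) :
    (st hm (v * D2.x m b ^ (e + 1))).F m c = (st hm v).F m c + (e + 1) ∧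
      PosS b p (st hm (v * D2.x m b ^ (e + 1))) := by
  induction e with
  | zero =>
    obtain ⟨h3, h4⟩ := pos_step (st_valid hm v) h h1 h2
    rw [zero_add, pow_one, st_mul_x, St.F_mulP hm h2.le b (st_valid hm v), if_pos h3]
    exact ⟨by simp, h4⟩
  | succ e ih =>
    obtain ⟨h3, h4⟩ := pos_step2 (st_valid hm _) ih.2 h1
    rw [pow_succ, ← mul_assoc, st_mul_x, St.F_mulP hm h2.le b (st_valid hm _), if_pos h3, ih.1]
    exact ⟨by push_cast; ring, h4⟩

theorem neg_syl (v : D2 m) {b : Bool} {p n c : ℕ} (h : Ready m b p n (st hm v)) (h0 : 1 ≤ c) (h1 : n + 1 + c ≤ m) (e : ℕ) :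
    (st hm (v * (D2.x m b)⁻¹ ^ (e + 1))).F m c = (st hm v).F m c + (e + 1) ∧
      NegS m b n (st hm (v * (D2.x m b)⁻¹ ^ (e + 1))) := by
  induction e with
  | zero =>
    obtain ⟨h3, h4⟩ := neg_step (st_valid hm v) h h0 h1
    rw [zero_add, pow_one, st_mul_x_inv, St.F_mulN hm (by omega) b (st_valid hm v), if_neg (by omega)]
    exact ⟨by simp, h4⟩
  | succ e ih =>
    obtain ⟨h3, h4⟩ := neg_step2 (st_valid hm _) ih.2 (show c < m by omega)
    rw [pow_succ, ← mul_assoc, st_mul_x_inv, St.F_mulN hm (by omega) b (st_valid hm _), if_neg (by omega), ih.1]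
    exact ⟨by push_cast; ring, h4⟩

theorem sy_mixed (es : List ℤ) (b : Bool) (h0 : ∀ e ∈ es, e ≠ 0) {c : ℕ} (h1 : 1 ≤ c) (h2 : c < m)
    (h3 : Pcnt es ≤ c) (h4 : Ncnt es + c ≤ m) :
    (st hm (sy (D2.x m) b es)).F m c = Psum es ∧
      Ready m (!b) (Pcnt es) (Ncnt es) (st hm (sy (D2.x m) b es)) := by
  induction es generalizing b with
  | nil => simp [sy, Psum, st_one, St.F, Ready]
  | cons e es ih =>
    have he := h0 e (by simp)
    rcases lt_or_gt_of_ne he with h5 | h5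
    · have h6 : Pcnt (e :: es) = Pcnt es := by
        simp only [Pcnt]; rw [List.countP_cons_of_neg (by simp; omega)]
      have h7 : Ncnt (e :: es) = Ncnt es + 1 := by
        simp only [Ncnt]; rw [List.countP_cons_of_pos (by simp; omega)]
      rw [h6] at h3 ⊢
      rw [h7] at h4 ⊢
      obtain ⟨i1, i2⟩ := ih (!b) (fun a ha => h0 a (by simp [ha])) h3 (by omega)
      rw [Bool.not_not] at i2
      obtain ⟨j1, j2⟩ := neg_syl hm _ i2 h1 (by omega) (e.natAbs - 1)
      rw [Nat.sub_add_cancel (by omega)] at j1 j2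
      have e1 : D2.x m b ^ e = (D2.x m b)⁻¹ ^ e.natAbs := by
        rw [inv_pow, ← zpow_natCast, ← zpow_neg]; congr 1; omega
      rw [sy, e1, j1, i1]
      refine ⟨by rw [Psum_cons]; omega, ?_⟩
      obtain ⟨l, L', k1, k2, k3⟩ := j2
      exact Or.inr ⟨l, L', k1, Or.inr ⟨k2, by omega⟩⟩
    · have h6 : Pcnt (e :: es) = Pcnt es + 1 := by
        simp only [Pcnt]; rw [List.countP_cons_of_pos (by simp; omega)]
      have h7 : Ncnt (e :: es) = Ncnt es := by
        simp only [Ncnt]; rw [List.countP_cons_of_neg (by simp; omega)]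
      rw [h6] at h3 ⊢
      rw [h7] at h4 ⊢
      obtain ⟨i1, i2⟩ := ih (!b) (fun a ha => h0 a (by simp [ha])) (by omega) (by omega)
      rw [Bool.not_not] at i2
      obtain ⟨j1, j2⟩ := pos_syl hm _ i2 (show Pcnt es < c by omega) h2 (e.natAbs - 1)
      rw [Nat.sub_add_cancel (by omega)] at j1 j2
      have e1 : D2.x m b ^ e = (D2.x m b) ^ e.natAbs := by
        rw [← zpow_natCast]; congr 1; omega
      rw [sy, e1, j1, i1]
      refine ⟨by rw [Psum_cons]; omega, ?_⟩
      obtain ⟨l, L', k1, k2, k3⟩ := j2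
      exact Or.inr ⟨l, L', k1, Or.inl ⟨by rw [k2, Bool.not_not], by omega⟩⟩

theorem Fm_mul_x (v : D2 m) (b : Bool) : (st hm (v * D2.x m b)).F m m = (st hm v).F m m + 1 := by
  have h1 := St.lam_le_mu hm b (st_valid hm v)
  have h2 := St.mu_lt hm b (st_valid hm v)
  rw [st_mul_x, St.F_mulP hm le_rfl b (st_valid hm v), if_pos (by omega)]

theorem Fm_mul_x_inv (v : D2 m) (b : Bool) : (st hm (v * (D2.x m b)⁻¹)).F m m = (st hm v).F m m - 1 := by
  have := Fm_mul_x hm (v * (D2.x m b)⁻¹) b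
  rw [inv_mul_cancel_right] at this
  linarith

theorem Fm_mul_zpow (v : D2 m) (b : Bool) (e : ℤ) : (st hm (v * D2.x m b ^ e)).F m m = (st hm v).F m m + e := by
  induction e with
  | zero => simp
  | succ n ih => rw [zpow_add_one, ← mul_assoc, Fm_mul_x, ih]; ring
  | pred n ih => rw [zpow_sub_one, ← mul_assoc, Fm_mul_x_inv, ih]; ring

theorem Fm_sy (b : Bool) (es : List ℤ) : (st hm (sy (D2.x m) b es)).F m m = es.sum := by
  induction es generalizing b with
  | nil => simp [sy, st_one, St.F]
  | cons e es ih => rw [sy, Fm_mul_zpow, ih]; simp; ring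

theorem F0_eq (v : D2 m) : (st hm v).F m 0 = - (st hm v).F m m := St.F_zero_neg (st_valid hm v)

theorem cnt_add {es : List ℤ} (h0 : ∀ e ∈ es, e ≠ 0) : Pcnt es + Ncnt es = es.length := by
  induction es with
  | nil => simp [Pcnt, Ncnt]
  | cons e es ih =>
    have he := h0 e (by simp)
    have := ih (fun a ha => h0 a (by simp [ha]))
    simp only [Pcnt, Ncnt, List.countP_cons, List.length_cons, decide_eq_true_eq] at *
    split_ifs <;> omega

theorem Psum_of_N {es : List ℤ} (h : Ncnt es = 0) : (Psum es : ℤ) = es.sum := by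
  induction es with
  | nil => simp [Psum]
  | cons e es ih =>
    simp only [Ncnt, List.countP_cons, decide_eq_true_eq] at h
    have := ih (by simp only [Ncnt]; omega)
    rw [Psum_cons, List.sum_cons]
    split_ifs at h
    omega

theorem Psum_of_P {es : List ℤ} (h : Pcnt es = 0) : (Psum es : ℤ) = -es.sum := by
  induction es with
  | nil => simp [Psum]
  | cons e es ih =>
    simp only [Pcnt, List.countP_cons, decide_eq_true_eq] at h
    have := ih (by simp only [Pcnt]; omega)
    rw [Psum_cons, List.sum_cons]
    split_ifs at h
    omega

theorem D2_syl {m : ℕ} (hm : 3 ≤ m) (b : Bool) (es : List ℤ) (h0 : ∀ e ∈ es, e ≠ 0) (hl : es.length ≤ m) :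
    wl (D2.x m) (sy (D2.x m) b es) = Psum es := by
  apply le_antisymm (wl_sy_le (D2.closure_x m) b es)
  have h1 := cnt_add h0
  have : (Psum es : ℤ) ≤ wl (D2.x m) (sy (D2.x m) b es) := by
    by_cases hN : Ncnt es = 0
    · rw [Psum_of_N hN, ← Fm_sy hm b]; exact F_le_wl hm le_rfl _
    by_cases hP : Pcnt es = 0
    · rw [Psum_of_P hP, ← Fm_sy hm b, ← F0_eq]; exact F_le_wl hm (by omega) _
    rw [← (sy_mixed hm es b h0 (c := Pcnt es) (by omega) (by omega) le_rfl (by omega)).1]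
    exact F_le_wl hm (by omega) _
  exact_mod_cast this

theorem D2_chi (m : ℕ) : ∃ χ : D2 m →* ℤˣ, ∀ b, χ (D2.x m b) = -1 :=
  D2.exists_lift m (fun _ => -1) rfl

end

theorem exists_r {ι G : Type*} [Group G] {x : ι → G} (hx : Subgroup.closure (Set.range x) = ⊤)
    (hχ : ∃ χ : G →* ℤˣ, ∀ b, χ (x b) = -1) (i : ι)
    (h : ∀ v : G, wl x (v * x i) < wl x v → wl x (v * (x i)⁻¹) < wl x v → False) (v : G) :
    ∃ r : ℤ, ∀ t : ℤ, wl x (v * x i ^ t) = wl x (v * x i ^ (-r)) + (r + t).natAbs := by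
  obtain ⟨χ, hχ⟩ := hχ
  obtain ⟨t0, h0⟩ := int_nolocalmax (fun t => wl x (v * x i ^ t)) (by
    intro t
    have := wl_mul_letter_ne hx χ hχ (mem_lset i) (v * x i ^ t)
    rw [mul_assoc, ← zpow_add_one] at this
    exact this) (by
    intro t ht
    have h1 := wl_mul_letter_ne hx χ hχ (inv_mem_lset i) (v * x i ^ t)
    have h2 := h (v * x i ^ t)
    rw [mul_assoc, ← zpow_add_one, mul_assoc, ← zpow_sub_one] at h2
    rw [mul_assoc, ← zpow_sub_one] at h1
    by_contra h3
    exact h2 (by omega) (by omega))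
  refine ⟨-t0, fun t => ?_⟩
  rw [neg_neg, add_comm (-t0), ← sub_eq_add_neg]
  exact h0 t

/-! ### Permissibility in two-generator groups -/
section
variable {D : Type} [Group D] (x : Bool → D)

def DPos (h : D) : Prop := h ∈ Submonoid.closure ({x true, x false} : Set D)
def DNeg (h : D) : Prop := h ∈ Submonoid.closure ({(x true)⁻¹, (x false)⁻¹} : Set D)
def DDel (m : ℕ) : D := altProd m (x true) (x false)
def DMax (m k : ℕ) (h : D) : Prop :=
  IsLeftDiv (wl x) (DDel x m ^ k) h ∧ ∀ k' : ℕ, IsLeftDiv (wl x) (DDel x m ^ k') h → k' ≤ k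
def DMaxN (m k : ℕ) (h : D) : Prop :=
  IsLeftDiv (wl x) ((DDel x m)⁻¹ ^ k) h ∧ ∀ k' : ℕ, IsLeftDiv (wl x) ((DDel x m)⁻¹ ^ k') h → k' ≤ k
def DTwo (h : D) : Prop := ∃ a ∈ lset x, ∃ b ∈ lset x, ∃ s t : ℕ, h = a ^ s * b ^ t

def PermD (m : ℕ∞) (h₁ h₂ : D) : Prop :=
  wl x h₁ + wl x h₂ = wl x (h₁ * h₂) ∧
  (∀ m' : ℕ, m = (m' : ℕ∞) → (DPos x (h₁ * h₂) ∨ DNeg x (h₁ * h₂)) →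
    (DTwo x h₁ ∨ DTwo x h₂ ∨
     (DPos x (h₁ * h₂) ∧ DPos x h₁ ∧ DPos x h₂ ∧
       ∃ k₁ k₂ : ℕ, DMax x m' k₁ h₁ ∧ DMax x m' k₂ h₂ ∧ DMax x m' (k₁ + k₂) (h₁ * h₂)) ∨
     (DNeg x (h₁ * h₂) ∧ DNeg x h₁ ∧ DNeg x h₂ ∧
       ∃ k₁ k₂ : ℕ, DMaxN x m' k₁ h₁ ∧ DMaxN x m' k₂ h₂ ∧ DMaxN x m' (k₁ + k₂) (h₁ * h₂))))

variable {x}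

theorem DPos_inv {h : D} (hh : DPos x h) : DNeg x h⁻¹ := by
  induction hh using Submonoid.closure_induction with
  | mem y hy =>
    apply Submonoid.subset_closure
    rcases hy with rfl | hy
    · simp
    · rw [Set.mem_singleton_iff] at hy; subst hy; simp
  | one => rw [inv_one]; exact Submonoid.one_mem _
  | mul a b _ _ ha hb => rw [mul_inv_rev]; exact Submonoid.mul_mem _ hb ha

theorem DNeg_inv {h : D} (hh : DNeg x h) : DPos x h⁻¹ := by
  induction hh using Submonoid.closure_induction with
  | mem y hy =>
    apply Submonoid.subset_closure
    rcases hy with rfl | hy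
    · simp
    · rw [Set.mem_singleton_iff] at hy; subst hy; simp
  | one => rw [inv_one]; exact Submonoid.one_mem _
  | mul a b _ _ ha hb => rw [mul_inv_rev]; exact Submonoid.mul_mem _ hb ha

theorem DTwo_inv {h : D} (hh : DTwo x h) : DTwo x h⁻¹ := by
  obtain ⟨a, ha, b, hb, s, t, rfl⟩ := hh
  exact ⟨b⁻¹, lset_inv hb, a⁻¹, lset_inv ha, t, s, by simp⟩

theorem DMax_inv (hx : Subgroup.closure (Set.range x) = ⊤) {m k : ℕ}
    (hD : ∀ (j : ℤ) (v : D), wl x (DDel x m ^ j * v) = wl x (v * DDel x m ^ j)) {h : D} :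
    DMaxN x m k h⁻¹ ↔ DMax x m k h := by
  have key : ∀ k : ℕ, IsLeftDiv (wl x) ((DDel x m)⁻¹ ^ k) h⁻¹ ↔ IsLeftDiv (wl x) (DDel x m ^ k) h := by
    intro k
    unfold IsLeftDiv
    rw [inv_pow, wl_inv hx, wl_inv hx h, inv_inv]
    have h1 : wl x (DDel x m ^ k * h⁻¹) = wl x ((DDel x m ^ k)⁻¹ * h) := by
      rw [← wl_inv hx, mul_inv_rev, inv_inv]
      have := hD (-k) h
      rw [zpow_neg, zpow_natCast] at this
      exact this.symm
    rw [h1]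
  unfold DMax DMaxN
  simp only [key]

theorem PermD_inv (hx : Subgroup.closure (Set.range x) = ⊤) {m : ℕ∞}
    (hD : ∀ m' : ℕ, m = m' → ∀ (j : ℤ) (v : D), wl x (DDel x m' ^ j * v) = wl x (v * DDel x m' ^ j))
    {h₁ h₂ : D} (h : PermD x m h₁ h₂) : PermD x m h₂⁻¹ h₁⁻¹ := by
  obtain ⟨h1, h2⟩ := h
  refine ⟨by rw [← mul_inv_rev, wl_inv hx, wl_inv hx, wl_inv hx, ← h1, add_comm], ?_⟩
  intro m' hm' hp
  rw [← mul_inv_rev] at hp ⊢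
  have hp' : DPos x (h₁ * h₂) ∨ DNeg x (h₁ * h₂) := by
    rcases hp with hp | hp
    · right; simpa using DPos_inv hp
    · left; simpa using DNeg_inv hp
  rcases h2 m' hm' hp' with h | h | ⟨a, b, c, k1, k2, d1, d2, d3⟩ | ⟨a, b, c, k1, k2, d1, d2, d3⟩
  · exact Or.inr (Or.inl (DTwo_inv h))
  · exact Or.inl (DTwo_inv h)
  · refine Or.inr (Or.inr (Or.inr ⟨DPos_inv a, DPos_inv c, DPos_inv b, k2, k1, ?_, ?_, ?_⟩))
    · rwa [DMax_inv hx (hD m' hm')]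
    · rwa [DMax_inv hx (hD m' hm')]
    · rwa [DMax_inv hx (hD m' hm'), add_comm]
  · refine Or.inr (Or.inr (Or.inl ⟨DNeg_inv a, DNeg_inv c, DNeg_inv b, k2, k1, ?_, ?_, ?_⟩))
    · rwa [← DMax_inv hx (hD m' hm'), inv_inv]
    · rwa [← DMax_inv hx (hD m' hm'), inv_inv]
    · rwa [← DMax_inv hx (hD m' hm'), inv_inv, add_comm]
end

/-! ### Shifts by the Garside element -/
namespace St
def shift (j : ℤ) (s : St) : St := ⟨s.k + j, s.z, s.L⟩

theorem shift_mulP (m : ℕ) (j : ℤ) (b : Bool) (s : St) : (s.shift j).mulP m b = (s.mulP m b).shift j := by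
  rcases s with ⟨k, z, _ | ⟨l, _ | ⟨l', L⟩⟩⟩ <;> simp only [shift, mulP, nrm] <;> split_ifs <;>
    simp <;> ring

theorem F_shift (m c : ℕ) (j : ℤ) (s : St) : (s.shift j).F m c = s.F m c - j * (m - 2 * c) := by
  simp only [shift, F]; ring
end St

def VS.shift {m : ℕ} (j : ℤ) (s : VS m) : VS m := ⟨s.1.shift j, s.2⟩

section
variable {m : ℕ} (hm : 3 ≤ m)

theorem ra_shift (v : D2 m) (j : ℤ) (s : VS m) : ra hm (s.shift j) v = (ra hm s v).shift j := by
  have hv : v ∈ Subgroup.closure (Set.range (D2.x m)) := by rw [D2.closure_x]; trivial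
  induction hv using Subgroup.closure_induction generalizing s with
  | mem y hy =>
    obtain ⟨b, rfl⟩ := hy
    apply Subtype.ext
    rw [ra_x]
    simp only [VS.shift, ra_x]
    exact St.shift_mulP m j b s.1
  | one => simp [ra_one]
  | mul a b _ _ ha hb => rw [ra_mul, ha, hb, ra_mul]
  | inv a _ ha =>
    have h1 := ha (ra hm s a⁻¹)
    rw [← ra_mul, inv_mul_cancel, ra_one] at h1
    rw [← h1, ← ra_mul, mul_inv_cancel, ra_one]

theorem ra_altProd (j : ℕ) (b : Bool) (s : VS m) :
    (ra hm s (altProd j (D2.x m b) (D2.x m (!b)))).1 = St.act m j b s.1 := by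
  induction j generalizing b s with
  | zero => rw [altProd, ra_one]; rfl
  | succ j ih =>
    rw [altProd, ra_mul]
    have := ih (!b) (ra hm s (D2.x m b))
    rw [Bool.not_not] at this
    rw [this, ra_x]; rfl

theorem st_mul_Del (v : D2 m) :
    st hm (v * Del m) = St.nrm ((st hm v).k + 1) (Bool.not^[m] (st hm v).z) (st hm v).L := by
  rw [st, ra_mul, Del]
  have := ra_altProd hm m true (ra hm (base m) v)
  rw [Bool.not_true] at this
  rw [this]; exact St.act_full hm _ (ra hm (base m) v).2

theorem st_Del_mul (v : D2 m) : st hm (Del m * v) = (st hm v).shift 1 := by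
  rw [st, ra_mul]
  have : ra hm (base m) (Del m) = (base m).shift 1 := by
    apply Subtype.ext
    have := st_mul_Del hm (1 : D2 m)
    rw [one_mul, st_one] at this
    exact this
  rw [this, ra_shift]; rfl

theorem st_Del_zpow_mul (j : ℤ) (v : D2 m) : st hm (Del m ^ j * v) = (st hm v).shift j := by
  induction j with
  | zero => simp [St.shift]
  | succ n ih =>
    rw [zpow_add_one, ← (Commute.refl (Del m)).zpow_right n |>.eq, mul_assoc, st_Del_mul, ih]
    simp [St.shift]; ring
  | pred n ih =>
    have h1 := st_Del_mul hm (Del m ^ (-(n:ℤ) - 1) * v)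
    rw [← mul_assoc, ← zpow_one_add, show 1 + (-(n:ℤ) - 1) = -n by ring, ih] at h1
    have h2 : (st hm (Del m ^ (-(n:ℤ) - 1) * v)) = ((st hm v).shift (-n)).shift (-1) := by
      rw [h1]; simp [St.shift]
    rw [h2]; simp [St.shift]; ring

theorem stL_mul_Del_zpow (j : ℤ) (v : D2 m) :
    (st hm (v * Del m ^ j)).L = (st hm v).L ∧ (st hm (v * Del m ^ j)).k = (st hm v).k + j := by
  induction j with
  | zero => simp
  | succ n ih =>
    rw [zpow_add_one, ← mul_assoc, st_mul_Del, St.nrm_L, St.nrm_k, ih.1, ih.2]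
    exact ⟨rfl, by ring⟩
  | pred n ih =>
    have h1 := st_mul_Del hm (v * Del m ^ (-(n:ℤ) - 1))
    rw [mul_assoc, ← zpow_add_one, show (-(n:ℤ) - 1) + 1 = -n by ring] at h1
    rw [h1] at ih
    simp at ih
    exact ⟨ih.1, by omega⟩

theorem D2_Del_comm (hm : 3 ≤ m) (j : ℤ) (v : D2 m) : wl (D2.x m) (Del m ^ j * v) = wl (D2.x m) (v * Del m ^ j) := by
  have h : (wl (D2.x m) (Del m ^ j * v) : ℤ) = wl (D2.x m) (v * Del m ^ j) := by
    rw [wl_eq_N hm, wl_eq_N hm, St.N, St.N]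
    congr 1
    funext c
    rw [st_Del_zpow_mul]
    simp only [St.F, St.shift, stL_mul_Del_zpow]
  exact_mod_cast h

/-- bounds for the state by the length -/
theorem st_bounds (v : D2 m) : (st hm v).k ≤ wl (D2.x m) v ∧ -(st hm v).k ≤ wl (D2.x m) v ∧
    ((st hm v).L.length : ℤ) ≤ wl (D2.x m) v := by
  have key : ∀ (s : St) (b : Bool), ((s.mulP m b).k ≤ s.k + 1 ∧ s.k ≤ (s.mulP m b).k ∧ (s.mulP m b).L.length ≤ s.L.length + 1) ∧
     ((s.mulN m b).k ≤ s.k ∧ s.k ≤ (s.mulN m b).k + 1 ∧ (s.mulN m b).L.length ≤ s.L.length + 1) := by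
    intro s b
    rcases s with ⟨k, z, _ | ⟨l, L⟩⟩ <;> simp only [St.mulP, St.mulN] <;> (try split_ifs) <;> simp <;> omega
  refine ⟨?_, ?_, ?_⟩
  · apply le_wl (D2.closure_x m) (fun v => (st hm v).k)
    · simp [st_one]
    · rintro g s ⟨b, rfl | rfl⟩
      · have := (key (st hm g) b).1; simp only [st_mul_x]; omega
      · have := (key (st hm g) b).2; simp only [st_mul_x_inv]; omega
  · apply le_wl (D2.closure_x m) (fun v => -(st hm v).k)
    · simp [st_one]
    · rintro g s ⟨b, rfl | rfl⟩
      · have := (key (st hm g) b).1; simp only [st_mul_x]; omega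
      · have := (key (st hm g) b).2; simp only [st_mul_x_inv]; omega
  · apply le_wl (D2.closure_x m) (fun v => ((st hm v).L.length : ℤ))
    · simp [st_one]
    · rintro g s ⟨b, rfl | rfl⟩
      · have := (key (st hm g) b).1; simp only [st_mul_x]; omega
      · have := (key (st hm g) b).2; simp only [st_mul_x_inv]; omega

/-! positive elements -/
theorem Fm_mul (v w : D2 m) : (st hm (v * w)).F m m = (st hm v).F m m + (st hm w).F m m := by
  have hw : w ∈ Subgroup.closure (Set.range (D2.x m)) := by rw [D2.closure_x]; trivial
  have h1 : (st hm (1 : D2 m)).F m m = 0 := by simp [st_one, St.F]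
  have hinv : ∀ b, (st hm (D2.x m b)).F m m = 1 := by
    intro b
    have := Fm_mul_x hm 1 b
    rw [one_mul, h1] at this; simpa using this
  induction hw using Subgroup.closure_induction generalizing v with
  | mem y hy =>
    obtain ⟨b, rfl⟩ := hy
    rw [Fm_mul_x, hinv]
  | one => rw [mul_one, h1, add_zero]
  | mul a b _ _ ha hb => rw [← mul_assoc, hb, ha, hb a]; ring
  | inv a _ ha =>
    have e1 := ha a⁻¹
    have e2 := ha (v * a⁻¹)
    rw [inv_mul_cancel, h1] at e1
    rw [inv_mul_cancel_right] at e2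
    linarith

theorem pos_iff (v : D2 m) : DPos (D2.x m) v ↔ (st hm v).F m m = wl (D2.x m) v := by
  constructor
  · intro h
    apply le_antisymm (F_le_wl hm le_rfl v)
    induction h using Submonoid.closure_induction with
    | mem y hy =>
      have : ∃ b, y = D2.x m b := by rcases hy with h | h; exacts [⟨_, h⟩, ⟨_, h⟩]
      obtain ⟨b, rfl⟩ := this
      have h1 := Fm_mul_x hm 1 b
      have h2 := wl_letter (mem_lset (x := D2.x m) b)
      rw [one_mul, st_one] at h1
      have h3 : St.F m m ⟨0, true, []⟩ = 0 := by simp [St.F]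
      rw [h1, h3]; push_cast [← Nat.cast_le (α := ℤ)] at h2; linarith
    | one => simp [wl_one, st_one, St.F]
    | mul a b _ _ ha hb =>
      have := wl_mul_le (D2.closure_x m) a b
      rw [Fm_mul]; push_cast [← Nat.cast_le (α := ℤ)] at this; linarith
  · induction hn : wl (D2.x m) v generalizing v with
    | zero => intro _; rw [wl_eq_zero (D2.closure_x m) hn]; exact Submonoid.one_mem _
    | succ n ih =>
      intro hF
      obtain ⟨s, ⟨b, rfl | rfl⟩, h2⟩ := wl_succ (D2.closure_x m) hn
      · exfalso
        have h3 := F_le_wl hm le_rfl (v * D2.x m b)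
        rw [Fm_mul_x, hF, h2] at h3
        push_cast at h3; omega
      · have h3 := ih _ h2 (by rw [Fm_mul_x_inv, hF]; push_cast; ring)
        have h4 := Submonoid.mul_mem _ h3 (Submonoid.subset_closure (show D2.x m b ∈ ({D2.x m true, D2.x m false} : Set (D2 m)) by cases b <;> simp))
        rwa [inv_mul_cancel_right] at h4

theorem neg_iff (v : D2 m) : DNeg (D2.x m) v ↔ (st hm v).F m 0 = wl (D2.x m) v := by
  have h1 : DNeg (D2.x m) v ↔ DPos (D2.x m) v⁻¹ := ⟨DNeg_inv, fun h => by simpa using DPos_inv h⟩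
  have h2 := Fm_mul hm v v⁻¹
  rw [mul_inv_cancel, st_one] at h2
  simp [St.F] at h2
  rw [h1, pos_iff hm, wl_inv (D2.closure_x m), F0_eq]
  simp only [St.F] at *
  constructor <;> intro h3 <;> linarith

theorem wl_Del_pow (k : ℕ) : wl (D2.x m) (Del m ^ k) = m * k ∧ (st hm (Del m ^ k)).F m m = m * k := by
  have h0 : (st hm (Del m ^ k)).F m m = m * k := by
    have := st_Del_zpow_mul hm k 1
    rw [mul_one, zpow_natCast, st_one] at this
    rw [this]; simp [St.F, St.shift]; ring
  have hp : DPos (D2.x m) (Del m ^ k) := by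
    apply Submonoid.pow_mem
    have : ∀ j b, DPos (D2.x m) (altProd j (D2.x m b) (D2.x m (!b))) := by
      intro j
      induction j with
      | zero => intro b; exact Submonoid.one_mem _
      | succ j ih =>
        intro b
        have := ih (!b)
        rw [Bool.not_not] at this
        exact Submonoid.mul_mem _ (Submonoid.subset_closure (by cases b <;> simp)) this
    exact this m true
  rw [pos_iff hm, h0] at hp
  exact ⟨by exact_mod_cast hp.symm, h0⟩

theorem pos_k_nonneg {v : D2 m} (h : DPos (D2.x m) v) : 0 ≤ (st hm v).k := by
  induction h using Submonoid.closure_induction_right with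
  | one => simp [st_one]
  | mul_right a _ y hy ha =>
    have : ∃ b, y = D2.x m b := by rcases hy with h | h; exacts [⟨_, h⟩, ⟨_, h⟩]
    obtain ⟨b, rfl⟩ := this
    rw [st_mul_x]
    apply ha.trans
    rcases st hm a with ⟨k, z, _ | ⟨l, L⟩⟩ <;> simp only [St.mulP] <;> (try split_ifs) <;> simp

theorem pos_of_k_zero {v : D2 m} (h : (st hm v).k = 0) : DPos (D2.x m) v := by
  rw [pos_iff hm]
  apply le_antisymm (F_le_wl hm le_rfl v)
  obtain ⟨c, hc, h1⟩ := exists_F_eq hm v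
  rw [← h1]
  simp only [St.F, h]
  simp only [neg_zero, zero_mul, zero_add]
  apply List.sum_le_sum
  intro l hl
  have := (st_valid hm v).1 l hl
  rw [abs_of_nonpos (a := (l:ℤ) - m) (by omega)]
  have := neg_abs_le ((l:ℤ) - c)
  have := le_abs_self ((l:ℤ) - c)
  have : -((l:ℤ) - c) ≤ |(l:ℤ) - c| := neg_le_abs _
  omega

theorem leftDiv_Del_iff {v : D2 m} (h : DPos (D2.x m) v) (k : ℕ) :
    IsLeftDiv (wl (D2.x m)) (Del m ^ k) v ↔ (k : ℤ) ≤ (st hm v).k := by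
  have h1 : ((Del m ^ k)⁻¹ * v) = Del m ^ (-(k:ℤ)) * v := by simp
  have h2 : (st hm ((Del m ^ k)⁻¹ * v)).k = (st hm v).k - k := by
    rw [h1, st_Del_zpow_mul]; simp [St.shift]; ring
  have h3 : (st hm ((Del m ^ k)⁻¹ * v)).F m m = (st hm v).F m m - m * k := by
    rw [h1, st_Del_zpow_mul, St.F_shift]; ring
  have h4 := (pos_iff hm v).1 h
  unfold IsLeftDiv
  rw [(wl_Del_pow hm k).1]
  constructor
  · intro h5
    have h6 : DPos (D2.x m) ((Del m ^ k)⁻¹ * v) := by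
      rw [pos_iff hm, h3, h4, ← h5]; push_cast; ring
    have := pos_k_nonneg hm h6
    omega
  · intro h5
    have h6 : DPos (D2.x m) ((Del m ^ k)⁻¹ * v) := by
      have h7 : DPos (D2.x m) (Del m ^ (-(st hm v).k) * v) := by
        apply pos_of_k_zero hm
        rw [st_Del_zpow_mul]; simp [St.shift]
      obtain ⟨q, hq⟩ := Int.eq_ofNat_of_zero_le (show 0 ≤ (st hm v).k - k by omega)
      have h8 : (Del m ^ k)⁻¹ * v = Del m ^ q * (Del m ^ (-(st hm v).k) * v) := by
        rw [h1, ← mul_assoc, ← zpow_natCast, ← zpow_add]; congr 2; omega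
      rw [h8]
      refine Submonoid.mul_mem _ ?_ h7
      have := (pos_iff hm (Del m ^ q)).2 (by rw [(wl_Del_pow hm q).1, (wl_Del_pow hm q).2]; push_cast; ring)
      exact this
    rw [pos_iff hm, h3, h4] at h6
    have : (m * k + wl (D2.x m) ((Del m ^ k)⁻¹ * v) : ℤ) = wl (D2.x m) v := by rw [← h6]; ring
    exact_mod_cast this

theorem DMax_eq {v : D2 m} (h : DPos (D2.x m) v) {k : ℕ} (hk : DMax (D2.x m) m k v) : (st hm v).k = k := by
  obtain ⟨h1, h2⟩ := hk
  change IsLeftDiv (wl (D2.x m)) (Del m ^ k) v at h1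
  rw [leftDiv_Del_iff hm h] at h1
  obtain ⟨q, hq⟩ := Int.eq_ofNat_of_zero_le (pos_k_nonneg hm h)
  have h3 := h2 q (by
    change IsLeftDiv (wl (D2.x m)) (Del m ^ q) v
    rw [leftDiv_Del_iff hm h, hq])
  omega

end

/-! ### Counting permissible factorisations in dihedral Artin groups -/

def Suff (X : List ℕ) (s : St) : Prop := ∃ Y, Y ≠ [] ∧ s.L = Y ++ X

theorem suff_mulP {m : ℕ} {X : List ℕ} {s : St} (b : Bool) (h : Suff X s) (h1 : s.lam b + 1 < m) :
    Suff X (s.mulP m b) := by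
  obtain ⟨Y, hY, h⟩ := h
  rcases s with ⟨k, z, L⟩
  simp only at h
  subst h
  rcases Y with _ | ⟨l, Y⟩
  · exact absurd rfl hY
  simp only [List.cons_append, St.mulP, St.lam] at *
  by_cases h2 : z = b
  · simp only [h2, if_true]; exact ⟨1 :: l :: Y, by simp, rfl⟩
  · simp only [h2, if_false] at *
    rw [if_pos h1]; exact ⟨(l + 1) :: Y, by simp, rfl⟩

theorem suff_mulN {m : ℕ} {X : List ℕ} {s : St} (b : Bool) (h : Suff X s) (h1 : 1 ≤ s.mu m b) :
    Suff X (s.mulN m b) := by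
  obtain ⟨Y, hY, h⟩ := h
  rcases s with ⟨k, z, L⟩
  simp only at h
  subst h
  rcases Y with _ | ⟨l, Y⟩
  · exact absurd rfl hY
  simp only [List.cons_append, St.mulN, St.mu] at *
  by_cases h2 : z = b
  · simp only [h2, if_true] at *
    rw [if_pos (by omega)]; exact ⟨(l - 1) :: Y, by simp, rfl⟩
  · simp only [h2, if_false] at *
    exact ⟨(m - 1) :: l :: Y, by simp, rfl⟩

section
variable {m : ℕ} (hm : 3 ≤ m)

theorem suff_mixed {c : ℕ} (h1 : 1 ≤ c) (h2 : c < m) {l : ℕ} {X : List ℕ} (n : ℕ) (u V : D2 m)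
    (hu : (st hm u).L = l :: X)
    (hn : wl (D2.x m) (u⁻¹ * V) = n) (hl : wl (D2.x m) u + n = wl (D2.x m) V)
    (hF : (st hm V).F m c = wl (D2.x m) V) : Suff X (st hm V) := by
  induction n generalizing V with
  | zero =>
    have : V = u := by
      have := wl_eq_zero (D2.closure_x m) hn
      exact (inv_mul_eq_one.1 this).symm
    rw [this]; exact ⟨[l], by simp, hu⟩
  | succ n ih =>
    obtain ⟨s, hs, h3⟩ := wl_succ (D2.closure_x m) hn
    rw [mul_assoc] at h3
    have h4 := wl_mul_le (D2.closure_x m) u (u⁻¹ * (V * s))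
    rw [mul_inv_cancel_left] at h4
    have h5 := wl_le_mul_letter (D2.closure_x m) hs V
    have h6 := F_le_wl hm h2.le (V * s)
    have e : wl (D2.x m) V = wl (D2.x m) (V * s) + 1 := by omega
    obtain ⟨b, rfl | rfl⟩ := hs
    · have h7 := h6
      rw [st_mul_x, St.F_mulP hm h2.le b (st_valid hm V)] at h7
      have h9 : ¬ (st hm V).lam b < c := by intro h; rw [if_pos h] at h7; omega
      have h8 := ih (V * D2.x m b) h3 (by omega) (by
        rw [st_mul_x, St.F_mulP hm h2.le b (st_valid hm V), if_neg h9]; omega)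
      have h10 := suff_mulN (m := m) b h8 (by
        have := St.lam_mulN hm b (st_valid hm (V * D2.x m b))
        rw [← this, ← st_mul_x_inv, mul_inv_cancel_right]; omega)
      rwa [← st_mul_x_inv, mul_inv_cancel_right] at h10
    · have h7 := h6
      rw [st_mul_x_inv, St.F_mulN hm h2.le b (st_valid hm V)] at h7
      have h9 : (st hm V).mu m b < c := by by_contra h; rw [if_neg h] at h7; omega
      have h8 := ih (V * (D2.x m b)⁻¹) h3 (by omega) (by
        rw [st_mul_x_inv, St.F_mulN hm h2.le b (st_valid hm V), if_pos h9]; omega)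
      have h10 := suff_mulP (m := m) b h8 (by
        rw [st_mul_x_inv, St.lam_mulN hm b (st_valid hm V)]; omega)
      rwa [← st_mul_x, inv_mul_cancel_right] at h10

theorem suff_pos_word {l : ℕ} {X : List ℕ} (u w : D2 m) (hu : (st hm u).L = l :: X) (hw : DPos (D2.x m) w) :
    (st hm u).k ≤ (st hm (u * w)).k ∧ ((st hm (u * w)).k = (st hm u).k → Suff X (st hm (u * w))) := by
  induction hw using Submonoid.closure_induction_right with
  | one => rw [mul_one]; exact ⟨le_rfl, fun _ => ⟨[l], by simp, hu⟩⟩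
  | mul_right a _ y hy ha =>
    have : ∃ b, y = D2.x m b := by rcases hy with h | h; exacts [⟨_, h⟩, ⟨_, h⟩]
    obtain ⟨b, rfl⟩ := this
    obtain ⟨i1, i2⟩ := ha
    rw [← mul_assoc, st_mul_x]
    have key : ∀ s : St, s.Valid m → s.k ≤ (s.mulP m b).k ∧ ((s.mulP m b).k = s.k → s.lam b + 1 < m) := by
      intro s hs
      rcases s with ⟨k, z, _ | ⟨l, L⟩⟩
      · simp [St.mulP, St.lam]; omega
      · have := (hs.1 l (by simp)).2
        simp only [St.mulP, St.lam]
        split_ifs <;> simp <;> omega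
    obtain ⟨k1, k2⟩ := key (st hm (u * a)) (st_valid hm _)
    refine ⟨by omega, fun h => suff_mulP b (i2 (by omega)) (k2 (by omega))⟩

theorem suff_pos {l : ℕ} {X : List ℕ} (u w : D2 m) (hu : (st hm u).L = l :: X) (hw : DPos (D2.x m) w)
    (hk : (st hm (u * w)).k = (st hm u).k + (st hm w).k) : Suff X (st hm (u * w)) := by
  have e1 : u * w = (u * Del m ^ (st hm w).k) * (Del m ^ (-(st hm w).k) * w) := by simp [mul_assoc]
  have e2 := stL_mul_Del_zpow hm (st hm w).k u
  have e3 : DPos (D2.x m) (Del m ^ (-(st hm w).k) * w) := by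
    apply pos_of_k_zero hm
    rw [st_Del_zpow_mul]; simp [St.shift]
  rw [e1] at hk ⊢
  exact (suff_pos_word hm _ _ (by rw [e2.1, hu]) e3).2 (by rw [hk, e2.2])

noncomputable instance D2.decEq (m : ℕ) : DecidableEq (D2 m) := Classical.decEq _

/-- candidates for the left factor -/
noncomputable def candT (V : D2 m) (K : ℕ) : Finset (D2 m) :=
  ((Finset.Icc (-(K:ℤ)) K ×ˢ (Finset.univ : Finset Bool) ×ˢ Finset.range m ×ˢ Finset.range (K + 1)).image
    (fun q => ev m ⟨q.1, q.2.1, q.2.2.1 :: (st hm V).L.drop ((st hm V).L.length - q.2.2.2)⟩)) ∪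
  (Finset.Icc (-(K:ℤ)) K).image (fun j => ev m ⟨j, true, []⟩)

theorem candT_card (V : D2 m) (K : ℕ) : (candT hm V K).card ≤ (4 * m + 2) * (K + 1) ^ 2 := by
  refine (Finset.card_union_le _ _).trans ?_
  have h1 := Finset.card_image_le (s := (Finset.Icc (-(K:ℤ)) K ×ˢ (Finset.univ : Finset Bool) ×ˢ Finset.range m ×ˢ Finset.range (K + 1)))
    (f := (fun q => ev m ⟨q.1, q.2.1, q.2.2.1 :: (st hm V).L.drop ((st hm V).L.length - q.2.2.2)⟩))
  have h2 := Finset.card_image_le (s := Finset.Icc (-(K:ℤ)) K) (f := (fun j => ev m ⟨j, true, []⟩))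
  have h3 : (Finset.Icc (-(K:ℤ)) K).card = 2 * K + 1 := by rw [Int.card_Icc]; omega
  simp only [Finset.card_product, h3, Finset.card_range, Finset.card_univ, Fintype.card_bool] at h1 h2
  refine (add_le_add h1 h2).trans ?_
  nlinarith [Nat.zero_le K, Nat.zero_le m, Nat.zero_le (m * K)]

theorem mem_candT {V u : D2 m} {K : ℕ} (hK : wl (D2.x m) u = K)
    (h : ∀ l X, (st hm u).L = l :: X → Suff X (st hm V)) : u ∈ candT hm V K := by
  obtain ⟨b1, b2, b3⟩ := st_bounds hm u
  rw [hK] at b1 b2 b3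
  have e := ev_st hm u
  have hv := st_valid hm u
  rw [candT, Finset.mem_union]
  rcases hs : st hm u with ⟨k, z, L⟩
  rw [hs] at b1 b2 b3 e hv
  simp only at b1 b2 b3
  rcases L with _ | ⟨l, X⟩
  · right
    rw [Finset.mem_image]
    refine ⟨k, by simp; omega, ?_⟩
    have : z = true := hv.2 rfl
    rw [← e, this]
  · left
    rw [Finset.mem_image]
    obtain ⟨Y, hY, h1⟩ := h l X (by rw [hs])
    have hl := (hv.1 l (by simp)).2
    refine ⟨(k, z, l, X.length), ?_, ?_⟩
    · simp only [List.length_cons] at b3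
      push_cast at b3
      simp only [Finset.mem_product, Finset.mem_Icc, Finset.mem_univ, Finset.mem_range, true_and]
      omega
    · rw [← e]; simp only [h1]; simp

/-! bar automorphism -/
theorem altProd_inv {G : Type*} [Group G] (j : ℕ) (f : Bool → G) (b : Bool) :
    (altProd j (f b) (f (!b)))⁻¹ = altProd j (f (Bool.not^[j+1] b))⁻¹ (f (!Bool.not^[j+1] b))⁻¹ := by
  induction j generalizing b with
  | zero => simp [altProd]
  | succ j ih =>
    rw [altProd_succ_right f, mul_inv_rev, ih, altProd, St.not_iter_add_two, Function.iterate_succ_apply, St.not_iter_not]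
    simp

theorem exists_bar (m : ℕ) : ∃ β : D2 m →* D2 m, (∀ b, β (D2.x m b) = (D2.x m b)⁻¹) ∧ β (Del m) = (Del m)⁻¹ := by
  have key : ∀ b, altProd m (D2.x m b)⁻¹ (D2.x m (!b))⁻¹ = (Del m)⁻¹ := by
    intro b
    have h1 := altProd_inv m (D2.x m) (Bool.not^[m+1] b)
    rw [St.not_iter_iter, Del_eq] at h1
    exact h1.symm
  obtain ⟨β, hβ⟩ := D2.exists_lift m (fun b => (D2.x m b)⁻¹) ((key true).trans (key false).symm)
  refine ⟨β, hβ, ?_⟩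
  rw [Del, map_altProd, hβ, hβ]; exact key true

noncomputable def bar (m : ℕ) : D2 m →* D2 m := (exists_bar m).choose
theorem bar_x (b : Bool) : bar m (D2.x m b) = (D2.x m b)⁻¹ := (exists_bar m).choose_spec.1 b
theorem bar_Del : bar m (Del m) = (Del m)⁻¹ := (exists_bar m).choose_spec.2
theorem bar_bar (v : D2 m) : bar m (bar m v) = v := by
  have hv : v ∈ Subgroup.closure (Set.range (D2.x m)) := by rw [D2.closure_x]; trivial
  induction hv using Subgroup.closure_induction with
  | mem y hy => obtain ⟨b, rfl⟩ := hy; simp [bar_x]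
  | one => simp
  | mul a b _ _ ha hb => simp [ha, hb]
  | inv a _ ha => simp [ha]
theorem bar_lset {s : D2 m} (h : s ∈ lset (D2.x m)) : bar m s ∈ lset (D2.x m) := by
  obtain ⟨b, rfl | rfl⟩ := h
  · rw [bar_x]; exact inv_mem_lset b
  · rw [map_inv, bar_x, inv_inv]; exact mem_lset b
theorem wl_bar_le (v : D2 m) : wl (D2.x m) (bar m v) ≤ wl (D2.x m) v := by
  obtain ⟨w, h1, h2, h3⟩ := wl_spec (D2.closure_x m) v
  have := wl_le_length (x := D2.x m) (w.map (bar m)) (by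
    intro a ha
    obtain ⟨c, hc, rfl⟩ := List.mem_map.1 ha
    exact bar_lset (h1 c hc))
  rwa [← map_list_prod, h3, List.length_map, h2] at this
theorem wl_bar (v : D2 m) : wl (D2.x m) (bar m v) = wl (D2.x m) v :=
  le_antisymm (wl_bar_le v) (by simpa [bar_bar] using wl_bar_le (bar m v))
theorem bar_DNeg {v : D2 m} (h : DNeg (D2.x m) v) : DPos (D2.x m) (bar m v) := by
  induction h using Submonoid.closure_induction with
  | mem y hy =>
    apply Submonoid.subset_closure
    rcases hy with rfl | hy
    · simp [bar_x]
    · rw [Set.mem_singleton_iff] at hy; subst hy; simp [bar_x]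
  | one => rw [map_one]; exact Submonoid.one_mem _
  | mul a b _ _ ha hb => rw [map_mul]; exact Submonoid.mul_mem _ ha hb
theorem bar_DTwo {v : D2 m} (h : DTwo (D2.x m) v) : DTwo (D2.x m) (bar m v) := by
  obtain ⟨a, ha, b, hb, s, t, rfl⟩ := h
  exact ⟨_, bar_lset ha, _, bar_lset hb, s, t, by simp⟩
theorem bar_DMaxN {v : D2 m} {k : ℕ} (h : DMaxN (D2.x m) m k v) : DMax (D2.x m) m k (bar m v) := by
  have key : ∀ k : ℕ, IsLeftDiv (wl (D2.x m)) (DDel (D2.x m) m ^ k) (bar m v) ↔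
      IsLeftDiv (wl (D2.x m)) ((DDel (D2.x m) m)⁻¹ ^ k) v := by
    intro k
    have e : DDel (D2.x m) m ^ k = bar m ((DDel (D2.x m) m)⁻¹ ^ k) := by
      rw [map_pow, map_inv]
      have := bar_Del (m := m)
      rw [show DDel (D2.x m) m = Del m from rfl, this, inv_inv]
    unfold IsLeftDiv
    rw [e, ← map_inv, ← map_mul, wl_bar, wl_bar, wl_bar]
  unfold DMax
  simp only [key]
  exact h

/-! two syllables -/
theorem wl_two {m : ℕ} (hm : 3 ≤ m) (b : Bool) (e f : ℤ) :
    wl (D2.x m) (D2.x m b ^ e * D2.x m (!b) ^ f) = e.natAbs + f.natAbs := by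
  by_cases he : e = 0
  · by_cases hf : f = 0
    · simp [he, hf, wl_one]
    · have := D2_syl hm (!b) [f] (by simpa using hf) (by simp; omega)
      simpa [sy, Psum, he] using this
  · by_cases hf : f = 0
    · have := D2_syl hm b [e] (by simpa using he) (by simp; omega)
      simpa [sy, Psum, hf] using this
    · have := D2_syl hm (!b) [f, e] (by simp [he, hf]) (by simp; omega)
      simp only [sy, Psum, Bool.not_not, one_mul, List.map_cons, List.map_nil, List.sum_cons, List.sum_nil] at this
      rw [this]; omega

theorem DTwo_nf {v : D2 m} (h : DTwo (D2.x m) v) : ∃ b, ∃ e f : ℤ, v = D2.x m b ^ e * D2.x m (!b) ^ f := by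
  obtain ⟨a, ha, c, hc, s, t, rfl⟩ := h
  have key : ∀ a ∈ lset (D2.x m), ∀ s : ℕ, ∃ b, ∃ e : ℤ, a ^ s = D2.x m b ^ e := by
    rintro a ⟨b, rfl | rfl⟩ s
    · exact ⟨b, s, by simp⟩
    · exact ⟨b, -s, by simp⟩
  obtain ⟨b, e, h1⟩ := key a ha s
  obtain ⟨b', f, h2⟩ := key c hc t
  rw [h1, h2]
  by_cases hb : b' = b
  · subst hb; exact ⟨b', e + f, 0, by simp [zpow_add]⟩
  · have : b' = !b := by cases b <;> cases b' <;> simp_all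
    subst this
    exact ⟨b, e, f, rfl⟩

noncomputable def candTwo (m K : ℕ) : Finset (D2 m) :=
  ((Finset.univ : Finset Bool) ×ˢ Finset.Icc (-(K:ℤ)) K ×ˢ Finset.Icc (-(K:ℤ)) K).image
    (fun q => D2.x m q.1 ^ q.2.1 * D2.x m (!q.1) ^ q.2.2)

theorem candTwo_card (m K : ℕ) : (candTwo m K).card ≤ 8 * (K + 1) ^ 2 := by
  refine Finset.card_image_le.trans ?_
  have h3 : (Finset.Icc (-(K:ℤ)) K).card = 2 * K + 1 := by rw [Int.card_Icc]; omega
  simp only [Finset.card_product, h3, Finset.card_univ, Fintype.card_bool]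
  nlinarith

theorem mem_candTwo {m : ℕ} (hm : 3 ≤ m) {u : D2 m} {K : ℕ} (hK : wl (D2.x m) u = K) (h : DTwo (D2.x m) u) :
    u ∈ candTwo m K := by
  obtain ⟨b, e, f, rfl⟩ := DTwo_nf h
  rw [wl_two hm] at hK
  rw [candTwo, Finset.mem_image]
  refine ⟨(b, e, f), ?_, rfl⟩
  simp only [Finset.mem_product, Finset.mem_univ, Finset.mem_Icc, true_and]
  omega

/-- repeated multiplication by one letter eventually pushes -/
theorem push_eventually (b : Bool) (q : ℕ) (u : D2 m) (s : ℕ) (hq : (st hm u).L.length ≤ q) (hs : q + 2 ≤ s) :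
    ∃ X, (st hm (u * D2.x m b ^ s)).z = b ∧ (st hm (u * D2.x m b ^ s)).L = 1 :: X := by
  have h1 : ∀ (t : ℕ) (u : D2 m), ((st hm u).L = [] ∨ (st hm u).z = b) →
      ∃ X, (st hm (u * D2.x m b ^ (t + 1))).z = b ∧ (st hm (u * D2.x m b ^ (t + 1))).L = 1 :: X := by
    intro t
    induction t with
    | zero =>
      intro u hu
      rw [zero_add, pow_one, st_mul_x]
      rcases h : st hm u with ⟨k, z, _ | ⟨l, L⟩⟩
      · exact ⟨[], rfl, rfl⟩
      · rw [h] at hu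
        have : z = b := by simpa using hu
        simp [St.mulP, this]
    | succ t ih =>
      intro u hu
      obtain ⟨X, i1, i2⟩ := ih u hu
      rw [pow_succ, ← mul_assoc, st_mul_x]
      rcases h : st hm (u * D2.x m b ^ (t + 1)) with ⟨k, z, L⟩
      rw [h] at i1 i2
      simp only at i1 i2
      subst i1; subst i2
      simp [St.mulP]
  induction q generalizing u s with
  | zero =>
    obtain ⟨t, rfl⟩ : ∃ t, s = t + 1 := ⟨s - 1, by omega⟩
    exact h1 t u (Or.inl (List.length_eq_zero_iff.1 (by omega)))
  | succ q ih =>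
    by_cases h2 : (st hm u).L = [] ∨ (st hm u).z = b
    · obtain ⟨t, rfl⟩ : ∃ t, s = t + 1 := ⟨s - 1, by omega⟩
      exact h1 t u h2
    · obtain ⟨t, rfl⟩ : ∃ t, s = t + 1 := ⟨s - 1, by omega⟩
      rw [pow_succ', ← mul_assoc]
      by_cases h3 : (st hm (u * D2.x m b)).z = b
      · obtain ⟨t', rfl⟩ : ∃ t', t = t' + 1 := ⟨t - 1, by omega⟩
        exact h1 t' _ (Or.inr h3)
      · apply ih _ _ _ (by omega)
        rw [st_mul_x] at h3 ⊢
        rcases h : st hm u with ⟨k, z, _ | ⟨l, L⟩⟩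
        · rw [h] at h2; simp at h2
        · rw [h] at h2 h3 hq
          simp only [reduceCtorEq, false_or, List.length_cons] at h2 hq
          simp only [St.mulP, h2, if_false] at h3 ⊢
          split_ifs at h3 ⊢ with h4
          · simp at h3
          · simp; omega

theorem run_of_push {b : Bool} {X : List ℕ} {u : D2 m} (hz : (st hm u).z = b) (hL : (st hm u).L = 1 :: X) (t : ℕ) :
    (st hm (u * D2.x m (!b) ^ (t + 1))).z = !b ∧
    (st hm (u * D2.x m (!b) ^ (t + 1))).L = List.replicate t 1 ++ 2 :: X := by
  induction t with
  | zero =>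
    rw [zero_add, pow_one, st_mul_x]
    rcases h : st hm u with ⟨k, z, L⟩
    rw [h] at hz hL
    simp only at hz hL
    subst hz; subst hL
    have : 2 < m := by omega
    simp [St.mulP, this]
  | succ t ih =>
    rw [pow_succ, ← mul_assoc, st_mul_x]
    rcases h : st hm (u * D2.x m (!b) ^ (t + 1)) with ⟨k, z, L⟩
    rw [h] at ih
    simp only at ih
    obtain ⟨rfl, rfl⟩ := ih
    cases t with
    | zero => simp [St.mulP]
    | succ t => rw [List.replicate_succ]; simp [St.mulP, List.replicate_succ]

def run (L : List ℕ) : ℕ := (L.takeWhile (· == 1)).length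

theorem run_replicate (t : ℕ) (X : List ℕ) : run (List.replicate t 1 ++ 2 :: X) = t := by
  induction t with
  | zero => simp [run]
  | succ t ih => simp only [run, List.replicate_succ, List.cons_append] at *; simp [ih]

noncomputable def candU (V : D2 m) (K : ℕ) : Finset (D2 m) :=
  (((Finset.univ : Finset Bool) ×ˢ (insert (wl (D2.x m) V - K) (insert (wl (D2.x m) V - K - (run (st hm V).L + 1)) (Finset.range (K + 2)))))).image
    (fun q => V * (D2.x m q.1 ^ q.2 * D2.x m (!q.1) ^ (wl (D2.x m) V - K - q.2))⁻¹)

theorem candU_card (V : D2 m) (K : ℕ) : (candU hm V K).card ≤ 8 * (K + 1) ^ 2 := by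
  refine Finset.card_image_le.trans ?_
  rw [Finset.card_product, Finset.card_univ, Fintype.card_bool]
  have h1 := Finset.card_insert_le (wl (D2.x m) V - K) (insert (wl (D2.x m) V - K - (run (st hm V).L + 1)) (Finset.range (K + 2)))
  have h2 := Finset.card_insert_le (wl (D2.x m) V - K - (run (st hm V).L + 1)) (Finset.range (K + 2))
  rw [Finset.card_range] at h2
  nlinarith

theorem mem_candU {V u : D2 m} {K : ℕ} (hK : wl (D2.x m) u = K) (hV : DPos (D2.x m) V)
    (hg : wl (D2.x m) u + wl (D2.x m) (u⁻¹ * V) = wl (D2.x m) V) (h : DTwo (D2.x m) (u⁻¹ * V)) :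
    u ∈ candU hm V K := by
  obtain ⟨b, e, f, hef⟩ := DTwo_nf h
  have hl := wl_two hm b e f
  rw [← hef] at hl
  have hVF := (pos_iff hm V).1 hV
  have hsum := Fm_mul hm u (u⁻¹ * V)
  rw [mul_inv_cancel_left, hVF] at hsum
  have h1 := F_le_wl hm le_rfl u
  have h2 : (st hm (u⁻¹ * V)).F m m = e + f := by
    rw [hef, Fm_mul_zpow]
    have := Fm_mul_zpow hm 1 b e
    rw [one_mul] at this
    rw [this, st_one]; simp [St.F]
  have he : 0 ≤ e := by omega
  have hf : 0 ≤ f := by omega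
  obtain ⟨s, rfl⟩ := Int.eq_ofNat_of_zero_le he
  obtain ⟨t, rfl⟩ := Int.eq_ofNat_of_zero_le hf
  simp only [Int.ofNat_eq_natCast, zpow_natCast] at hef
  have hst : wl (D2.x m) V - K = s + t := by
    simp at hl; omega
  rw [candU, Finset.mem_image]
  refine ⟨(b, s), ?_, ?_⟩
  · simp only [Finset.mem_product, Finset.mem_univ, true_and, Finset.mem_insert, Finset.mem_range, hst]
    by_cases ht : t = 0
    · left; omega
    by_cases hs : s < K + 2
    · right; right; exact hs
    right; left
    have h3 := (st_bounds hm u).2.2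
    rw [hK] at h3
    obtain ⟨X, p1, p2⟩ := push_eventually hm b K u s (by exact_mod_cast h3) (by omega)
    obtain ⟨t', rfl⟩ : ∃ t', t = t' + 1 := ⟨t - 1, by omega⟩
    have p3 := (run_of_push hm p1 p2 t').2
    have e1 : u * D2.x m b ^ s * D2.x m (!b) ^ (t' + 1) = V := by
      rw [mul_assoc, ← hef, mul_inv_cancel_left]
    rw [e1] at p3
    rw [p3, run_replicate]; omega
  · simp only [hst, Nat.add_sub_cancel_left]
    rw [← hef]; simp

theorem D2_count {m : ℕ} (hm : 3 ≤ m) : ∃ A : ℕ, ∀ (V : D2 m) (K : ℕ), ∃ S : Finset (D2 m),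
    S.card ≤ A * (K + 1) ^ 2 ∧
    ∀ u, wl (D2.x m) u = K → PermD (D2.x m) (m : ℕ∞) u (u⁻¹ * V) → u ∈ S := by
  refine ⟨8 * m + 28, fun V K => ⟨candT hm V K ∪ (candT hm (bar m V) K).image (bar m) ∪ candTwo m K ∪
    candU hm V K ∪ (candU hm (bar m V) K).image (bar m), ?_, ?_⟩⟩
  · have h1 := candT_card hm V K
    have h2 := candT_card hm (bar m V) K
    have h3 := candTwo_card m K
    have h4 := candU_card hm V K
    have h5 := candU_card hm (bar m V) K
    have h6 := Finset.card_image_le (s := candT hm (bar m V) K) (f := bar m)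
    have h7 := Finset.card_image_le (s := candU hm (bar m V) K) (f := bar m)
    have i1 := Finset.card_union_le (candT hm V K ∪ (candT hm (bar m V) K).image (bar m) ∪ candTwo m K ∪
      candU hm V K) ((candU hm (bar m V) K).image (bar m))
    have i2 := Finset.card_union_le (candT hm V K ∪ (candT hm (bar m V) K).image (bar m) ∪ candTwo m K) (candU hm V K)
    have i3 := Finset.card_union_le (candT hm V K ∪ (candT hm (bar m V) K).image (bar m)) (candTwo m K)
    have i4 := Finset.card_union_le (candT hm V K) ((candT hm (bar m V) K).image (bar m))
    have e : (8 * m + 28) * (K + 1) ^ 2 = (4 * m + 2) * (K + 1) ^ 2 + (4 * m + 2) * (K + 1) ^ 2 + 8 * (K + 1) ^ 2 + 8 * (K + 1) ^ 2 + 8 * (K + 1) ^ 2 := by ring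
    omega
  · intro u hK ⟨hg, hp⟩
    rw [mul_inv_cancel_left] at hg hp
    simp only [Finset.mem_union]
    by_cases hpos : DPos (D2.x m) V ∨ DNeg (D2.x m) V
    · rcases hp m rfl hpos with h | h | ⟨a, b, c, k1, k2, d1, d2, d3⟩ | ⟨a, b, c, k1, k2, d1, d2, d3⟩
      · left; left; right; exact mem_candTwo hm hK h
      · rcases hpos with hpos | hneg
        · left; right; exact mem_candU hm hK hpos hg h
        · right
          rw [Finset.mem_image]
          refine ⟨bar m u, mem_candU hm (by rw [wl_bar, hK]) (bar_DNeg hneg) ?_ ?_, bar_bar u⟩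
          · rw [← map_inv, ← map_mul, wl_bar, wl_bar, wl_bar, hg]
          · rw [← map_inv, ← map_mul]; exact bar_DTwo h
      · left; left; left; left
        apply mem_candT hm hK
        intro l X hX
        have := suff_pos hm u (u⁻¹ * V) hX c (by
          rw [mul_inv_cancel_left, DMax_eq hm a d3, DMax_eq hm b d1, DMax_eq hm c d2]; push_cast; ring)
        rwa [mul_inv_cancel_left] at this
      · left; left; left; right
        rw [Finset.mem_image]
        refine ⟨bar m u, mem_candT hm (by rw [wl_bar, hK]) ?_, bar_bar u⟩
        intro l X hX
        have := suff_pos hm (bar m u) (bar m (u⁻¹ * V)) hX (bar_DNeg c) (by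
          rw [← map_mul, mul_inv_cancel_left, DMax_eq hm (bar_DNeg a) (bar_DMaxN d3), DMax_eq hm (bar_DNeg b) (bar_DMaxN d1),
            DMax_eq hm (bar_DNeg c) (bar_DMaxN d2)]; push_cast; ring)
        rwa [← map_mul, mul_inv_cancel_left] at this
    · left; left; left; left
      push Not at hpos
      apply mem_candT hm hK
      intro l X hX
      obtain ⟨c, hc, hF⟩ := exists_F_eq hm V
      have c1 : c ≠ m := by rintro rfl; exact hpos.1 ((pos_iff hm V).2 hF)
      have c0 : c ≠ 0 := by rintro rfl; exact hpos.2 ((neg_iff hm V).2 hF)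
      exact suff_mixed hm (by omega) (by omega) _ u V hX rfl hg hF

end

/-! ### The interface for two-generator Artin groups -/

/-- Everything the global argument needs to know about a two-generator Artin group. -/
structure Dih (m : ℕ∞) where
  D : Type
  grp : Group D
  x : Bool → D
  rel : ∀ m' : ℕ, m = m' → altProd m' (x true) (x false) = altProd m' (x false) (x true)
  lift : ∀ (H : Type) [Group H] (f : Bool → H),
    (∀ m' : ℕ, m = m' → altProd m' (f true) (f false) = altProd m' (f false) (f true)) →
    ∃ φ : D →* H, ∀ b, φ (x b) = f b
  gen : Subgroup.closure (Set.range x) = ⊤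
  r : Bool → D → ℤ
  hr : ∀ b v t, wl x (v * x b ^ t) = wl x (v * x b ^ (-(r b v))) + (r b v + t).natAbs
  syl : ∀ b es, (∀ e ∈ es, e ≠ 0) → (es.length : ℕ∞) ≤ m → wl x (sy x b es) = Psum es
  top : ∀ v, (∀ b, r b v ≠ 0) → m < ⊤
  cnt : ∃ A : ℕ, ∀ (V : D) (K : ℕ), ∃ S : Finset D, S.card ≤ A * (K + 1) ^ 2 ∧
    ∀ u, wl x u = K → PermD x m u (u⁻¹ * V) → u ∈ S
  perm_inv : ∀ h₁ h₂ : D, PermD x m h₁ h₂ → PermD x m h₂⁻¹ h₁⁻¹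

attribute [instance] Dih.grp

theorem Dih_fin {m : ℕ} (hm : 3 ≤ m) : Nonempty (Dih (m : ℕ∞)) := by
  have hr := fun b => exists_r (D2.closure_x m) (D2_chi m) b (fun v => by
    intro h1 h2
    exact D2_nolocalmax hm v b h1 h2)
  choose r hr using hr
  exact ⟨{
    D := D2 m
    grp := inferInstance
    x := D2.x m
    rel := by
      intro m' hm'
      have : m = m' := by exact_mod_cast hm'
      subst this
      exact D2.rel m
    lift := by
      intro H _ f hf
      exact D2.exists_lift m f (hf m rfl)
    gen := D2.closure_x m
    r := r
    hr := hr
    syl := by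
      intro b es h0 hl
      exact D2_syl hm b es h0 (by exact_mod_cast hl)
    top := by
      intro v _
      exact ENat.natCast_lt_top m
    cnt := D2_count hm
    perm_inv := by
      intro h₁ h₂ h
      refine PermD_inv (D2.closure_x m) ?_ h
      intro m' hm' j v
      have : m = m' := by exact_mod_cast hm'
      subst this
      exact D2_Del_comm hm j v }⟩

/-! ### The free group -/

abbrev fx : Bool → FreeGroup Bool := FreeGroup.of

theorem fx_gen : Subgroup.closure (Set.range fx) = ⊤ := FreeGroup.closure_range_of Bool

theorem fx_norm (v : FreeGroup Bool) : wl fx v = v.norm := by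
  apply le_antisymm
  · have h := wl_le_length (x := fx) (v.toWord.map (fun p => FreeGroup.mk [p])) (by
      intro a ha
      rw [List.mem_map] at ha
      obtain ⟨⟨b, c⟩, -, rfl⟩ := ha
      cases c
      · exact ⟨b, Or.inr rfl⟩
      · exact ⟨b, Or.inl rfl⟩)
    rw [List.length_map] at h
    have e : (v.toWord.map (fun p => FreeGroup.mk [p])).prod = v := by
      have : ∀ L : List (Bool × Bool), (L.map (fun p => FreeGroup.mk [p])).prod = FreeGroup.mk L := by
        intro L
        induction L with
        | nil => rfl
        | cons a L ih => rw [List.map_cons, List.prod_cons, ih, FreeGroup.mul_mk]; rfl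
      rw [this, FreeGroup.mk_toWord]
    rw [e] at h
    exact h
  · obtain ⟨w, h1, h2, h3⟩ := wl_spec fx_gen v
    rw [← h2, ← h3]
    clear h2 h3
    induction w with
    | nil => simp
    | cons a w ih =>
      rw [List.prod_cons, List.length_cons]
      have := FreeGroup.norm_mul_le a w.prod
      have h4 := ih (fun b hb => h1 b (by simp [hb]))
      have h5 : a.norm ≤ 1 := by
        obtain ⟨b, rfl | rfl⟩ := h1 a (by simp)
        · simp
        · simp
      omega

theorem fx_desc_left {p : Bool × Bool} {w : FreeGroup Bool}
    (h : (FreeGroup.mk [p] * w).norm < w.norm) : w.toWord.head? = some (p.1, !p.2) := by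
  have e : (FreeGroup.mk [p] * w).toWord = FreeGroup.reduce (p :: w.toWord) := by
    conv_lhs => rw [← FreeGroup.mk_toWord (x := w)]
    rw [FreeGroup.mul_mk, FreeGroup.toWord_mk]; rfl
  rw [FreeGroup.norm, e, FreeGroup.reduce.cons, FreeGroup.reduce_toWord] at h
  unfold FreeGroup.norm at h
  rcases hw : w.toWord with _ | ⟨a, t⟩
  · simp [hw] at h
  · rw [hw] at h
    simp only at h
    split_ifs at h with hc
    · obtain ⟨h1, h2⟩ := hc
      simp [h1, h2]
    · simp at h

theorem fx_unique {v s s' : FreeGroup Bool} (hs : s ∈ lset fx) (hs' : s' ∈ lset fx)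
    (h : wl fx (v * s) < wl fx v) (h' : wl fx (v * s') < wl fx v) : s = s' := by
  have key : ∀ s ∈ lset fx, ∃ p : Bool × Bool, s⁻¹ = FreeGroup.mk [p] := by
    rintro s ⟨b, rfl | rfl⟩
    · exact ⟨(b, false), rfl⟩
    · exact ⟨(b, true), by rw [inv_inv]; rfl⟩
  have key2 : ∀ s p, s⁻¹ = FreeGroup.mk [p] → wl fx (v * s) < wl fx v →
      v⁻¹.toWord.head? = some (p.1, !p.2) := by
    intro s p hp hh
    rw [← wl_inv fx_gen (v * s), ← wl_inv fx_gen v, mul_inv_rev, hp, fx_norm, fx_norm] at hh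
    exact fx_desc_left hh
  obtain ⟨p, hp⟩ := key s hs
  obtain ⟨p', hp'⟩ := key s' hs'
  have h1 := key2 s p hp h
  have h2 := key2 s' p' hp' h'
  rw [h1] at h2
  have h3 : p = p' := by
    rcases p with ⟨a, b⟩
    rcases p' with ⟨c, d⟩
    simpa using h2
  subst h3
  rw [← hp'] at hp
  exact inv_injective hp

theorem fx_hom : ∃ χ : FreeGroup Bool →* Multiplicative ℤ, ∀ b, χ (fx b) = Multiplicative.ofAdd 1 :=
  ⟨FreeGroup.lift (fun _ => Multiplicative.ofAdd 1), fun b => by simp [fx]⟩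

theorem fx_ne (b c : Bool) : fx b ≠ (fx c)⁻¹ := by
  intro h
  obtain ⟨χ, hχ⟩ := fx_hom
  have := congrArg χ h
  rw [map_inv, hχ, hχ, ← ofAdd_neg] at this
  have := Multiplicative.ofAdd.injective this
  omega

theorem Dih_top : Nonempty (Dih ⊤) := by
  have hr := fun b => exists_r fx_gen ⟨FreeGroup.lift (fun _ => -1), fun b => by simp [fx]⟩ b (fun v => by
    intro h1 h2
    exact fx_ne b b (fx_unique (mem_lset b) (inv_mem_lset b) h1 h2))
  choose r hr using hr
  have hd : ∀ b v, r b v ≠ 0 → ∃ s, (s = fx b ∨ s = (fx b)⁻¹) ∧ wl fx (v * s) < wl fx v := by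
    intro b v h
    have h0 := hr b v 0
    have h1 := hr b v 1
    have h2 := hr b v (-1)
    rw [zpow_zero, mul_one] at h0
    rw [zpow_one] at h1
    rw [zpow_neg_one] at h2
    rcases lt_or_gt_of_ne h with h3 | h3
    · exact ⟨_, Or.inl rfl, by omega⟩
    · exact ⟨_, Or.inr rfl, by omega⟩
  have htop : ∀ v, (∀ b, r b v ≠ 0) → False := by
    intro v h
    obtain ⟨s, hs, h1⟩ := hd true v (h true)
    obtain ⟨s', hs', h2⟩ := hd false v (h false)
    have := fx_unique ⟨true, hs⟩ ⟨false, hs'⟩ h1 h2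
    have hne : fx true ≠ fx false := fun h => by simpa using FreeGroup.of_injective h
    rcases hs with rfl | rfl <;> rcases hs' with rfl | rfl
    · exact hne this
    · exact fx_ne _ _ this
    · exact fx_ne _ _ this.symm
    · exact hne (inv_injective this)
  have hrm : ∀ b v t, r b (v * fx b ^ t) = r b v + t := by
    intro b v t
    have h1 := hr b (v * fx b ^ t)
    have h2 := hr b v
    have h3 : ∀ s, wl fx (v * fx b ^ t * fx b ^ s) = wl fx (v * fx b ^ (t + s)) := by
      intro s; rw [mul_assoc, ← zpow_add]
    have e1 := h2 (t + -r b (v * fx b ^ t))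
    have e2 := h1 (- r b v - t)
    rw [h3, h3, e1, h2] at e2
    omega
  have hone : ∀ b, r b 1 = 0 := by
    intro b
    by_contra h
    obtain ⟨s, -, h1⟩ := hd b 1 h
    rw [wl_one] at h1
    omega
  have hsy : ∀ es, (∀ e ∈ es, e ≠ 0) → ∀ b, wl fx (sy fx b es) = Psum es ∧ r (!b) (sy fx b es) = 0 := by
    intro es
    induction es with
    | nil => intro _ b; exact ⟨by simp [sy, wl_one, Psum], hone _⟩
    | cons e es ih =>
      intro h0 b
      obtain ⟨h1, h2⟩ := ih (fun a ha => h0 a (by simp [ha])) (!b)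
      rw [Bool.not_not] at h2
      have h3 : r b (sy fx b (e :: es)) = e := by rw [sy, hrm, h2, zero_add]
      constructor
      · have := hr b (sy fx (!b) es) e
        rw [h2] at this
        rw [sy, this, Psum_cons, ← h1]
        simp [add_comm]
      · by_contra h4
        apply htop (sy fx b (e :: es))
        intro c
        by_cases hc : c = b
        · rw [hc, h3]; exact h0 e (by simp)
        · have : c = !b := by cases c <;> cases b <;> simp_all
          rw [this]; exact h4
  have hu : ∀ N (V u u' : FreeGroup Bool), wl fx u = wl fx u' → wl fx (u⁻¹ * V) = N → wl fx (u'⁻¹ * V) = N →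
      wl fx u + N = wl fx V → u = u' := by
    intro N
    induction N with
    | zero =>
      intro V u u' _ h1 h2 _
      have a1 := wl_eq_zero fx_gen h1
      have a2 := wl_eq_zero fx_gen h2
      rw [← a2] at a1
      exact inv_injective (mul_right_cancel a1)
    | succ N ih =>
      intro V u u' h h1 h2 h3
      obtain ⟨s, hs, e1⟩ := wl_succ fx_gen h1
      obtain ⟨s', hs', e2⟩ := wl_succ fx_gen h2
      have b1 : wl fx (V * s) ≤ wl fx u + N := by
        have := wl_mul_le fx_gen u (u⁻¹ * V * s)
        rw [e1] at this
        simpa [mul_assoc] using this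
      have b2 : wl fx (V * s') ≤ wl fx u + N := by
        have := wl_mul_le fx_gen u' (u'⁻¹ * V * s')
        rw [e2, ← h] at this
        simpa [mul_assoc] using this
      have : s = s' := fx_unique hs hs' (v := V) (by omega) (by omega)
      subst this
      refine ih (V * s) u u' h (by rw [← e1, mul_assoc]) (by rw [← e2, mul_assoc]) ?_
      have := wl_le_mul_letter fx_gen hs V
      omega
  exact ⟨{
    D := FreeGroup Bool
    grp := inferInstance
    x := fx
    rel := by intro m' h; exact absurd h.symm (ENat.natCast_ne_top m')
    lift := by
      intro H _ f _
      exact ⟨FreeGroup.lift f, fun b => by simp [fx]⟩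
    gen := fx_gen
    r := r
    hr := hr
    syl := fun b es h0 _ => (hsy es h0 b).1
    top := fun v h => (htop v h).elim
    cnt := by
      refine ⟨1, fun V K => ?_⟩
      by_cases h : ∃ u, wl fx u = K ∧ PermD fx ⊤ u (u⁻¹ * V)
      · obtain ⟨u, h1, h2, -⟩ := h
        refine ⟨{u}, by simp; exact Nat.one_le_pow _ _ (by omega), ?_⟩
        intro u' h1' h2'
        rw [Finset.mem_singleton]
        have h3 := h2'.1
        rw [mul_inv_cancel_left] at h2 h3
        exact hu (wl fx (u⁻¹ * V)) V u' u (by rw [h1, h1']) (by omega) rfl (by omega)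
      · refine ⟨∅, by simp, ?_⟩
        intro u h1 h2
        exact absurd ⟨u, h1, h2⟩ h
    perm_inv := by
      intro h₁ h₂ h
      refine PermD_inv fx_gen ?_ h
      intro m' hm'
      exact absurd hm'.symm (ENat.natCast_ne_top m') }⟩

theorem Dih_exists {m : ℕ∞} (hm : 3 ≤ m) : Nonempty (Dih m) := by
  induction m using ENat.recTopCoe with
  | top => exact Dih_top
  | coe m => exact Dih_fin (by exact_mod_cast hm)

namespace Dih
variable {m : ℕ∞} (d : Dih m)

theorem len_mul (b : Bool) (v : d.D) (t : ℤ) :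
    wl d.x (v * d.x b ^ t) + (d.r b v).natAbs = wl d.x v + (d.r b v + t).natAbs := by
  have h0 := d.hr b v 0
  have h1 := d.hr b v t
  rw [zpow_zero, mul_one] at h0
  omega

theorem r_mul (b : Bool) (v : d.D) (t : ℤ) : d.r b (v * d.x b ^ t) = d.r b v + t := by
  have h1 := d.hr b (v * d.x b ^ t)
  have h2 := d.hr b v
  have h3 : ∀ s, wl d.x (v * d.x b ^ t * d.x b ^ s) = wl d.x (v * d.x b ^ (t + s)) := by
    intro s; rw [mul_assoc, ← zpow_add]
  have e1 := h2 (t + -d.r b (v * d.x b ^ t))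
  have e2 := h1 (- d.r b v - t)
  rw [h3, h3, e1, h2] at e2
  omega

theorem r_zero_of (b : Bool) (v : d.D) (h1 : wl d.x (v * d.x b) = wl d.x v + 1)
    (h2 : wl d.x (v * (d.x b)⁻¹) = wl d.x v + 1) : d.r b v = 0 := by
  have e1 := d.len_mul b v 1
  have e2 := d.len_mul b v (-1)
  rw [zpow_one] at e1
  rw [zpow_neg_one] at e2
  omega

theorem r_sy (b : Bool) (es : List ℤ) (h0 : ∀ e ∈ es, e ≠ 0) (hl : ((es.length + 1 : ℕ) : ℕ∞) ≤ m) :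
    d.r (!b) (sy d.x b es) = 0 := by
  have hl' : (es.length : ℕ∞) ≤ m := le_trans (by exact_mod_cast Nat.le_succ _) hl
  apply r_zero_of
  · have h1 := d.syl (!b) (1 :: es) (by simpa using h0) (by simpa using hl)
    rw [d.syl b es h0 hl', add_comm]
    simpa [sy, Psum_cons] using h1
  · have h1 := d.syl (!b) (-1 :: es) (by simpa using h0) (by simpa using hl)
    rw [d.syl b es h0 hl', add_comm]
    simpa [sy, Psum_cons] using h1

theorem r_one (hm : 3 ≤ m) (b : Bool) : d.r b 1 = 0 := by
  have := d.r_sy (!b) [] (by simp) (le_trans (by norm_num) hm)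
  simpa [sy] using this

theorem exists_r_ne (v : d.D) (hv : v ≠ 1) : ∃ b, d.r b v ≠ 0 := by
  obtain ⟨N, hN⟩ : ∃ N, wl d.x v = N + 1 :=
    Nat.exists_eq_succ_of_ne_zero (fun h => hv (wl_eq_zero d.gen h))
  obtain ⟨s, ⟨b, hs⟩, h⟩ := wl_succ d.gen hN
  refine ⟨b, fun h0 => ?_⟩
  have e1 := d.len_mul b v 1
  have e2 := d.len_mul b v (-1)
  rw [zpow_one] at e1
  rw [zpow_neg_one] at e2
  rw [h0] at e1 e2
  rcases hs with rfl | rfl <;> omega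

theorem r_two (hm : 3 ≤ m) (b : Bool) (s t : ℤ) (ht : t ≠ 0) :
    d.r b (d.x b ^ s * d.x (!b) ^ t) = 0 := by
  by_cases hs : s = 0
  · have := d.r_sy (!b) [t] (by simpa using ht) (le_trans (by norm_num) hm)
    simpa [sy, hs] using this
  · have := d.r_sy (!b) [t, s] (by simp [ht, hs]) (le_trans (by norm_num) hm)
    simpa [sy] using this

theorem r_three (hm : 4 ≤ m) (b : Bool) (a q s : ℤ) (ha : a ≠ 0) (hq : q ≠ 0) (hs : s ≠ 0) :
    d.r b (d.x (!b) ^ a * d.x b ^ q * d.x (!b) ^ s) = 0 := by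
  have := d.r_sy (!b) [s, q, a] (by simp [ha, hq, hs]) (le_trans (by norm_num) hm)
  simpa [sy] using this

end Dih

/-! ### The normal form model -/

/-- An abstract system of two-generator groups glued along generators. -/
structure Sys (I : Type) where
  E : Type
  mem : I → E → Prop
  two : ∀ e, ∃ i j, i ≠ j ∧ mem i e ∧ mem j e ∧ ∀ k, mem k e → k = i ∨ k = j
  uniq : ∀ i j e e', i ≠ j → mem i e → mem j e → mem i e' → mem j e' → e = e'
  cov : ∀ i, ∃ e, mem i e
  D : E → Type
  grp : ∀ e, Group (D e)
  x : ∀ e, I → D e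
  len : ∀ e, D e → ℕ
  r : ∀ e, I → D e → ℤ
  len_one : ∀ e, len e 1 = 0
  len_mul : ∀ e i v (t : ℤ), mem i e → len e (v * x e i ^ t) + (r e i v).natAbs = len e v + (r e i v + t).natAbs
  r_mul : ∀ e i v (t : ℤ), mem i e → r e i (v * x e i ^ t) = r e i v + t
  r_one : ∀ e i, mem i e → r e i 1 = 0
  ex : ∀ e v, v ≠ 1 → ∃ i, mem i e ∧ r e i v ≠ 0
  r_two : ∀ e i j (s t : ℤ), mem i e → mem j e → i ≠ j → t ≠ 0 → r e i (x e i ^ s * x e j ^ t) = 0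

attribute [instance] Sys.grp

/-- Pieces of normal forms. -/
inductive Piece {I : Type} (S : Sys I) where
  | syl (i : I) (r : ℤ) : Piece S
  | dih (e : S.E) (v : S.D e) : Piece S

namespace Sys
variable {I : Type} (S : Sys I)

/-- two-ended elements -/
def T (e : S.E) (v : S.D e) : Prop := ∀ i, S.mem i e → S.r e i v ≠ 0

open Classical in
/-- maximal right divisor in the `e`-th two-generator group -/
noncomputable def RD (e : S.E) : List (Piece S) → S.D e
  | [] => 1
  | .syl i r :: y => if S.mem i e then RD e y * S.x e i ^ r else 1
  | .dih e' v :: _ => if h : e' = e then h ▸ v else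
      if h : ∃ i, S.mem i e ∧ S.mem i e' then S.x e h.choose ^ (S.r e' h.choose v) else 1

open Classical in
/-- exponent of the last `i`-power -/
noncomputable def last (i : I) : List (Piece S) → ℤ
  | [] => 0
  | .syl j r :: _ => if i = j then r else 0
  | .dih e v :: _ => if S.mem i e then S.r e i v else 0

/-- valid normal forms -/
def Valid : List (Piece S) → Prop
  | [] => True
  | .syl i r :: y => Valid y ∧ r ≠ 0 ∧ S.last i y = 0 ∧ ∀ e, S.mem i e → ¬ S.T e (S.RD e y * S.x e i ^ r)
  | .dih e v :: y => Valid y ∧ S.RD e y = 1 ∧ S.T e v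

/-- length of a normal form -/
def size : List (Piece S) → ℕ
  | [] => 0
  | .syl _ r :: y => r.natAbs + size y
  | .dih e v :: y => S.len e v + size y

theorem len_strip {e : S.E} {i : I} {v : S.D e} (hi : S.mem i e) :
    S.len e (v * S.x e i ^ (-(S.r e i v))) + (S.r e i v).natAbs = S.len e v := by
  have := S.len_mul e i v (-(S.r e i v)) hi
  simpa using this

open Classical in
/-- assemble `v` on top of `y`, `A` being the operation of adding a syllable to `y` -/
noncomputable def asmA (e : S.E) (A : I → ℤ → List (Piece S)) (y : List (Piece S)) (v : S.D e) : List (Piece S) :=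
  if h1 : v = 1 then y else
  if S.T e v then .dih e v :: y else
  if v * S.x e (S.ex e v h1).choose ^ (-(S.r e (S.ex e v h1).choose v)) = 1 then
    A (S.ex e v h1).choose (S.r e (S.ex e v h1).choose v) else
  .syl (S.ex e v h1).choose (S.r e (S.ex e v h1).choose v) ::
    asmA e A y (v * S.x e (S.ex e v h1).choose ^ (-(S.r e (S.ex e v h1).choose v)))
termination_by S.len e v
decreasing_by
  have h := S.len_strip (v := v) (S.ex e v h1).choose_spec.1
  have h' := (S.ex e v h1).choose_spec.2
  omega

open Classical in
/-- gates and syllable addition, defined simultaneously -/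
noncomputable def GA : List (Piece S) → (S.E → List (Piece S)) × (I → ℤ → List (Piece S))
  | [] => (fun _ => [], fun i t => [.syl i t])
  | .syl j s :: y => (fun e => if S.mem j e then (GA y).1 e else .syl j s :: y,
      fun i t => if h : ∃ e, S.mem i e ∧ S.mem j e ∧ i ≠ j ∧ S.T e (S.RD e (.syl j s :: y) * S.x e i ^ t) then
        .dih h.choose (S.RD h.choose (.syl j s :: y) * S.x h.choose i ^ t) :: (GA y).1 h.choose
        else .syl i t :: .syl j s :: y)
  | .dih e' v :: y => (fun e => if e = e' then y else
        if h : ∃ i, S.mem i e ∧ S.mem i e' then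
          S.asmA e' (GA y).2 y (v * S.x e' h.choose ^ (-(S.r e' h.choose v)))
        else .dih e' v :: y,
      fun i t => .syl i t :: .dih e' v :: y)

noncomputable def gate (e : S.E) (y : List (Piece S)) : List (Piece S) := (S.GA y).1 e
noncomputable def add (i : I) (t : ℤ) (y : List (Piece S)) : List (Piece S) := (S.GA y).2 i t
noncomputable def asm (e : S.E) (y : List (Piece S)) (v : S.D e) : List (Piece S) := S.asmA e (S.GA y).2 y v

variable {S}

theorem inter_eq {e e' : S.E} (hne : e ≠ e') {i j : I} (h1 : S.mem i e) (h2 : S.mem i e')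
    (h3 : S.mem j e) (h4 : S.mem j e') : i = j := by
  by_contra h
  exact hne (S.uniq i j e e' h h1 h3 h2 h4)

theorem T_of {e : S.E} {v : S.D e} {i j : I} (hi : S.mem i e) (hj : S.mem j e) (hij : i ≠ j)
    (h1 : S.r e i v ≠ 0) (h2 : S.r e j v ≠ 0) : S.T e v := by
  intro k hk
  obtain ⟨a, b, hab, ha, hb, hall⟩ := S.two e
  rcases hall k hk with rfl | rfl <;> rcases hall i hi with rfl | rfl <;> rcases hall j hj with rfl | rfl <;>
    first | exact h1 | exact h2 | exact absurd rfl hij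

theorem other {e : S.E} (i : I) : ∃ j, S.mem j e ∧ j ≠ i := by
  obtain ⟨a, b, hab, ha, hb, hall⟩ := S.two e
  by_cases h : a = i
  · exact ⟨b, hb, fun h' => hab (h.trans h'.symm)⟩
  · exact ⟨a, ha, h⟩

theorem T_ne_one {e : S.E} {v : S.D e} (h : S.T e v) : v ≠ 1 := by
  rintro rfl
  obtain ⟨i, _, _, hi, _⟩ := S.two e
  exact h i hi (S.r_one e i hi)

theorem nT_zpow {e : S.E} {i : I} (hi : S.mem i e) (t : ℤ) : ¬ S.T e (S.x e i ^ t) := by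
  intro h
  obtain ⟨j, hj, hji⟩ := other (e := e) i
  by_cases ht : t = 0
  · subst ht; rw [zpow_zero] at h; exact T_ne_one h rfl
  · have := S.r_two e j i 0 t hj hi hji ht
    rw [zpow_zero, one_mul] at this
    exact h j hj this

theorem nT_pow {e : S.E} {i j : I} (hi : S.mem i e) (hj : S.mem j e) (s t : ℤ) :
    ¬ S.T e (S.x e j ^ s * S.x e i ^ t) := by
  by_cases hij : j = i
  · subst hij; rw [← zpow_add]; exact nT_zpow hi _
  · by_cases ht : t = 0
    · subst ht; rw [zpow_zero, mul_one]; exact nT_zpow hj _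
    · intro h; exact h j hj (S.r_two e j i s t hj hi hij ht)

/-! equations -/
theorem RD_nil (e : S.E) : S.RD e [] = 1 := rfl
theorem RD_syl {e : S.E} {i : I} (h : S.mem i e) (r y) : S.RD e (.syl i r :: y) = S.RD e y * S.x e i ^ r := by
  rw [RD, if_pos h]
theorem RD_syl_not {e : S.E} {i : I} (h : ¬ S.mem i e) (r y) : S.RD e (.syl i r :: y) = 1 := by
  rw [RD, if_neg h]
theorem RD_dih (e : S.E) (v y) : S.RD e (.dih e v :: y) = v := by
  rw [RD, dif_pos rfl]
theorem RD_dih_inter {e e' : S.E} (hne : e' ≠ e) {i : I} (h : S.mem i e) (h' : S.mem i e') (v y) :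
    S.RD e (.dih e' v :: y) = S.x e i ^ (S.r e' i v) := by
  have hex : ∃ i, S.mem i e ∧ S.mem i e' := ⟨i, h, h'⟩
  rw [RD, dif_neg hne, dif_pos hex, inter_eq hne hex.choose_spec.2 hex.choose_spec.1 h' h]
theorem RD_dih_disj {e e' : S.E} (hne : e' ≠ e) (h : ¬ ∃ i, S.mem i e ∧ S.mem i e') (v y) :
    S.RD e (.dih e' v :: y) = 1 := by
  rw [RD, dif_neg hne, dif_neg h]

theorem gate_nil (e : S.E) : S.gate e [] = [] := rfl
theorem gate_syl {e : S.E} {i : I} (h : S.mem i e) (r y) : S.gate e (.syl i r :: y) = S.gate e y := by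
  rw [gate, GA]; simp only; rw [if_pos h]; rfl
theorem gate_syl_not {e : S.E} {i : I} (h : ¬ S.mem i e) (r y) : S.gate e (.syl i r :: y) = .syl i r :: y := by
  rw [gate, GA]; simp only; rw [if_neg h]
theorem gate_dih (e : S.E) (v y) : S.gate e (.dih e v :: y) = y := by
  rw [gate, GA]; simp
theorem gate_dih_inter {e e' : S.E} (hne : e' ≠ e) {i : I} (h : S.mem i e) (h' : S.mem i e') (v y) :
    S.gate e (.dih e' v :: y) = S.asm e' y (v * S.x e' i ^ (-(S.r e' i v))) := by
  have hex : ∃ i, S.mem i e ∧ S.mem i e' := ⟨i, h, h'⟩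
  rw [gate, GA]; simp only; rw [if_neg hne.symm, dif_pos hex, asm,
    inter_eq hne hex.choose_spec.2 hex.choose_spec.1 h' h]
theorem gate_dih_disj {e e' : S.E} (hne : e' ≠ e) (h : ¬ ∃ i, S.mem i e ∧ S.mem i e') (v y) :
    S.gate e (.dih e' v :: y) = .dih e' v :: y := by
  rw [gate, GA]; simp only; rw [if_neg hne.symm, dif_neg h]

theorem add_T {e : S.E} {i j : I} (hi : S.mem i e) (hj : S.mem j e) (hij : i ≠ j) {s t : ℤ} {y}
    (h : S.T e (S.RD e (.syl j s :: y) * S.x e i ^ t)) :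
    S.add i t (.syl j s :: y) = .dih e (S.RD e (.syl j s :: y) * S.x e i ^ t) :: S.gate e y := by
  have hex : ∃ e, S.mem i e ∧ S.mem j e ∧ i ≠ j ∧ S.T e (S.RD e (.syl j s :: y) * S.x e i ^ t) :=
    ⟨e, hi, hj, hij, h⟩
  have he : hex.choose = e := S.uniq i j _ _ hij hex.choose_spec.1 hex.choose_spec.2.1 hi hj
  rw [add, GA]; simp only; rw [dif_pos hex, he, gate]

theorem add_nT {i : I} {t : ℤ} {y} (h : ∀ e, S.mem i e → ¬ S.T e (S.RD e y * S.x e i ^ t)) :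
    S.add i t y = .syl i t :: y := by
  rcases y with _ | ⟨⟨j, s⟩ | ⟨e, v⟩, y⟩
  · rfl
  · rw [add, GA]; simp only; rw [dif_neg]
    rintro ⟨e, h1, -, -, h2⟩
    exact h e h1 h2
  · rfl

theorem asm_one (e : S.E) (y) : S.asm e y 1 = y := by
  rw [asm, asmA, dif_pos rfl]

theorem asm_T {e : S.E} {v : S.D e} (h : S.T e v) (y) : S.asm e y v = .dih e v :: y := by
  rw [asm, asmA, dif_neg (T_ne_one h), if_pos h]

open Classical in
theorem asm_syl {e : S.E} {v : S.D e} {i : I} {t : ℤ} (hi : S.mem i e) (h0 : S.r e i v = 0) (ht : t ≠ 0)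
    (h : ¬ S.T e (v * S.x e i ^ t)) (y) :
    (v = 1 → S.asm e y (v * S.x e i ^ t) = S.add i t y) ∧
    (v ≠ 1 → S.asm e y (v * S.x e i ^ t) = .syl i t :: S.asm e y v) := by
  have hr : S.r e i (v * S.x e i ^ t) = t := by rw [S.r_mul e i v t hi, h0, zero_add]
  have h1 : v * S.x e i ^ t ≠ 1 := by
    intro h2; rw [h2, S.r_one e i hi] at hr; exact ht hr.symm
  have hc : (S.ex e _ h1).choose = i := by
    by_contra hne
    exact h (T_of (S.ex e _ h1).choose_spec.1 hi hne (S.ex e _ h1).choose_spec.2 (by rw [hr]; exact ht))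
  have e1 : S.asm e y (v * S.x e i ^ t) = if v = 1 then S.add i t y else .syl i t :: S.asm e y v := by
    rw [asm, asmA, dif_neg h1, if_neg h, hc, hr]
    simp only [mul_assoc, ← zpow_add, add_neg_cancel, zpow_zero, mul_one]
    rfl
  rw [e1]
  exact ⟨fun h => if_pos h, fun h => if_neg h⟩

theorem D_ind {e : S.E} {P : S.D e → Prop} (h1 : P 1)
    (h2 : ∀ v i (t : ℤ), S.mem i e → S.r e i v = 0 → t ≠ 0 → P v → P (v * S.x e i ^ t)) (v : S.D e) : P v := by
  induction hn : S.len e v using Nat.strong_induction_on generalizing v with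
  | _ n ih =>
    by_cases hv : v = 1
    · rw [hv]; exact h1
    · obtain ⟨i, hi, hr⟩ := S.ex e v hv
      have hl := S.len_strip (v := v) hi
      have := h2 (v * S.x e i ^ (-(S.r e i v))) i (S.r e i v) hi (by rw [S.r_mul e i _ _ hi, add_neg_cancel]) hr
        (ih _ (by omega) _ rfl)
      rwa [mul_assoc, ← zpow_add, neg_add_cancel, zpow_zero, mul_one] at this

theorem r_RD {g} (hg : S.Valid g) {e : S.E} {i : I} (hi : S.mem i e) : S.r e i (S.RD e g) = S.last i g := by
  induction g generalizing i with
  | nil => rw [RD_nil, S.r_one e i hi]; rfl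
  | cons p y ih =>
    rcases p with ⟨j, s⟩ | ⟨e', v⟩
    · obtain ⟨hy, hs, hl, hT⟩ := hg
      by_cases hj : S.mem j e
      · rw [RD_syl hj]
        by_cases hij : i = j
        · subst hij
          rw [S.r_mul e i _ _ hi, ih hy hi, hl, last, if_pos rfl, zero_add]
        · rw [last, if_neg hij]
          by_contra h
          refine hT e hj (T_of hi hj hij h ?_)
          rw [S.r_mul e j _ _ hj, ih hy hj, hl, zero_add]
          exact hs
      · rw [RD_syl_not hj, S.r_one e i hi, last, if_neg]
        rintro rfl; exact hj hi
    · obtain ⟨hy, h1, hT⟩ := hg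
      by_cases he : e' = e
      · subst he; rw [RD_dih, last, if_pos hi]
      · by_cases hex : ∃ k, S.mem k e ∧ S.mem k e'
        · obtain ⟨k, hk, hk'⟩ := hex
          rw [RD_dih_inter he hk hk']
          by_cases hik : i = k
          · subst hik
            have := S.r_mul e i 1 (S.r e' i v) hi
            rw [one_mul, S.r_one e i hi, zero_add] at this
            rw [this, last, if_pos hk']
          · have := S.r_two e i k 0 (S.r e' k v) hi hk hik (hT k hk')
            rw [zpow_zero, one_mul] at this
            rw [this, last, if_neg]
            intro h
            exact hik (inter_eq he h hi hk' hk)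
        · rw [RD_dih_disj he hex, S.r_one e i hi, last, if_neg]
          intro h; exact hex ⟨i, hi, h⟩

end Sys

namespace Sys
variable {I : Type} {S : Sys I}

theorem lemU {y} (hy : S.Valid y) {e : S.E} {i : I} (hi : S.mem i e) {t : ℤ} (h0 : S.last i y = 0)
    (hT : S.T e (S.RD e y * S.x e i ^ t)) : ∃ j s y', y = .syl j s :: y' ∧ S.mem j e ∧ i ≠ j := by
  rcases y with _ | ⟨⟨j, s⟩ | ⟨e', v⟩, y⟩
  · rw [RD_nil, one_mul] at hT; exact absurd hT (nT_zpow hi t)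
  · by_cases hj : S.mem j e
    · refine ⟨j, s, y, rfl, hj, ?_⟩
      rintro rfl
      rw [last, if_pos rfl] at h0
      exact hy.2.1 h0
    · rw [RD_syl_not hj, one_mul] at hT; exact absurd hT (nT_zpow hi t)
  · by_cases he : e' = e
    · subst he
      rw [last, if_pos hi] at h0
      exact absurd h0 (hy.2.2 i hi)
    · by_cases hex : ∃ k, S.mem k e ∧ S.mem k e'
      · obtain ⟨k, hk, hk'⟩ := hex
        rw [RD_dih_inter he hk hk'] at hT
        exact absurd hT (nT_pow hi hk _ t)
      · rw [RD_dih_disj he hex, one_mul] at hT; exact absurd hT (nT_zpow hi t)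

theorem gate_of_RD {y} (hy : S.Valid y) {e : S.E} (h : S.RD e y = 1) : S.gate e y = y := by
  rcases y with _ | ⟨⟨j, s⟩ | ⟨e', v⟩, y⟩
  · rfl
  · by_cases hj : S.mem j e
    · have := r_RD hy hj
      rw [h, S.r_one e j hj, last, if_pos rfl] at this
      exact absurd this.symm hy.2.1
    · rw [gate_syl_not hj]
  · by_cases he : e' = e
    · subst he
      rw [RD_dih] at h
      exact absurd h (T_ne_one hy.2.2)
    · by_cases hex : ∃ k, S.mem k e ∧ S.mem k e'
      · obtain ⟨k, hk, hk'⟩ := hex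
        have := r_RD hy hk
        rw [h, S.r_one e k hk, last, if_pos hk'] at this
        exact absurd this.symm (hy.2.2 k hk')
      · rw [gate_dih_disj he hex]

/-- properties of syllable addition -/
structure Good1 (y : List (Piece S)) : Prop where
  valid : ∀ i t, S.last i y = 0 → t ≠ 0 → S.Valid (S.add i t y)
  rd : ∀ i t, S.last i y = 0 → t ≠ 0 → ∀ f, S.mem i f → S.RD f (S.add i t y) = S.RD f y * S.x f i ^ t
  gt : ∀ i t, S.last i y = 0 → t ≠ 0 → ∀ f, S.mem i f → S.gate f (S.add i t y) = S.gate f y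
  sz : ∀ i t, S.last i y = 0 → t ≠ 0 → S.size (S.add i t y) = S.size y + t.natAbs
  pw : ∀ i t, S.last i y = 0 → t ≠ 0 → ∀ f, ¬ S.mem i f → ∃ k, S.mem k f ∧ ∃ s : ℤ, S.RD f (S.add i t y) = S.x f k ^ s

/-- properties of gates -/
structure Good2 (y : List (Piece S)) : Prop where
  valid : ∀ e, S.Valid (S.gate e y)
  rd : ∀ e, S.RD e (S.gate e y) = 1
  asm : ∀ e, S.asm e (S.gate e y) (S.RD e y) = y
  sz : ∀ e, S.size (S.gate e y) + S.len e (S.RD e y) = S.size y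

structure Good4 (e : S.E) (y : List (Piece S)) (v : S.D e) : Prop where
  valid : S.Valid (S.asm e y v)
  rd : S.RD e (S.asm e y v) = v
  gt : S.gate e (S.asm e y v) = y
  sz : S.size (S.asm e y v) = S.size y + S.len e v

theorem nT_of_mul {e : S.E} {v : S.D e} {i : I} (hi : S.mem i e) (h0 : S.r e i v = 0) : ¬ S.T e v :=
  fun h => h i hi h0

theorem strip_form {e : S.E} {v : S.D e} (hv : v ≠ 1) : ∃ (j : I) (s : ℤ) (v' : S.D e), S.mem j e ∧ S.r e j v' = 0 ∧ s ≠ 0 ∧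
    v = v' * S.x e j ^ s := by
  obtain ⟨j, hj, hr⟩ := S.ex e v hv
  refine ⟨j, S.r e j v, v * S.x e j ^ (-(S.r e j v)), hj, ?_, hr, ?_⟩
  · rw [S.r_mul e j _ _ hj, add_neg_cancel]
  · rw [mul_assoc, ← zpow_add, neg_add_cancel, zpow_zero, mul_one]

theorem len_add {e : S.E} {v : S.D e} {i : I} (hi : S.mem i e) (h0 : S.r e i v = 0) (t : ℤ) :
    S.len e (v * S.x e i ^ t) = S.len e v + t.natAbs := by
  have := S.len_mul e i v t hi
  rw [h0] at this
  simpa using this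

theorem good4 {y} (hy : S.Valid y) (h1 : Good1 y) {e : S.E} (hrd : S.RD e y = 1) (v : S.D e) : Good4 e y v := by
  induction v using D_ind with
  | h1 =>
    rw [show Good4 e y 1 ↔ _ from Iff.rfl]
    exact ⟨by rwa [asm_one], by rwa [asm_one], by rw [asm_one]; exact gate_of_RD hy hrd,
      by rw [asm_one, S.len_one, add_zero]⟩
  | h2 v i t hi h0 ht ih =>
    by_cases hT : S.T e (v * S.x e i ^ t)
    · rw [show Good4 e y (v * S.x e i ^ t) ↔ _ from Iff.rfl]
      exact ⟨by rw [asm_T hT]; exact ⟨hy, hrd, hT⟩, by rw [asm_T hT, RD_dih], by rw [asm_T hT, gate_dih],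
        by rw [asm_T hT, size, add_comm]⟩
    · obtain ⟨a1, a2⟩ := asm_syl hi h0 ht hT y
      by_cases hv : v = 1
      · have e1 := a1 hv
        subst hv
        have hl : S.last i y = 0 := by rw [← r_RD hy hi, hrd, S.r_one e i hi]
        exact ⟨by rw [e1]; exact h1.valid i t hl ht, by rw [e1, h1.rd i t hl ht e hi, hrd],
          by rw [e1, h1.gt i t hl ht e hi, gate_of_RD hy hrd],
          by rw [e1, h1.sz i t hl ht, len_add hi h0, S.len_one, zero_add]⟩
      · have e1 := a2 hv
        refine ⟨?_, by rw [e1, RD_syl hi, ih.rd], by rw [e1, gate_syl hi, ih.gt],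
          by rw [e1, size, ih.sz, len_add hi h0]; omega⟩
        rw [e1]
        refine ⟨ih.valid, ht, by rw [← r_RD ih.valid hi, ih.rd, h0], ?_⟩
        intro f hf
        by_cases hfe : f = e
        · subst hfe; rwa [ih.rd]
        obtain ⟨j, s, v', hj, hj0, hs, rfl⟩ := strip_form hv
        have hji : j ≠ i := by
          rintro rfl
          rw [S.r_mul e j _ _ hj, hj0] at h0
          omega
        have hjf : ¬ S.mem j f := fun h => hji (inter_eq hfe h hj hf hi)
        obtain ⟨b1, b2⟩ := asm_syl hj hj0 hs (nT_of_mul hi h0) y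
        by_cases hv' : v' = 1
        · rw [b1 hv']
          subst hv'
          have hl : S.last j y = 0 := by rw [← r_RD hy hj, hrd, S.r_one e j hj]
          obtain ⟨k, hk, q, hq⟩ := h1.pw j s hl hs f hjf
          rw [hq]
          exact nT_pow hf hk q t
        · rw [b2 hv', RD_syl_not hjf, one_mul]
          exact nT_zpow hf t

theorem good2_nil : Good2 (S := S) [] where
  valid := fun e => by rw [gate_nil]; trivial
  rd := fun e => rfl
  asm := fun e => by rw [gate_nil, RD_nil, asm_one]
  sz := fun e => by rw [gate_nil, RD_nil, S.len_one, add_zero]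

theorem good2_of_one {g} (hg : S.Valid g) {e : S.E} (h : S.RD e g = 1) :
    S.Valid (S.gate e g) ∧ S.RD e (S.gate e g) = 1 ∧ S.asm e (S.gate e g) (S.RD e g) = g ∧
      S.size (S.gate e g) + S.len e (S.RD e g) = S.size g := by
  rw [gate_of_RD hg h]
  refine ⟨hg, h, ?_, ?_⟩
  · rw [h, asm_one]
  · rw [h, S.len_one, add_zero]

theorem good2_syl {i : I} {t : ℤ} {y} (hg : S.Valid (.syl i t :: y)) (h2 : Good2 y) (e : S.E) :
    S.Valid (S.gate e (.syl i t :: y)) ∧ S.RD e (S.gate e (.syl i t :: y)) = 1 ∧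
    S.asm e (S.gate e (.syl i t :: y)) (S.RD e (.syl i t :: y)) = .syl i t :: y ∧
      S.size (S.gate e (.syl i t :: y)) + S.len e (S.RD e (.syl i t :: y)) = S.size (.syl i t :: y) := by
  by_cases hi : S.mem i e
  · obtain ⟨hy, ht, hl, hT⟩ := hg
    have h0 : S.r e i (S.RD e y) = 0 := by rw [r_RD hy hi, hl]
    rw [gate_syl hi, RD_syl hi]
    refine ⟨h2.valid e, h2.rd e, ?_, ?_⟩
    · obtain ⟨a1, a2⟩ := asm_syl hi h0 ht (hT e hi) (S.gate e y)
      by_cases hv : S.RD e y = 1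
      · rw [a1 hv, gate_of_RD hy hv]
        exact add_nT hT
      · rw [a2 hv, h2.asm]
    · rw [len_add hi h0, size, ← h2.sz e]; omega
  · exact good2_of_one hg (RD_syl_not hi t y)

theorem good2_dih {e' : S.E} {v : S.D e'} {y} (hg : S.Valid (.dih e' v :: y)) (h1 : Good1 y) (e : S.E) :
    S.Valid (S.gate e (.dih e' v :: y)) ∧ S.RD e (S.gate e (.dih e' v :: y)) = 1 ∧
    S.asm e (S.gate e (.dih e' v :: y)) (S.RD e (.dih e' v :: y)) = .dih e' v :: y ∧
      S.size (S.gate e (.dih e' v :: y)) + S.len e (S.RD e (.dih e' v :: y)) = S.size (.dih e' v :: y) := by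
  by_cases he : e' = e
  · subst he
    obtain ⟨hy, h, hT⟩ := hg
    rw [gate_dih, RD_dih, asm_T hT, size]
    exact ⟨hy, h, rfl, by omega⟩
  by_cases hex : ∃ i, S.mem i e ∧ S.mem i e'
  · obtain ⟨i, hi, hi'⟩ := hex
    obtain ⟨hy, h, hT⟩ := hg
    rw [gate_dih_inter he hi hi', RD_dih_inter he hi hi']
    have hsl := S.len_strip (v := v) hi'
    have hmul : v * S.x e' i ^ (-(S.r e' i v)) * S.x e' i ^ (S.r e' i v) = v := by
      rw [mul_assoc, ← zpow_add, neg_add_cancel, zpow_zero, mul_one]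
    have h0 : S.r e' i (v * S.x e' i ^ (-(S.r e' i v))) = 0 := by
      rw [S.r_mul e' i _ _ hi', add_neg_cancel]
    set v' := v * S.x e' i ^ (-(S.r e' i v)) with hv'
    set t := S.r e' i v with ht
    have ht0 : t ≠ 0 := hT i hi'
    have hv1 : v' ≠ 1 := by
      intro h1; rw [h1, one_mul] at hmul; rw [← hmul] at hT; exact nT_zpow hi' t hT
    have g4 := good4 hy h1 h v'
    obtain ⟨j, s, v'', hj, hj0, hs, e1⟩ := strip_form hv1
    have hji : j ≠ i := by
      rintro rfl
      rw [e1, S.r_mul e' j _ _ hj, hj0] at h0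
      omega
    have hje : ¬ S.mem j e := fun h => hji (inter_eq he hj h hi' hi)
    have hv2 : v'' ≠ 1 := by
      intro h2
      rw [e1, h2, one_mul] at hmul
      rw [← hmul] at hT
      exact nT_pow hi' hj _ _ hT
    have e2 : S.asm e' y v' = .syl j s :: S.asm e' y v'' := by
      have := (asm_syl hj hj0 hs (by rw [← e1]; exact nT_of_mul hi' h0) y).2 hv2
      rwa [← e1] at this
    have hrd1 : S.RD e (S.asm e' y v') = 1 := by rw [e2, RD_syl_not hje]
    have hl0 : S.last i (S.asm e' y v') = 0 := by rw [← r_RD g4.valid hi', g4.rd, h0]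
    refine ⟨g4.valid, hrd1, ?_, ?_⟩
    · have hnT : ¬ S.T e (1 * S.x e i ^ t) := by rw [one_mul]; exact nT_zpow hi t
      have := (asm_syl hi (S.r_one e i hi) ht0 hnT (S.asm e' y v')).1 rfl
      rw [one_mul] at this
      rw [this]
      have hT2 : S.T e' (S.RD e' (S.asm e' y v') * S.x e' i ^ t) := by rw [g4.rd, hmul]; exact hT
      have hg := g4.gt
      have hr := g4.rd
      rw [e2] at hT2 hg hr ⊢
      rw [add_T hi' hj hji.symm hT2, hr, hmul]
      rw [gate_syl hj] at hg
      rw [hg]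
    · have := len_add hi (S.r_one e i hi) t
      rw [one_mul, S.len_one] at this
      rw [g4.sz, this, size, ← hsl]; omega
  · exact good2_of_one hg (RD_dih_disj he hex v y)

theorem good1_of_nT {y} (hy : S.Valid y) {i : I} {t : ℤ} (h0 : S.last i y = 0) (ht : t ≠ 0)
    (hT : ∀ e, S.mem i e → ¬ S.T e (S.RD e y * S.x e i ^ t)) :
    S.Valid (S.add i t y) ∧ (∀ f, S.mem i f → S.RD f (S.add i t y) = S.RD f y * S.x f i ^ t) ∧
    (∀ f, S.mem i f → S.gate f (S.add i t y) = S.gate f y) ∧ S.size (S.add i t y) = S.size y + t.natAbs ∧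
    (∀ f, ¬ S.mem i f → ∃ k, S.mem k f ∧ ∃ s : ℤ, S.RD f (S.add i t y) = S.x f k ^ s) := by
  rw [add_nT hT]
  refine ⟨⟨hy, ht, h0, hT⟩, fun f hf => RD_syl hf t y, fun f hf => gate_syl hf t y, by rw [size, add_comm], ?_⟩
  intro f hf
  obtain ⟨k, _, _, hk, _⟩ := S.two f
  exact ⟨k, hk, 0, by rw [RD_syl_not hf, zpow_zero]⟩

theorem good1_main {y} (hy : S.Valid y) (h2 : Good2 y) (h2t : ∀ p y', y = p :: y' → Good2 y')
    {i : I} {t : ℤ} (h0 : S.last i y = 0) (ht : t ≠ 0) :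
    S.Valid (S.add i t y) ∧ (∀ f, S.mem i f → S.RD f (S.add i t y) = S.RD f y * S.x f i ^ t) ∧
    (∀ f, S.mem i f → S.gate f (S.add i t y) = S.gate f y) ∧ S.size (S.add i t y) = S.size y + t.natAbs ∧
    (∀ f, ¬ S.mem i f → ∃ k, S.mem k f ∧ ∃ s : ℤ, S.RD f (S.add i t y) = S.x f k ^ s) := by
  by_cases hT : ∀ e, S.mem i e → ¬ S.T e (S.RD e y * S.x e i ^ t)
  · exact good1_of_nT hy h0 ht hT
  push Not at hT
  obtain ⟨e, hi, hT⟩ := hT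
  obtain ⟨j, s, y', rfl, hj, hij⟩ := lemU hy hi h0 hT
  have g2 := h2t _ y' rfl
  have hr0 : S.r e i (S.RD e (.syl j s :: y')) = 0 := by rw [r_RD hy hi, h0]
  have hrt : S.r e i (S.RD e (.syl j s :: y') * S.x e i ^ t) = t := by rw [S.r_mul e i _ _ hi, hr0, zero_add]
  rw [add_T hi hj hij hT]
  refine ⟨⟨g2.valid e, g2.rd e, hT⟩, ?_, ?_, ?_, ?_⟩
  · intro f hf
    by_cases hfe : e = f
    · subst hfe; rw [RD_dih]
    · rw [RD_dih_inter hfe hf hi, RD_syl_not (e := f), hrt, one_mul]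
      intro h
      exact hij (inter_eq hfe hi hf hj h)
  · intro f hf
    by_cases hfe : e = f
    · subst hfe; rw [gate_dih, gate_syl hj]
    · rw [gate_dih_inter hfe hf hi, hrt, mul_assoc, ← zpow_add, add_neg_cancel, zpow_zero, mul_one]
      have := h2.asm e
      rw [gate_syl hj] at this
      rw [this, gate_syl_not]
      intro h
      exact hij (inter_eq hfe hi hf hj h)
  · rw [← h2.sz e, size, len_add hi hr0, gate_syl hj]; omega
  · intro f hf
    have hfe : e ≠ f := by rintro rfl; exact hf hi
    by_cases hex : ∃ k, S.mem k f ∧ S.mem k e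
    · obtain ⟨k, hk, hk'⟩ := hex
      exact ⟨k, hk, _, RD_dih_inter hfe hk hk' _ _⟩
    · obtain ⟨k, _, _, hk, _⟩ := S.two f
      exact ⟨k, hk, 0, by rw [RD_dih_disj hfe hex, zpow_zero]⟩

theorem good12 (y) (hy : S.Valid y) : Good2 y ∧ Good1 y := by
  induction y with
  | nil =>
    refine ⟨good2_nil, ?_⟩
    have key := fun i t => good1_main (i := i) (t := t) hy good2_nil (by simp)
    exact ⟨fun i t h h' => (key i t h h').1, fun i t h h' => (key i t h h').2.1,
      fun i t h h' => (key i t h h').2.2.1, fun i t h h' => (key i t h h').2.2.2.1,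
      fun i t h h' => (key i t h h').2.2.2.2⟩
  | cons p y ih =>
    have hyv : S.Valid y := by
      rcases p with ⟨i, t⟩ | ⟨e, v⟩
      · exact hy.1
      · exact hy.1
    obtain ⟨i2, i1⟩ := ih hyv
    have g2 : Good2 (p :: y) := by
      rcases p with ⟨i, t⟩ | ⟨e, v⟩
      · have := good2_syl hy i2
        exact ⟨fun e => (this e).1, fun e => (this e).2.1, fun e => (this e).2.2.1, fun e => (this e).2.2.2⟩
      · have := good2_dih hy i1
        exact ⟨fun e => (this e).1, fun e => (this e).2.1, fun e => (this e).2.2.1, fun e => (this e).2.2.2⟩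
    refine ⟨g2, ?_⟩
    have key := fun i t => good1_main (i := i) (t := t) hy g2 (by
      intro p' y' h
      rw [List.cons.injEq] at h
      rw [← h.2]; exact i2)
    exact ⟨fun i t h h' => (key i t h h').1, fun i t h h' => (key i t h h').2.1,
      fun i t h h' => (key i t h h').2.2.1, fun i t h h' => (key i t h h').2.2.2.1,
      fun i t h h' => (key i t h h').2.2.2.2⟩

theorem good4' {y} (hy : S.Valid y) {e : S.E} (hrd : S.RD e y = 1) (v : S.D e) : Good4 e y v :=
  good4 hy (good12 y hy).2 hrd v

end Sys

namespace Sys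
variable {I : Type} {S : Sys I}

theorem asm_add {y} (hy : S.Valid y) {e : S.E} (hrd : S.RD e y = 1) {v : S.D e} {i : I} {t : ℤ}
    (hi : S.mem i e) (h0 : S.r e i v = 0) (ht : t ≠ 0) :
    S.asm e y (v * S.x e i ^ t) = S.add i t (S.asm e y v) := by
  have g4 := good4' hy hrd v
  have hl : S.last i (S.asm e y v) = 0 := by rw [← r_RD g4.valid hi, g4.rd, h0]
  by_cases hT : S.T e (v * S.x e i ^ t)
  · rw [asm_T hT]
    have hT' : S.T e (S.RD e (S.asm e y v) * S.x e i ^ t) := by rwa [g4.rd]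
    obtain ⟨j, s, y', he, hj, hij⟩ := lemU g4.valid hi hl hT'
    have hg := g4.gt
    have hr := g4.rd
    rw [he] at hT' hg hr ⊢
    rw [gate_syl hj] at hg
    rw [add_T hi hj hij hT', hr, hg]
  · obtain ⟨a1, a2⟩ := asm_syl hi h0 ht hT y
    by_cases hv : v = 1
    · rw [a1 hv, hv, asm_one]
    · have hval := (good4' hy hrd (v * S.x e i ^ t)).valid
      rw [a2 hv] at hval ⊢
      rw [add_nT hval.2.2.2]

open Classical in
noncomputable def addz (i : I) (t : ℤ) (y : List (Piece S)) : List (Piece S) := if t = 0 then y else S.add i t y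

open Classical in
noncomputable def strip (i : I) : List (Piece S) → List (Piece S)
  | [] => []
  | .syl j r :: y => if i = j then y else .syl j r :: y
  | .dih e v :: y => if S.mem i e then S.asm e y (v * S.x e i ^ (-(S.r e i v))) else .dih e v :: y

noncomputable def act (e : S.E) (h : S.D e) (g : List (Piece S)) : List (Piece S) :=
  S.asm e (S.gate e g) (S.RD e g * h)

theorem strip_eq {g} (hg : S.Valid g) {e : S.E} {i : I} (hi : S.mem i e) :
    S.asm e (S.gate e g) (S.RD e g * S.x e i ^ (-(S.last i g))) = strip i g := by
  have g2 := (good12 g hg).1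
  rcases g with _ | ⟨⟨j, s⟩ | ⟨e', v⟩, y⟩
  · simp only [last, neg_zero, zpow_zero, mul_one, strip]; exact g2.asm e
  · by_cases hij : i = j
    · subst hij
      rw [gate_syl hi, RD_syl hi, last, if_pos rfl, strip, if_pos rfl, mul_assoc, ← zpow_add, add_neg_cancel,
        zpow_zero, mul_one]
      exact (good12 y hg.1).1.asm e
    · rw [last, if_neg hij, strip, if_neg hij, neg_zero, zpow_zero, mul_one]
      exact g2.asm e
  · by_cases hi' : S.mem i e'
    · rw [last, if_pos hi', strip, if_pos hi']
      by_cases he : e' = e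
      · subst he; rw [gate_dih, RD_dih]
      · rw [gate_dih_inter he hi hi', RD_dih_inter he hi hi', ← zpow_add, add_neg_cancel, zpow_zero, asm_one]
    · rw [last, if_neg hi', strip, if_neg hi', neg_zero, zpow_zero, mul_one]
      exact g2.asm e

theorem act_x {g} (hg : S.Valid g) {e : S.E} {i : I} (hi : S.mem i e) (t : ℤ) :
    act e (S.x e i ^ t) g = addz i (S.last i g + t) (strip i g) := by
  rw [← strip_eq hg hi, act, addz]
  have g2 := (good12 g hg).1
  have hr := r_RD hg hi
  split_ifs with h
  · congr 3; omega
  · rw [← asm_add (g2.valid e) (g2.rd e) hi (by rw [S.r_mul e i _ _ hi, hr, add_neg_cancel]) h, mul_assoc,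
      ← zpow_add]
    congr 3; omega

theorem act_valid {g} (hg : S.Valid g) {e : S.E} (h : S.D e) : S.Valid (act e h g) := by
  have g2 := (good12 g hg).1
  exact (good4' (g2.valid e) (g2.rd e) _).valid

theorem act_RD {g} (hg : S.Valid g) {e : S.E} (h : S.D e) : S.RD e (act e h g) = S.RD e g * h := by
  have g2 := (good12 g hg).1
  exact (good4' (g2.valid e) (g2.rd e) _).rd

theorem act_gate {g} (hg : S.Valid g) {e : S.E} (h : S.D e) : S.gate e (act e h g) = S.gate e g := by
  have g2 := (good12 g hg).1
  exact (good4' (g2.valid e) (g2.rd e) _).gt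

theorem act_size {g} (hg : S.Valid g) {e : S.E} (h : S.D e) :
    S.size (act e h g) = S.size (S.gate e g) + S.len e (S.RD e g * h) := by
  have g2 := (good12 g hg).1
  exact (good4' (g2.valid e) (g2.rd e) _).sz

theorem act_one {g} (hg : S.Valid g) {e : S.E} : act e 1 g = g := by
  rw [act, mul_one]; exact (good12 g hg).1.asm e

theorem act_mul {g} (hg : S.Valid g) {e : S.E} (h k : S.D e) : act e (h * k) g = act e k (act e h g) := by
  conv_rhs => rw [act, act_RD hg, act_gate hg]
  rw [act, mul_assoc]

variable (S) in
abbrev NF : Type := {g : List (Piece S) // S.Valid g}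

noncomputable def actPerm (e : S.E) (h : S.D e) : Equiv.Perm (NF S) where
  toFun g := ⟨act e h g.1, act_valid g.2 h⟩
  invFun g := ⟨act e h⁻¹ g.1, act_valid g.2 _⟩
  left_inv g := by apply Subtype.ext; simp only; rw [← act_mul g.2, mul_inv_cancel, act_one g.2]
  right_inv g := by apply Subtype.ext; simp only; rw [← act_mul g.2, inv_mul_cancel, act_one g.2]

noncomputable def actHom (e : S.E) : S.D e →* (Equiv.Perm (NF S))ᵐᵒᵖ where
  toFun h := MulOpposite.op (actPerm e h)
  map_one' := by
    apply MulOpposite.unop_injective; ext1 g; apply Subtype.ext; exact act_one g.2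
  map_mul' h k := by
    apply MulOpposite.unop_injective; ext1 g; apply Subtype.ext; exact act_mul g.2 h k

variable (S) in
noncomputable def sigma (i : I) : (Equiv.Perm (NF S))ᵐᵒᵖ := actHom (S.cov i).choose (S.x _ i)

theorem actHom_x {e : S.E} {i : I} (hi : S.mem i e) : actHom e (S.x e i) = S.sigma i := by
  apply MulOpposite.unop_injective; ext1 g; apply Subtype.ext
  have h1 := act_x g.2 hi 1
  have h2 := act_x g.2 (S.cov i).choose_spec 1
  rw [zpow_one] at h1 h2
  exact h1.trans h2.symm

section model
variable {G : Type} [Group G] {y : I → G}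

/-- The value of a normal form. -/
noncomputable def val (y : I → G) (φ : ∀ e, S.D e →* G) : List (Piece S) → G
  | [] => 1
  | .syl i r :: g => val y φ g * y i ^ r
  | .dih e v :: g => val y φ g * φ e v

variable {φ : ∀ e, S.D e →* G}

theorem val_asm (hφ : ∀ e i, S.mem i e → φ e (S.x e i) = y i) {g}
    (h : ∀ i t, S.last i g = 0 → t ≠ 0 → val y φ (S.add i t g) = val y φ g * y i ^ t) (hg : S.Valid g)
    {e : S.E} (hrd : S.RD e g = 1) (v : S.D e) :
    val y φ (S.asm e g v) = val y φ g * φ e v := by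
  induction v using D_ind with
  | h1 => rw [asm_one, map_one, mul_one]
  | h2 v i t hi h0 ht ih =>
    by_cases hT : S.T e (v * S.x e i ^ t)
    · rw [asm_T hT]; rfl
    · obtain ⟨a1, a2⟩ := asm_syl hi h0 ht hT g
      by_cases hv : v = 1
      · rw [a1 hv, hv, one_mul, map_zpow, hφ e i hi]
        exact h i t (by rw [← r_RD hg hi, hrd, S.r_one e i hi]) ht
      · rw [a2 hv, val, ih, map_mul, map_zpow, hφ e i hi, mul_assoc]

theorem val_gate_add (hφ : ∀ e i, S.mem i e → φ e (S.x e i) = y i) (g) (hg : S.Valid g) :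
    (∀ e, val y φ (S.gate e g) * φ e (S.RD e g) = val y φ g) ∧
    (∀ i t, S.last i g = 0 → t ≠ 0 → val y φ (S.add i t g) = val y φ g * y i ^ t) := by
  induction g with
  | nil =>
    refine ⟨fun e => by rw [gate_nil, RD_nil, map_one, mul_one], fun i t _ _ => rfl⟩
  | cons p g ih =>
    have hgv : S.Valid g := by
      rcases p with ⟨i, t⟩ | ⟨e, v⟩
      · exact hg.1
      · exact hg.1
    obtain ⟨ih1, ih2⟩ := ih hgv
    have key : ∀ e, val y φ (S.gate e (p :: g)) * φ e (S.RD e (p :: g)) = val y φ (p :: g) := by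
      intro e
      by_cases h1 : S.RD e (p :: g) = 1
      · rw [h1, gate_of_RD hg h1, map_one, mul_one]
      rcases p with ⟨i, t⟩ | ⟨e', v⟩
      · by_cases hi : S.mem i e
        · rw [gate_syl hi, RD_syl hi, map_mul, ← mul_assoc, ih1, map_zpow, hφ e i hi]; rfl
        · exact absurd (RD_syl_not hi t g) h1
      · by_cases he : e' = e
        · subst he; rw [gate_dih, RD_dih]; rfl
        · by_cases hex : ∃ i, S.mem i e ∧ S.mem i e'
          · obtain ⟨i, hi, hi'⟩ := hex
            rw [gate_dih_inter he hi hi', RD_dih_inter he hi hi', val_asm hφ ih2 hgv hg.2.1, map_zpow, hφ e i hi,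
              map_mul, map_zpow, hφ e' i hi', mul_assoc, mul_assoc, ← zpow_add, neg_add_cancel, zpow_zero, mul_one]
            rfl
          · exact absurd (RD_dih_disj he hex v g) h1
    refine ⟨key, ?_⟩
    intro i t hl ht
    by_cases hT : ∀ e, S.mem i e → ¬ S.T e (S.RD e (p :: g) * S.x e i ^ t)
    · rw [add_nT hT]; rfl
    push Not at hT
    obtain ⟨e, hi, hT⟩ := hT
    obtain ⟨j, s, y', he, hj, hij⟩ := lemU hg hi hl hT
    rw [List.cons.injEq] at he
    obtain ⟨rfl, rfl⟩ := he
    have k := key e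
    rw [gate_syl hj] at k
    rw [add_T hi hj hij hT]
    show val y φ (S.gate e g) * φ e (_ * _) = val y φ (.syl j s :: g) * y i ^ t
    rw [map_mul, ← mul_assoc, k, map_zpow, hφ e i hi]

theorem val_act (hφ : ∀ e i, S.mem i e → φ e (S.x e i) = y i) {g} (hg : S.Valid g) (e : S.E) (h : S.D e) :
    val y φ (act e h g) = val y φ g * φ e h := by
  have g2 := (good12 g hg).1
  rw [act, val_asm hφ (val_gate_add hφ _ (g2.valid e)).2 (g2.valid e) (g2.rd e), map_mul, ← mul_assoc,
    (val_gate_add hφ g hg).1 e]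

end model

/-- The final description of the glued group. -/
structure Model (S : Sys I) {G : Type} [Group G] (y : I → G) (φ : ∀ e, S.D e →* G) where
  RD : ∀ e, G → S.D e
  last : I → G → ℤ
  gate : S.E → G → G
  gate_mul : ∀ e u, gate e u * φ e (RD e u) = u
  RD_mul : ∀ e u h, RD e (u * φ e h) = RD e u * h
  gate_coset : ∀ e u h, gate e (u * φ e h) = gate e u
  len : ∀ e u, wl y u = wl y (gate e u) + S.len e (RD e u)
  r_RD : ∀ e i u, S.mem i e → S.r e i (RD e u) = last i u
  two : ∀ i j f u, i ≠ j → last i u ≠ 0 → last j u ≠ 0 → S.mem j f → ¬ S.mem i f → RD f u = S.x f j ^ (last j u)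
  last_ex : ∀ i j u, i ≠ j → last i u ≠ 0 → last j u ≠ 0 → ∃ e, S.mem i e ∧ S.mem j e
  RD_one : ∀ e, RD e 1 = 1

theorem exists_model {G : Type} [Group G] {y : I → G} (hy : Subgroup.closure (Set.range y) = ⊤)
    {φ : ∀ e, S.D e →* G} (hφ : ∀ e i, S.mem i e → φ e (S.x e i) = y i)
    (ρ : G →* (Equiv.Perm (NF S))ᵐᵒᵖ) (hρ : ∀ i, ρ (y i) = S.sigma i) : Nonempty (Model S y φ) := by
  have hρφ : ∀ e (h : S.D e), ρ (φ e h) = actHom e h := by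
    intro e h
    induction h using D_ind with
    | h1 => simp
    | h2 v i t hi h0 ht ih =>
      rw [map_mul, map_mul, ih, map_zpow, map_zpow, hφ e i hi, hρ, map_mul, map_zpow, actHom_x hi]
  have hval : ∀ u (w : NF S), val y φ ((ρ u).unop w).1 = val y φ w.1 * u := by
    intro u
    have hu : u ∈ Subgroup.closure (Set.range y) := by rw [hy]; trivial
    induction hu using Subgroup.closure_induction with
    | mem z hz =>
      obtain ⟨i, rfl⟩ := hz
      intro w
      obtain ⟨e, he⟩ := S.cov i
      rw [hρ, ← actHom_x he, ← hφ e i he]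
      exact val_act hφ w.2 e _
    | one => intro w; simp
    | mul a b _ _ ha hb =>
      intro w
      rw [map_mul, MulOpposite.unop_mul, Equiv.Perm.mul_apply, hb, ha, mul_assoc]
    | inv a _ ha =>
      intro w
      have := ha ((ρ a⁻¹).unop w)
      rw [← Equiv.Perm.mul_apply, ← MulOpposite.unop_mul, ← map_mul, inv_mul_cancel, map_one, MulOpposite.unop_one,
        Equiv.Perm.one_apply] at this
      rw [this, mul_inv_cancel_right]
  set nf : G → NF S := fun u => (ρ u).unop ⟨[], trivial⟩ with hnf
  have hvn : ∀ u, val y φ (nf u).1 = u := by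
    intro u; rw [hnf]; simp only; rw [hval]; simp [val]
  have hnm : ∀ u e (h : S.D e), (nf (u * φ e h)).1 = act e h (nf u).1 := by
    intro u e h
    rw [hnf]; simp only
    rw [map_mul, MulOpposite.unop_mul, Equiv.Perm.mul_apply, hρφ]
    rfl
  have hnv : ∀ g (hg : S.Valid g), (nf (val y φ g)).1 = g := by
    intro g
    induction g with
    | nil => intro _; rw [hnf]; simp [val]
    | cons p g ih =>
      intro hg
      rcases p with ⟨i, t⟩ | ⟨e, v⟩
      · obtain ⟨e, he⟩ := S.cov i
        rw [val, ← hφ e i he, ← map_zpow, hnm, ih hg.1, act]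
        have := (good12 _ hg).1.asm e
        rwa [gate_syl he, RD_syl he] at this
      · rw [val, hnm, ih hg.1, act, hg.2.1, gate_of_RD hg.1 hg.2.1, one_mul, asm_T hg.2.2]
  have hwφ : ∀ e (h : S.D e), wl y (φ e h) ≤ S.len e h := by
    intro e h
    induction h using D_ind with
    | h1 => rw [map_one, wl_one]; omega
    | h2 v i t hi h0 ht ih =>
      rw [len_add hi h0, map_mul, map_zpow, hφ e i hi]
      have := wl_mul_le hy (φ e v) (y i ^ t)
      have := wl_zpow_le hy i t
      omega
  have hws : ∀ g : List (Piece S), wl y (val y φ g) ≤ S.size g := by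
    intro g
    induction g with
    | nil => rw [val, wl_one]; omega
    | cons p g ih =>
      rcases p with ⟨i, t⟩ | ⟨e, v⟩
      · have := wl_mul_le hy (val y φ g) (y i ^ t)
        have := wl_zpow_le hy i t
        rw [val, size]; omega
      · have := wl_mul_le hy (val y φ g) (φ e v)
        have := hwφ e v
        rw [val, size]; omega
  have hsz : ∀ u, wl y u = S.size (nf u).1 := by
    intro u
    apply le_antisymm
    · have := hws (nf u).1
      rwa [hvn] at this
    · have := le_wl hy (fun u => (S.size (nf u).1 : ℤ)) (by simp [hnf, size]) (by
        rintro g s ⟨i, hs⟩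
        obtain ⟨e, he⟩ := S.cov i
        obtain ⟨t, ht, hst⟩ : ∃ t : ℤ, t.natAbs = 1 ∧ s = φ e (S.x e i ^ t) := by
          rcases hs with rfl | rfl
          · exact ⟨1, rfl, by rw [zpow_one, hφ e i he]⟩
          · exact ⟨-1, rfl, by rw [zpow_neg_one, map_inv, hφ e i he]⟩
        rw [hst, hnm, act_size (nf g).2, ← (good12 _ (nf g).2).1.sz e]
        have := S.len_mul e i (S.RD e (nf g).1) t he
        omega) u
      exact_mod_cast this
  refine ⟨{
    RD := fun e u => S.RD e (nf u).1
    last := fun i u => S.last i (nf u).1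
    gate := fun e u => val y φ (S.gate e (nf u).1)
    gate_mul := ?_
    RD_mul := ?_
    gate_coset := ?_
    len := ?_
    r_RD := ?_
    two := ?_
    last_ex := ?_
    RD_one := ?_ }⟩
  · intro e u
    rw [(val_gate_add hφ _ (nf u).2).1, hvn]
  · intro e u h
    rw [hnm, act_RD (nf u).2]
  · intro e u h
    rw [hnm, act_gate (nf u).2]
  · intro e u
    rw [hsz u, hsz (val y φ _), hnv _ ((good12 _ (nf u).2).1.valid e), (good12 _ (nf u).2).1.sz e]
  · intro e i u hi
    exact Sys.r_RD (nf u).2 hi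
  · intro i j f u hij hi hj hjf hif
    rcases hu : (nf u).1 with _ | ⟨⟨k, s⟩ | ⟨e', v⟩, g⟩
    · rw [hu] at hi; exact absurd rfl hi
    · rw [hu] at hi hj
      simp only [Sys.last, ne_eq, ite_eq_right_iff, not_forall] at hi hj
      exact absurd (hi.1.trans hj.1.symm) hij
    · rw [hu] at hi hj
      simp only [Sys.last, ne_eq, ite_eq_right_iff, not_forall] at hi hj
      obtain ⟨hi', -⟩ := hi
      obtain ⟨hj', -⟩ := hj
      rw [Sys.last, if_pos hj', RD_dih_inter _ hjf hj']
      rintro rfl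
      exact hif hi'
  · intro i j u hij hi hj
    rcases hu : (nf u).1 with _ | ⟨⟨k, s⟩ | ⟨e', v⟩, g⟩
    · rw [hu] at hi; exact absurd rfl hi
    · rw [hu] at hi hj
      simp only [Sys.last, ne_eq, ite_eq_right_iff, not_forall] at hi hj
      exact absurd (hi.1.trans hj.1.symm) hij
    · rw [hu] at hi hj
      simp only [Sys.last, ne_eq, ite_eq_right_iff, not_forall] at hi hj
      exact ⟨e', hi.1, hj.1⟩
  · intro e
    simp [hnf, Sys.RD]

end Sys

/-! ### Counting permissible divisors in the glued group -/

namespace Sys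
namespace Model
variable {I : Type} {S : Sys I} {G : Type} [Group G] {y : I → G} {φ : ∀ e, S.D e →* G}

/-- `p` is a left divisor of `g`. -/
def Dv (y : I → G) (p g : G) : Prop := wl y p + wl y (p⁻¹ * g) = wl y g

theorem Dv.trans (hy : Subgroup.closure (Set.range y) = ⊤) {p q g : G} (h1 : Dv y p q) (h2 : Dv y q g) : Dv y p g := by
  unfold Dv at *
  have a1 := wl_mul_le hy (p⁻¹ * q) (q⁻¹ * g)
  have a2 := wl_mul_le hy p (p⁻¹ * g)
  rw [show p⁻¹ * q * (q⁻¹ * g) = p⁻¹ * g by group] at a1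
  rw [show p * (p⁻¹ * g) = g by group] at a2
  omega

theorem wl_mul_phi (Md : Model S y φ) (e : S.E) (u : G) (h : S.D e) :
    wl y (u * φ e h) = wl y (Md.gate e u) + S.len e (Md.RD e u * h) := by
  rw [Md.len e, Md.gate_coset, Md.RD_mul]

theorem gate_of_one (Md : Model S y φ) {e : S.E} {u : G} (h : Md.RD e u = 1) : Md.gate e u = u := by
  have := Md.gate_mul e u
  rwa [h, map_one, mul_one] at this

theorem wl_mul_phi_one (Md : Model S y φ) {e : S.E} {u : G} (hu : Md.RD e u = 1) (h : S.D e) :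
    wl y (u * φ e h) = wl y u + S.len e h := by
  rw [Md.wl_mul_phi, hu, one_mul, Md.gate_of_one hu]

theorem wl_phi (Md : Model S y φ) (e : S.E) (h : S.D e) : wl y (φ e h) = S.len e h := by
  have := Md.wl_mul_phi_one (Md.RD_one e) h
  rwa [one_mul, wl_one, zero_add] at this

theorem RD_phi (Md : Model S y φ) (e : S.E) (h : S.D e) : Md.RD e (φ e h) = h := by
  have := Md.RD_mul e 1 h
  rwa [one_mul, Md.RD_one, one_mul] at this

theorem RD_gate (Md : Model S y φ) (e : S.E) (u : G) : Md.RD e (Md.gate e u) = 1 := by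
  have h1 := Md.RD_mul e (Md.gate e u) (Md.RD e u)
  rw [Md.gate_mul] at h1
  simpa using h1

theorem len_inv (Md : Model S y φ) (hy : Subgroup.closure (Set.range y) = ⊤) (e : S.E) (h : S.D e) :
    S.len e h⁻¹ = S.len e h := by
  rw [← Md.wl_phi, ← Md.wl_phi, map_inv, wl_inv hy]

theorem len_le (Md : Model S y φ) (hy : Subgroup.closure (Set.range y) = ⊤) (e : S.E) (h k : S.D e) :
    S.len e (h * k) ≤ S.len e h + S.len e k := by
  rw [← Md.wl_phi, ← Md.wl_phi, ← Md.wl_phi, map_mul]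
  exact wl_mul_le hy _ _

theorem len_zpow {e : S.E} {i : I} (hi : S.mem i e) (t : ℤ) : S.len e (S.x e i ^ t) = t.natAbs := by
  have := S.len_mul e i 1 t hi
  rw [one_mul, S.r_one e i hi, S.len_one] at this
  simpa using this

variable (Md : Model S y φ) (hφ : ∀ e i, S.mem i e → φ e (S.x e i) = y i)

theorem RD_mul_zpow (Md : Model S y φ) (hφ : ∀ e i, S.mem i e → φ e (S.x e i) = y i) {e : S.E} {i : I}
    (hi : S.mem i e) (u : G) (t : ℤ) : Md.RD e (u * y i ^ t) = Md.RD e u * S.x e i ^ t := by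
  rw [← hφ e i hi, ← map_zpow, Md.RD_mul]

theorem last_mul (Md : Model S y φ) (hφ : ∀ e i, S.mem i e → φ e (S.x e i) = y i) (i : I) (u : G) (t : ℤ) :
    Md.last i (u * y i ^ t) = Md.last i u + t := by
  obtain ⟨e, hi⟩ := S.cov i
  rw [← Md.r_RD e i _ hi, ← Md.r_RD e i _ hi, Md.RD_mul_zpow hφ hi, S.r_mul e i _ _ hi]

theorem wl_mul_zpow (Md : Model S y φ) (hφ : ∀ e i, S.mem i e → φ e (S.x e i) = y i) (i : I) (u : G) (t : ℤ) :
    wl y (u * y i ^ t) + (Md.last i u).natAbs = wl y u + (Md.last i u + t).natAbs := by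
  obtain ⟨e, hi⟩ := S.cov i
  have h := S.len_mul e i (Md.RD e u) t hi
  rw [Md.r_RD e i _ hi] at h
  rw [← hφ e i hi, ← map_zpow, Md.wl_mul_phi, Md.len e u]
  omega

/-- Peel off the last letter of a proper multiple. -/
theorem peel (Md : Model S y φ) (hy : Subgroup.closure (Set.range y) = ⊤)
    (hφ : ∀ e i, S.mem i e → φ e (S.x e i) = y i) {p g : G} (h : Dv y p g) (hne : p ≠ g) :
    ∃ (i : I) (ε : ℤ), ε.natAbs = 1 ∧ (Md.last i g + ε).natAbs + 1 = (Md.last i g).natAbs ∧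
      Md.last i g ≠ 0 ∧ Dv y p (g * y i ^ ε) ∧ wl y (g * y i ^ ε) + 1 = wl y g := by
  have h0 : wl y (p⁻¹ * g) ≠ 0 := by
    intro h0
    have := wl_eq_zero hy h0
    exact hne (inv_mul_eq_one.mp this)
  obtain ⟨N, hN⟩ := Nat.exists_eq_succ_of_ne_zero h0
  obtain ⟨s, ⟨i, hs⟩, hs'⟩ := wl_succ hy hN
  obtain ⟨ε, he, hsε⟩ : ∃ ε : ℤ, ε.natAbs = 1 ∧ s = y i ^ ε := by
    rcases hs with rfl | rfl
    · exact ⟨1, rfl, by simp⟩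
    · exact ⟨-1, rfl, by simp⟩
  subst hsε
  unfold Dv at h
  have h1 := Md.wl_mul_zpow hφ i g ε
  have h2 := wl_mul_le hy p (p⁻¹ * g * y i ^ ε)
  rw [show p * (p⁻¹ * g * y i ^ ε) = g * y i ^ ε by group] at h2
  have h3 : wl y (g * y i ^ ε) + 1 = wl y g := by omega
  refine ⟨i, ε, he, by omega, by omega, ?_, h3⟩
  unfold Dv
  rw [← mul_assoc]
  omega

theorem exists_last (Md : Model S y φ) (hy : Subgroup.closure (Set.range y) = ⊤)
    (hφ : ∀ e i, S.mem i e → φ e (S.x e i) = y i) {u : G} (hu : u ≠ 1) : ∃ i, Md.last i u ≠ 0 := by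
  have h : Dv y 1 u := by unfold Dv; rw [wl_one, inv_one, one_mul, zero_add]
  obtain ⟨i, -, -, -, h, -⟩ := Md.peel hy hφ h hu.symm
  exact ⟨i, h⟩

theorem trichotomy (Md : Model S y φ) (hy : Subgroup.closure (Set.range y) = ⊤)
    (hφ : ∀ e i, S.mem i e → φ e (S.x e i) = y i) {e : S.E} {u p : G} (hu : Md.RD e u = 1) (v : S.D e)
    (h : Dv y p (u * φ e v)) :
    (∃ v₁, p = u * φ e v₁) ∨ Dv y p u ∨
    ∃ (j i : I) (s : ℤ), S.mem j e ∧ ¬ S.mem i e ∧ s ≠ 0 ∧ Md.last i (u * y j ^ s) ≠ 0 ∧ Dv y p (u * y j ^ s) ∧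
      s.natAbs + S.len e (S.x e j ^ (-s) * v) = S.len e v := by
  induction hN : S.len e v using Nat.strong_induction_on generalizing v with
  | _ N ih =>
    by_cases hp : p = u * φ e v
    · exact Or.inl ⟨v, hp⟩
    obtain ⟨i, ε, he, hl, hl0, hd, hw⟩ := Md.peel hy hφ h hp
    by_cases hi : S.mem i e
    · rw [← hφ e i hi, ← map_zpow, mul_assoc, ← map_mul] at hd hw
      rw [Md.wl_mul_phi_one hu, Md.wl_mul_phi_one hu] at hw
      rcases ih _ (by omega) (v * S.x e i ^ ε) hd rfl with h | h | ⟨j, k, s, hj, hk, hs, h1, h2, h3⟩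
      · exact Or.inl h
      · exact Or.inr (Or.inl h)
      · refine Or.inr (Or.inr ⟨j, k, s, hj, hk, hs, h1, h2, ?_⟩)
        have a1 := Md.len_le hy e (S.x e j ^ (-s) * (v * S.x e i ^ ε)) (S.x e i ^ (-ε))
        have a2 := Md.len_le hy e (S.x e j ^ s) (S.x e j ^ (-s) * v)
        rw [show S.x e j ^ (-s) * (v * S.x e i ^ ε) * S.x e i ^ (-ε) = S.x e j ^ (-s) * v by group,
          len_zpow hi] at a1
        rw [show S.x e j ^ s * (S.x e j ^ (-s) * v) = v by group, len_zpow hj] at a2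
        omega
    · by_cases hv : v = 1
      · subst hv
        rw [map_one, mul_one] at h
        exact Or.inr (Or.inl h)
      · obtain ⟨j, hj, hr⟩ := S.ex e v hv
        have hR : Md.RD e (u * φ e v) = v := by rw [Md.RD_mul, hu, one_mul]
        have hlj : Md.last j (u * φ e v) = S.r e j v := by rw [← Md.r_RD e j _ hj, hR]
        have h2 := Md.two i j e (u * φ e v) (by rintro rfl; exact hi hj) hl0 (by rw [hlj]; exact hr) hj hi
        rw [hR, hlj] at h2
        have h3 : φ e v = y j ^ (S.r e j v) := by
          conv_lhs => rw [h2]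
          rw [map_zpow, hφ e j hj]
        refine Or.inr (Or.inr ⟨j, i, S.r e j v, hj, hi, hr, ?_, ?_, ?_⟩)
        · rw [← h3]; exact hl0
        · rw [← h3]; exact h
        · have : S.x e j ^ (-(S.r e j v)) * v = 1 := by
            nth_rewrite 2 [h2]
            rw [← zpow_add, neg_add_cancel, zpow_zero]
          rw [this, S.len_one, ← hN]
          conv_rhs => rw [h2]
          rw [len_zpow hj]; omega

/-- The third alternative of the trichotomy. -/
def Cc (Md : Model S y φ) (e : S.E) (u : G) (j i : I) : Prop :=
  S.mem j e ∧ ¬ S.mem i e ∧ ∃ s : ℤ, s ≠ 0 ∧ Md.last i (u * y j ^ s) ≠ 0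

theorem Cc_spec (Md : Model S y φ) (hφ : ∀ e i, S.mem i e → φ e (S.x e i) = y i) {e : S.E} {u : G}
    (hu : Md.RD e u = 1) {j i : I} (h : Md.Cc e u j i) :
    ∃ (f : S.E) (s : ℤ), S.mem i f ∧ S.mem j f ∧ i ≠ j ∧ s ≠ 0 ∧ S.T f (Md.RD f u * S.x f j ^ s) ∧ Md.RD f u ≠ 1 ∧
      Md.last i u ≠ 0 ∧ Md.last j u = 0 := by
  obtain ⟨hj, hi, s, hs, hl⟩ := h
  have hij : i ≠ j := by rintro rfl; exact hi hj
  have hlj : Md.last j u = 0 := by rw [← Md.r_RD e j _ hj, hu, S.r_one e j hj]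
  have hlj' : Md.last j (u * y j ^ s) ≠ 0 := by rw [Md.last_mul hφ, hlj, zero_add]; exact hs
  obtain ⟨f, hif, hjf⟩ := Md.last_ex i j _ hij hl hlj'
  have hT : S.T f (Md.RD f u * S.x f j ^ s) := by
    rw [← Md.RD_mul_zpow hφ hjf]
    exact T_of hif hjf hij (by rw [Md.r_RD f i _ hif]; exact hl) (by rw [Md.r_RD f j _ hjf]; exact hlj')
  have h1 : Md.RD f u ≠ 1 := by
    intro h1
    rw [h1, one_mul] at hT
    exact nT_zpow hjf _ hT
  refine ⟨f, s, hif, hjf, hij, hs, hT, h1, ?_, hlj⟩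
  obtain ⟨k, hk, hr⟩ := S.ex f _ h1
  rw [Md.r_RD f k _ hk] at hr
  obtain ⟨a, b, hab, ha, hb, hall⟩ := S.two f
  rcases hall k hk with rfl | rfl <;> rcases hall i hif with rfl | rfl <;> rcases hall j hjf with rfl | rfl <;>
    first | exact hr | exact absurd hlj hr | exact absurd rfl hij

/-- The abstract form of the (3,3,m)-hypothesis. -/
def H33 (S : Sys I) : Prop := ∀ (e f f' : S.E) (i j j' : I) (v : S.D e) (a q s a' q' s' : ℤ),
  S.mem j e → S.mem j' e → S.mem i f → S.mem j f → S.mem i f' → S.mem j' f' → i ≠ j → i ≠ j' → j ≠ j' →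
  a ≠ 0 → q ≠ 0 → s ≠ 0 → a' ≠ 0 → q' ≠ 0 → s' ≠ 0 →
  S.T f (S.x f j ^ a * S.x f i ^ q * S.x f j ^ s) → S.T f' (S.x f' j' ^ a' * S.x f' i ^ q' * S.x f' j' ^ s') →
  S.T e v → False

theorem not_mem_third {f : S.E} {a b c : I} (ha : S.mem a f) (hb : S.mem b f) (hab : a ≠ b) (hca : c ≠ a) (hcb : c ≠ b) :
    ¬ S.mem c f := by
  intro hc
  obtain ⟨i, j, hij, hi, hj, hall⟩ := S.two f
  rcases hall a ha with rfl | rfl <;> rcases hall b hb with rfl | rfl <;> rcases hall c hc with rfl | rfl <;>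
    simp_all

theorem Cc_unique (Md : Model S y φ) (hφ : ∀ e i, S.mem i e → φ e (S.x e i) = y i) (h33 : H33 S) {e : S.E} {u : G}
    (hu : Md.RD e u = 1) {j i j' i' : I} (h : Md.Cc e u j i) (h' : Md.Cc e u j' i') : j = j' ∧ i = i' := by
  obtain ⟨f, s, hif, hjf, hij, hs, hT, h1, hli, hlj⟩ := Md.Cc_spec hφ hu h
  obtain ⟨f', s', hif', hjf', hij', hs', hT', h1', hli', hlj'⟩ := Md.Cc_spec hφ hu h'
  have hii : i = i' := by
    by_contra hne
    have hi'f : ¬ S.mem i' f := not_mem_third hif hjf hij (Ne.symm hne) (by rintro rfl; exact h'.2.1 h.1)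
    have := Md.two i' i f u (Ne.symm hne) hli' hli hif hi'f
    rw [this] at hT
    exact nT_pow hjf hif _ _ hT
  subst hii
  refine ⟨?_, rfl⟩
  by_contra hjj
  set q := Md.last i u with hq
  set w := u * y i ^ (-q) with hw
  have hwi : Md.last i w = 0 := by rw [hw, Md.last_mul hφ]; omega
  have key : ∀ (f : S.E) (j : I) (s : ℤ), S.mem i f → S.mem j f → i ≠ j → S.T f (Md.RD f u * S.x f j ^ s) →
      Md.last j w ≠ 0 := by
    intro f j s hif hjf hij hT h0
    have hR : Md.RD f w = 1 := by
      by_contra h1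
      obtain ⟨k, hk, hr⟩ := S.ex f _ h1
      rw [Md.r_RD f k _ hk] at hr
      by_cases hki : k = i
      · subst hki; exact hr hwi
      by_cases hkj : k = j
      · subst hkj; exact hr h0
      exact not_mem_third hif hjf hij hki hkj hk
    rw [hw, Md.RD_mul_zpow hφ hif, zpow_neg, mul_inv_eq_one] at hR
    rw [hR] at hT
    exact nT_pow hjf hif _ _ hT
  have hl := key f j s hif hjf hij hT
  have hl' := key f' j' s' hif' hjf' hij' hT'
  have key2 : ∀ (f : S.E) (j j' : I) (s : ℤ), S.mem i f → S.mem j f → i ≠ j → i ≠ j' → j ≠ j' →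
      S.T f (Md.RD f u * S.x f j ^ s) → Md.last j w ≠ 0 → Md.last j' w ≠ 0 →
      S.T f (S.x f j ^ (Md.last j w) * S.x f i ^ q * S.x f j ^ s) := by
    intro f j j' s hif hjf hij hij' hjj hT hl hl'
    have := Md.two j' j f w hjj.symm hl' hl hjf (not_mem_third hif hjf hij hij'.symm hjj.symm)
    rw [hw, Md.RD_mul_zpow hφ hif, zpow_neg, mul_inv_eq_iff_eq_mul] at this
    rw [this] at hT
    exact hT
  exact h33 e f f' i j j' (Md.RD e w) _ q s _ q s' h.1 h'.1 hif hjf hif' hjf' hij hij' hjj hl hli hs hl' hli hs'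
    (key2 f j j' s hif hjf hij hij' hjj hT hl hl') (key2 f' j' j s' hif' hjf' hij' hij (Ne.symm hjj) hT' hl' hl)
    (T_of h.1 h'.1 hjj (by rw [Md.r_RD e j _ h.1]; exact hl) (by rw [Md.r_RD e j' _ h'.1]; exact hl'))

theorem count_aux (Md : Model S y φ) (hy : Subgroup.closure (Set.range y) = ⊤)
    (hφ : ∀ e i, S.mem i e → φ e (S.x e i) = y i) (h33 : H33 S)
    (Q : ∀ e, S.D e → S.D e → Prop) (A : ℕ)
    (hQ : ∀ e (V : S.D e) (K : ℕ), ∃ F : Finset (S.D e), F.card ≤ A * (K + 1) ^ 2 ∧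
      ∀ v, S.len e v = K → Q e v (v⁻¹ * V) → v ∈ F) (k : ℕ) (g₀ : G) (N : ℕ) :
    ∀ (u : G) (e : S.E) (v : S.D e), wl y u = N → Md.RD e u = 1 → Dv y (u * φ e v) g₀ →
    ∃ F : Finset G, F.card ≤ A * (k + 1) ^ 2 * (min (wl y u) k + 1) ∧
      ∀ p, wl y p = k → Dv y p (u * φ e v) → (∀ e, Q e (Md.RD e p) (Md.RD e (g₀⁻¹ * p))⁻¹) → p ∈ F := by
  classical
  induction N using Nat.strong_induction_on with
  | _ N ih =>
    intro u e v hN hu hdv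
    -- the part inside the coset
    obtain ⟨F₀, hF₀, hF₀0, hF₀'⟩ : ∃ F : Finset G, F.card ≤ A * (k + 1) ^ 2 ∧ (k < wl y u → F.card = 0) ∧
        ∀ v₁, wl y (u * φ e v₁) = k →
          (∀ e', Q e' (Md.RD e' (u * φ e v₁)) (Md.RD e' (g₀⁻¹ * (u * φ e v₁)))⁻¹) → u * φ e v₁ ∈ F := by
      by_cases hk : k < wl y u
      · refine ⟨∅, by simp, by simp, ?_⟩
        intro v₁ h1
        rw [Md.wl_mul_phi_one hu] at h1
        omega
      · obtain ⟨F, hc, hF⟩ := hQ e (Md.RD e (g₀⁻¹ * u))⁻¹ (k - wl y u)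
        refine ⟨F.image (fun v => u * φ e v), ?_, by intro h; omega, ?_⟩
        · refine Finset.card_image_le.trans (hc.trans ?_)
          gcongr
          omega
        · intro v₁ h1 h2
          rw [Md.wl_mul_phi_one hu] at h1
          refine Finset.mem_image.mpr ⟨v₁, hF v₁ (by omega) ?_, rfl⟩
          have := h2 e
          rwa [Md.RD_mul, hu, one_mul, ← mul_assoc, Md.RD_mul, mul_inv_rev] at this
    have comb : ∀ (u' : G) (F' : Finset G), wl y u' < wl y u →
        F'.card ≤ A * (k + 1) ^ 2 * (min (wl y u') k + 1) →
        (F₀ ∪ F').card ≤ A * (k + 1) ^ 2 * (min (wl y u) k + 1) := by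
      intro u' F' hlt hF'
      have h1 := Finset.card_union_le F₀ F'
      by_cases hk : k < wl y u
      · have h2 := hF₀0 hk
        have h3 : A * (k + 1) ^ 2 * (min (wl y u') k + 1) ≤ A * (k + 1) ^ 2 * (min (wl y u) k + 1) := by
          gcongr
        omega
      · have h3 : A * (k + 1) ^ 2 * (min (wl y u') k + 1 + 1) ≤ A * (k + 1) ^ 2 * (min (wl y u) k + 1) := by
          apply Nat.mul_le_mul_left
          omega
        rw [Nat.mul_add, Nat.mul_one] at h3
        omega
    have gate_lt : ∀ f, Md.RD f u ≠ 1 → wl y (Md.gate f u) < wl y u := by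
      intro f hf
      have h1 := Md.len f u
      have h2 : S.len f (Md.RD f u) ≠ 0 := by
        intro h0
        rw [← Md.wl_phi] at h0
        have h3 := Md.RD_phi f (Md.RD f u)
        rw [wl_eq_zero hy h0, Md.RD_one] at h3
        exact hf h3.symm
      omega
    have hu_uv : Dv y u (u * φ e v) := by
      unfold Dv
      rw [inv_mul_cancel_left, Md.wl_mul_phi_one hu, Md.wl_phi]
    by_cases hC : ∃ j i, Md.Cc e u j i
    · obtain ⟨j, i, hC⟩ := hC
      obtain ⟨f, s₁, hif, hjf, hij, hs₁, hT, h1, hli, hlj⟩ := Md.Cc_spec hφ hu hC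
      have hj := hC.1
      set s₀ := -(S.r e j v⁻¹) with hs₀
      have hlen : ∀ s, S.len e (S.x e j ^ (-s) * v) + s₀.natAbs = S.len e v + (s₀ - s).natAbs := by
        intro s
        have := S.len_mul e j v⁻¹ s hj
        rw [← Md.len_inv hy e (v⁻¹ * _), mul_inv_rev, inv_inv, ← zpow_neg, Md.len_inv hy] at this
        omega
      have hwu : ∀ s : ℤ, wl y (u * y j ^ s) = wl y u + s.natAbs := by
        intro s
        rw [← hφ e j hj, ← map_zpow, Md.wl_mul_phi_one hu, len_zpow hj]
      have hwy : ∀ s : ℤ, wl y (y j ^ s) = s.natAbs := by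
        intro s
        rw [← hφ e j hj, ← map_zpow, Md.wl_phi, len_zpow hj]
      have heq : Md.gate f u * φ f (Md.RD f u * S.x f j ^ s₀) = u * y j ^ s₀ := by
        rw [map_mul, ← mul_assoc, Md.gate_mul, map_zpow, hφ f j hjf]
      have hd1 : Dv y (u * y j ^ s₀) (u * φ e v) := by
        unfold Dv
        have h3 : (u * y j ^ s₀)⁻¹ * (u * φ e v) = φ e (S.x e j ^ (-s₀) * v) := by
          rw [map_mul, map_zpow, hφ e j hj]; group
        rw [h3, hwu, Md.wl_phi, Md.wl_mul_phi_one hu]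
        have := hlen s₀
        simp only [sub_self, Int.natAbs_zero] at this
        omega
      obtain ⟨F', hF', hF''⟩ := ih _ (hN ▸ gate_lt f h1) (Md.gate f u) f (Md.RD f u * S.x f j ^ s₀) rfl
        (Md.RD_gate f u) (by rw [heq]; exact hd1.trans hy hdv)
      refine ⟨F₀ ∪ F', comb _ F' (gate_lt f h1) hF', ?_⟩
      intro p hp hpd hperm
      rw [Finset.mem_union]
      rcases Md.trichotomy hy hφ hu v hpd with ⟨v₁, rfl⟩ | h | ⟨j', i', s, hj', hi', hs, h2, h3, h4⟩
      · exact Or.inl (hF₀' v₁ hp hperm)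
      · refine Or.inr (hF'' p hp ?_ hperm)
        rw [heq]
        refine h.trans hy ?_
        unfold Dv
        rw [inv_mul_cancel_left, hwu, hwy]
      · obtain ⟨rfl, rfl⟩ := Md.Cc_unique hφ h33 hu hC ⟨hj', hi', s, hs, h2⟩
        refine Or.inr (hF'' p hp ?_ hperm)
        rw [heq]
        refine h3.trans hy ?_
        unfold Dv
        have h5 : (u * y j ^ s)⁻¹ * (u * y j ^ s₀) = y j ^ (s₀ - s) := by group
        rw [h5, hwu, hwu, hwy]
        have := hlen s
        omega
    · have key : ∀ p, Dv y p (u * φ e v) → (∃ v₁, p = u * φ e v₁) ∨ Dv y p u := by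
        intro p hpd
        rcases Md.trichotomy hy hφ hu v hpd with h | h | ⟨j', i', s, hj', hi', hs, h2, h3, h4⟩
        · exact Or.inl h
        · exact Or.inr h
        · exact absurd ⟨j', i', hj', hi', s, hs, h2⟩ hC
      by_cases hu1 : u = 1
      · refine ⟨F₀, hF₀.trans (Nat.le_mul_of_pos_right _ (Nat.succ_pos _)), ?_⟩
        intro p hp hpd hperm
        rcases key p hpd with ⟨v₁, rfl⟩ | h
        · exact hF₀' v₁ hp hperm
        · have hp1 : p = u * φ e 1 := by
            rw [hu1] at h ⊢
            unfold Dv at h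
            rw [wl_one] at h
            rw [wl_eq_zero hy (g := p) (by omega)]; simp
          subst hp1
          exact hF₀' 1 hp hperm
      · obtain ⟨i, hi⟩ := Md.exists_last hy hφ hu1
        obtain ⟨f, hif⟩ := S.cov i
        have h1 : Md.RD f u ≠ 1 := by
          intro h1
          rw [← Md.r_RD f i _ hif, h1, S.r_one f i hif] at hi
          exact hi rfl
        obtain ⟨F', hF', hF''⟩ := ih _ (hN ▸ gate_lt f h1) (Md.gate f u) f (Md.RD f u) rfl
          (Md.RD_gate f u) (by rw [Md.gate_mul]; exact hu_uv.trans hy hdv)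
        refine ⟨F₀ ∪ F', comb _ F' (gate_lt f h1) hF', ?_⟩
        intro p hp hpd hperm
        rw [Finset.mem_union]
        rcases key p hpd with ⟨v₁, rfl⟩ | h
        · exact Or.inl (hF₀' v₁ hp hperm)
        · exact Or.inr (hF'' p hp (by rw [Md.gate_mul]; exact h) hperm)

theorem count (Md : Model S y φ) (hy : Subgroup.closure (Set.range y) = ⊤)
    (hφ : ∀ e i, S.mem i e → φ e (S.x e i) = y i) (h33 : H33 S)
    (Q : ∀ e, S.D e → S.D e → Prop) (A : ℕ)
    (hQ : ∀ e (V : S.D e) (K : ℕ), ∃ F : Finset (S.D e), F.card ≤ A * (K + 1) ^ 2 ∧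
      ∀ v, S.len e v = K → Q e v (v⁻¹ * V) → v ∈ F) (e₀ : S.E) (k : ℕ) (g₀ : G) :
    ∃ F : Finset G, F.card ≤ A * (k + 1) ^ 3 ∧
      ∀ p, wl y p = k → Dv y p g₀ → (∀ e, Q e (Md.RD e p) (Md.RD e (g₀⁻¹ * p))⁻¹) → p ∈ F := by
  obtain ⟨F, hc, hF⟩ := Md.count_aux hy hφ h33 Q A hQ k g₀ _ (Md.gate e₀ g₀) e₀ (Md.RD e₀ g₀) rfl
    (Md.RD_gate _ _) (by rw [Md.gate_mul]; unfold Dv; rw [inv_mul_cancel, wl_one, add_zero])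
  rw [Md.gate_mul] at hF
  refine ⟨F, hc.trans ?_, hF⟩
  rw [pow_succ _ 2, ← mul_assoc]
  apply Nat.mul_le_mul_left
  omega

end Model
end Sys

/-! ### The Artin group as a glued group -/

/-- unordered pairs of indices -/
abbrev Edge (n : ℕ) : Type := {e : Fin n × Fin n // e.1 < e.2}

/-- the two-generator group attached to a pair -/
noncomputable def dih {n : ℕ} {M : Fin n → Fin n → ℕ∞} (hlarge : ∀ i j, i ≠ j → 3 ≤ M i j) (e : Edge n) :
    Dih (M e.1.1 e.1.2) :=
  (Dih_exists (hlarge e.1.1 e.1.2 e.2.ne)).some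

/-- position of an index in a pair -/
def bit {n : ℕ} (e : Edge n) (i : Fin n) : Bool := decide (i = e.1.1)

theorem bit_fst {n : ℕ} (e : Edge n) : bit e e.1.1 = true := by simp [bit]
theorem bit_snd {n : ℕ} (e : Edge n) : bit e e.1.2 = false := by
  have := e.2.ne
  simp [bit, this.symm]

theorem bit_ne {n : ℕ} {e : Edge n} {i j : Fin n} (hi : i = e.1.1 ∨ i = e.1.2) (hj : j = e.1.1 ∨ j = e.1.2)
    (hij : i ≠ j) : bit e j = !bit e i := by
  rcases hi with rfl | rfl <;> rcases hj with rfl | rfl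
  · exact absurd rfl hij
  · rw [bit_fst, bit_snd]; rfl
  · rw [bit_fst, bit_snd]; rfl
  · exact absurd rfl hij

noncomputable abbrev artinSys {n : ℕ} (hn : 2 ≤ n) {M : Fin n → Fin n → ℕ∞} (hlarge : ∀ i j, i ≠ j → 3 ≤ M i j) :
    Sys (Fin n) where
  E := Edge n
  mem i e := i = e.1.1 ∨ i = e.1.2
  two e := ⟨e.1.1, e.1.2, e.2.ne, Or.inl rfl, Or.inr rfl, fun _ h => h⟩
  uniq := by
    rintro i j ⟨⟨a, b⟩, h⟩ ⟨⟨a', b'⟩, h'⟩ hij h1 h2 h3 h4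
    apply Subtype.ext
    have k1 : a.val < b.val := h
    have k2 : a'.val < b'.val := h'
    simp only [Fin.ext_iff, Prod.mk.injEq, ne_eq] at *
    omega
  cov := by
    intro i
    by_cases h : (i : ℕ) = 0
    · exact ⟨⟨(i, ⟨1, hn⟩), by rw [Fin.lt_def]; simp [h]⟩, Or.inl rfl⟩
    · exact ⟨⟨(⟨0, by omega⟩, i), by rw [Fin.lt_def]; simp; omega⟩, Or.inr rfl⟩
  D e := (dih hlarge e).D
  grp e := (dih hlarge e).grp
  x e i := (dih hlarge e).x (bit e i)
  len e := wl (dih hlarge e).x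
  r e i := (dih hlarge e).r (bit e i)
  len_one e := wl_one
  len_mul e i v t _ := (dih hlarge e).len_mul _ v t
  r_mul e i v t _ := (dih hlarge e).r_mul _ v t
  r_one e i _ := (dih hlarge e).r_one (hlarge _ _ e.2.ne) _
  ex := by
    intro e v hv
    obtain ⟨b, hb⟩ := (dih hlarge e).exists_r_ne v hv
    cases b
    · exact ⟨e.1.2, Or.inr rfl, by rw [bit_snd]; exact hb⟩
    · exact ⟨e.1.1, Or.inl rfl, by rw [bit_fst]; exact hb⟩
  r_two := by
    intro e i j s t hi hj hij ht
    rw [bit_ne hi hj hij]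
    exact (dih hlarge e).r_two (hlarge _ _ e.2.ne) _ s t ht

theorem gen_closure (n : ℕ) (M : Fin n → Fin n → ℕ∞) : Subgroup.closure (Set.range (gen n M)) = ⊤ :=
  PresentedGroup.closure_range_of _

theorem gen_rel {n : ℕ} {M : Fin n → Fin n → ℕ∞} {i j : Fin n} (hij : i ≠ j) {m : ℕ} (hm : M i j = m) :
    altProd m (gen n M i) (gen n M j) = altProd m (gen n M j) (gen n M i) := by
  have h : PresentedGroup.mk (artinRels n M) (altProd m (FreeGroup.of i) (FreeGroup.of j) *
      (altProd m (FreeGroup.of j) (FreeGroup.of i))⁻¹) = 1 :=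
    PresentedGroup.one_of_mem ⟨i, j, hij, m, hm, rfl⟩
  rw [map_mul, map_inv, mul_inv_eq_one, map_altProd, map_altProd] at h
  exact h

theorem exists_phi {n : ℕ} {M : Fin n → Fin n → ℕ∞} (hlarge : ∀ i j, i ≠ j → 3 ≤ M i j) (e : Edge n) :
    ∃ φ : (dih hlarge e).D →* ArtinGroup n M,
      φ ((dih hlarge e).x true) = gen n M e.1.1 ∧ φ ((dih hlarge e).x false) = gen n M e.1.2 := by
  obtain ⟨φ, h⟩ := (dih hlarge e).lift (ArtinGroup n M) (fun b => if b then gen n M e.1.1 else gen n M e.1.2)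
    (by
      intro m' hm'
      simp only [if_true, Bool.false_eq_true, if_false]
      exact gen_rel e.2.ne hm')
  exact ⟨φ, by rw [h]; rfl, by rw [h]; rfl⟩

noncomputable def phi {n : ℕ} {M : Fin n → Fin n → ℕ∞} (hlarge : ∀ i j, i ≠ j → 3 ≤ M i j) (e : Edge n) :
    (dih hlarge e).D →* ArtinGroup n M := (exists_phi hlarge e).choose

theorem phi_true {n : ℕ} {M : Fin n → Fin n → ℕ∞} (hlarge : ∀ i j, i ≠ j → 3 ≤ M i j) (e : Edge n) :
    phi hlarge e ((dih hlarge e).x true) = gen n M e.1.1 := (exists_phi hlarge e).choose_spec.1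
theorem phi_false {n : ℕ} {M : Fin n → Fin n → ℕ∞} (hlarge : ∀ i j, i ≠ j → 3 ≤ M i j) (e : Edge n) :
    phi hlarge e ((dih hlarge e).x false) = gen n M e.1.2 := (exists_phi hlarge e).choose_spec.2

theorem phi_mem {n : ℕ} (hn : 2 ≤ n) {M : Fin n → Fin n → ℕ∞} (hlarge : ∀ i j, i ≠ j → 3 ≤ M i j)
    (e : (artinSys hn hlarge).E) (i : Fin n) (h : (artinSys hn hlarge).mem i e) :
    phi hlarge e ((artinSys hn hlarge).x e i) = gen n M i := by
  show phi hlarge e ((dih hlarge e).x (bit e i)) = gen n M i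
  rcases h with rfl | rfl
  · rw [bit_fst]; exact phi_true hlarge e
  · rw [bit_snd]; exact phi_false hlarge e

theorem exists_artin_model {n : ℕ} (hn : 2 ≤ n) {M : Fin n → Fin n → ℕ∞} (hsymm : ∀ i j, M i j = M j i)
    (hlarge : ∀ i j, i ≠ j → 3 ≤ M i j) :
    Nonempty (Sys.Model (artinSys hn hlarge) (gen n M) (phi hlarge)) := by
  set S := artinSys hn hlarge with hS
  have hrel0 : ∀ (e : Edge n) (m : ℕ), M e.1.1 e.1.2 = m →
      altProd m (S.sigma e.1.1) (S.sigma e.1.2) = altProd m (S.sigma e.1.2) (S.sigma e.1.1) := by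
    intro e m hm
    have h := congrArg (Sys.actHom (S := S) e) ((dih hlarge e).rel m hm)
    have e1 : Sys.actHom (S := S) e ((dih hlarge e).x true) = S.sigma e.1.1 := by
      rw [← Sys.actHom_x (S := S) (e := e) (i := e.1.1) (Or.inl rfl)]
      show _ = Sys.actHom (S := S) e ((dih hlarge e).x (bit e e.1.1))
      rw [bit_fst]
    have e2 : Sys.actHom (S := S) e ((dih hlarge e).x false) = S.sigma e.1.2 := by
      rw [← Sys.actHom_x (S := S) (e := e) (i := e.1.2) (Or.inr rfl)]
      show _ = Sys.actHom (S := S) e ((dih hlarge e).x (bit e e.1.2))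
      rw [bit_snd]
    have e3 := map_altProd (Sys.actHom (S := S) e : (dih hlarge e).D →* _) m ((dih hlarge e).x true) ((dih hlarge e).x false)
    have e4 := map_altProd (Sys.actHom (S := S) e : (dih hlarge e).D →* _) m ((dih hlarge e).x false) ((dih hlarge e).x true)
    rw [e1, e2] at e3 e4
    exact e3.symm.trans (h.trans e4)
  have hrel : ∀ r ∈ artinRels n M, FreeGroup.lift S.sigma r = 1 := by
    rintro r ⟨i, j, hij, m, hm, rfl⟩
    rw [map_mul, map_inv, mul_inv_eq_one, map_altProd, map_altProd, FreeGroup.lift_apply_of, FreeGroup.lift_apply_of]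
    rcases lt_or_gt_of_ne hij with h | h
    · exact hrel0 ⟨(i, j), h⟩ m hm
    · exact (hrel0 ⟨(j, i), h⟩ m (by rw [hsymm]; exact hm)).symm
  exact Sys.exists_model (gen_closure n M) (phi_mem hn hlarge) (PresentedGroup.toGroup hrel)
    (fun i => PresentedGroup.toGroup.of hrel)

theorem artin_H33 {n : ℕ} (hn : 2 ≤ n) {M : Fin n → Fin n → ℕ∞} (hsymm : ∀ i j, M i j = M j i)
    (hlarge : ∀ i j, i ≠ j → 3 ≤ M i j)
    (h33m : ¬ ∃ i j k : Fin n, i ≠ j ∧ i ≠ k ∧ j ≠ k ∧ M i j = 3 ∧ M i k = 3 ∧ M j k < ⊤) :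
    Sys.Model.H33 (artinSys hn hlarge) := by
  have hM : ∀ (e : Edge n) (i j : Fin n), (i = e.1.1 ∨ i = e.1.2) → (j = e.1.1 ∨ j = e.1.2) → i ≠ j →
      M i j = M e.1.1 e.1.2 := by
    intro e i j hi hj hij
    rcases hi with rfl | rfl <;> rcases hj with rfl | rfl
    · exact absurd rfl hij
    · rfl
    · exact hsymm _ _
    · exact absurd rfl hij
  have h3 : ∀ (f : Edge n) (i j : Fin n) (a q s : ℤ), (i = f.1.1 ∨ i = f.1.2) → (j = f.1.1 ∨ j = f.1.2) → i ≠ j →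
      a ≠ 0 → q ≠ 0 → s ≠ 0 →
      (dih hlarge f).r (bit f i) ((dih hlarge f).x (bit f j) ^ a * (dih hlarge f).x (bit f i) ^ q *
        (dih hlarge f).x (bit f j) ^ s) ≠ 0 → M i j = 3 := by
    intro f i j a q s hi hj hij ha hq hs h
    by_contra hne
    have h4 : 4 ≤ M f.1.1 f.1.2 := by
      rw [← hM f i j hi hj hij]
      have : 3 < M i j := lt_of_le_of_ne (hlarge i j hij) (Ne.symm hne)
      exact Order.add_one_le_of_lt this
    rw [bit_ne hi hj hij] at h
    exact h ((dih hlarge f).r_three h4 _ a q s ha hq hs)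
  intro e f f' i j j' v a q s a' q' s' hj hj' hif hjf hif' hjf' hij hij' hjj ha hq hs ha' hq' hs' hT hT' hTe
  refine h33m ⟨i, j, j', hij, hij', hjj, h3 f i j a q s hif hjf hij ha hq hs (hT i hif),
    h3 f' i j' a' q' s' hif' hjf' hij' ha' hq' hs' (hT' i hif'), ?_⟩
  rw [hM e j j' hj hj' hjj]
  refine (dih hlarge e).top v ?_
  intro b
  cases b
  · have := hTe e.1.2 (Or.inr rfl)
    have h0 : (dih hlarge e).r (bit e e.1.2) v ≠ 0 := this
    rwa [bit_snd] at h0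
  · have := hTe e.1.1 (Or.inl rfl)
    have h0 : (dih hlarge e).r (bit e e.1.1) v ≠ 0 := this
    rwa [bit_fst] at h0

theorem artin_cnt {n : ℕ} {M : Fin n → Fin n → ℕ∞} (hlarge : ∀ i j, i ≠ j → 3 ≤ M i j) :
    ∃ A : ℕ, ∀ (e : Edge n) (V : (dih hlarge e).D) (K : ℕ), ∃ F : Finset (dih hlarge e).D,
      F.card ≤ A * (K + 1) ^ 2 ∧
      ∀ v, wl (dih hlarge e).x v = K → PermD (dih hlarge e).x (M e.1.1 e.1.2) v (v⁻¹ * V) → v ∈ F := by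
  choose A hA using fun e : Edge n => (dih hlarge e).cnt
  refine ⟨∑ e, A e, fun e V K => ?_⟩
  obtain ⟨F, h1, h2⟩ := hA e V K
  refine ⟨F, h1.trans ?_, h2⟩
  apply Nat.mul_le_mul_right
  exact Finset.single_le_sum (f := A) (fun _ _ => Nat.zero_le _) (Finset.mem_univ e)

/-! ### Translation of the frozen definitions, and the final count -/

theorem genSet_eq (n : ℕ) (M : Fin n → Fin n → ℕ∞) : genSet n M = lset (gen n M) := rfl

theorem lA_eq (n : ℕ) (M : Fin n → Fin n → ℕ∞) : ℓA n M = wl (gen n M) := rfl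

section
variable {n : ℕ} {hn : 2 ≤ n} {M : Fin n → Fin n → ℕ∞} {hlarge : ∀ i j, i ≠ j → 3 ≤ M i j}

theorem wl_phi' (Md : Sys.Model (artinSys hn hlarge) (gen n M) (phi hlarge)) (e : Edge n) (h : (dih hlarge e).D) :
    wl (gen n M) (phi hlarge e h) = wl (dih hlarge e).x h := Md.wl_phi e h

theorem phi_inj (Md : Sys.Model (artinSys hn hlarge) (gen n M) (phi hlarge)) (e : Edge n) :
    Function.Injective (phi hlarge e) := by
  intro a b hab
  have h1 := Md.RD_phi e a
  have h2 := Md.RD_phi e b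
  rw [← h1, ← h2]
  exact congrArg (Md.RD e) hab

theorem phi_mem_Gij (e : Edge n) (h : (dih hlarge e).D) : phi hlarge e h ∈ Gij n M e.1.1 e.1.2 := by
  have hh : h ∈ Subgroup.closure (Set.range (dih hlarge e).x) := by rw [(dih hlarge e).gen]; trivial
  induction hh using Subgroup.closure_induction with
  | mem z hz =>
    obtain ⟨b, rfl⟩ := hz
    cases b
    · rw [phi_false]; exact Subgroup.subset_closure (by simp)
    · rw [phi_true]; exact Subgroup.subset_closure (by simp)
  | one => rw [map_one]; exact Subgroup.one_mem _
  | mul a b _ _ ha hb => rw [map_mul]; exact Subgroup.mul_mem _ ha hb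
  | inv a _ ha => rw [map_inv]; exact Subgroup.inv_mem _ ha

theorem exists_of_mem_Gij (e : Edge n) {g : ArtinGroup n M} (hg : g ∈ Gij n M e.1.1 e.1.2) :
    ∃ h, phi hlarge e h = g := by
  have : Gij n M e.1.1 e.1.2 ≤ (phi hlarge e).range := by
    rw [Gij, Subgroup.closure_le]
    rintro z (rfl | hz)
    · exact ⟨_, phi_true hlarge e⟩
    · rw [Set.mem_singleton_iff] at hz
      subst hz
      exact ⟨_, phi_false hlarge e⟩
  exact this hg

theorem RD_eq (Md : Sys.Model (artinSys hn hlarge) (gen n M) (phi hlarge)) (e : Edge n) {g h : ArtinGroup n M}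
    (hh : IsMaxRD n M e.1.1 e.1.2 g h) : h = phi hlarge e (Md.RD e g) := by
  have hy := gen_closure n M
  obtain ⟨h1, h2, h3⟩ := hh
  obtain ⟨w, rfl⟩ := exists_of_mem_Gij (hlarge := hlarge) e h1
  have a1 := Md.wl_mul_phi e g w⁻¹
  have a2 := Md.len e g
  have a3 := Md.gate_mul e g
  have h4 := h3 _ (phi_mem_Gij e (Md.RD e g)) (by
    unfold IsRightDiv
    rw [lA_eq, Md.wl_phi]
    have : g * (phi hlarge e (Md.RD e g))⁻¹ = Md.gate e g := by
      rw [mul_inv_eq_iff_eq_mul]; exact a3.symm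
    rw [this]; exact a2.symm)
  unfold IsRightDiv at h2
  rw [lA_eq] at h2 h4
  rw [wl_phi' Md] at h2 h4
  rw [wl_phi' Md] at h4
  rw [map_inv] at a1
  have a1' : wl (gen n M) (g * (phi hlarge e w)⁻¹) = wl (gen n M) (Md.gate e g) +
    wl (dih hlarge e).x (Md.RD e g * w⁻¹) := a1
  have a2' : wl (gen n M) g = wl (gen n M) (Md.gate e g) + wl (dih hlarge e).x (Md.RD e g) := a2
  have h5 : wl (dih hlarge e).x (Md.RD e g * w⁻¹) = 0 := by omega
  have h6 := wl_eq_zero (dih hlarge e).gen h5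
  rw [mul_inv_eq_one] at h6
  rw [h6]

theorem LD_eq (Md : Sys.Model (artinSys hn hlarge) (gen n M) (phi hlarge)) (e : Edge n) {g h : ArtinGroup n M}
    (hh : IsMaxLD n M e.1.1 e.1.2 g h) : h = phi hlarge e (Md.RD e g⁻¹)⁻¹ := by
  have hy := gen_closure n M
  have key : ∀ a b : ArtinGroup n M, IsLeftDiv (ℓA n M) a b ↔ IsRightDiv (ℓA n M) a⁻¹ b⁻¹ := by
    intro a b
    unfold IsLeftDiv IsRightDiv
    rw [lA_eq, wl_inv hy a, wl_inv hy b, inv_inv, ← wl_inv hy (b⁻¹ * a), mul_inv_rev, inv_inv, add_comm]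
  have : IsMaxRD n M e.1.1 e.1.2 g⁻¹ h⁻¹ := by
    obtain ⟨h1, h2, h3⟩ := hh
    refine ⟨Subgroup.inv_mem _ h1, (key _ _).mp h2, ?_⟩
    intro h' h4 h5
    have := h3 h'⁻¹ (Subgroup.inv_mem _ h4) ((key _ _).mpr (by rwa [inv_inv]))
    rw [lA_eq] at this ⊢
    rwa [wl_inv hy] at this ⊢
  have := RD_eq Md e this
  rw [map_inv, ← this, inv_inv]

theorem posIJ_iff (Md : Sys.Model (artinSys hn hlarge) (gen n M) (phi hlarge)) (e : Edge n) (h : (dih hlarge e).D) :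
    posIJ n M e.1.1 e.1.2 (phi hlarge e h) ↔ DPos (dih hlarge e).x h := by
  unfold posIJ DPos
  have : ({gen n M e.1.1, gen n M e.1.2} : Set (ArtinGroup n M)) =
      phi hlarge e '' {(dih hlarge e).x true, (dih hlarge e).x false} := by
    rw [Set.image_pair, phi_true, phi_false]
  rw [this, ← MonoidHom.map_mclosure]
  exact Submonoid.mem_map_iff_mem (phi_inj Md e)

theorem negIJ_iff (Md : Sys.Model (artinSys hn hlarge) (gen n M) (phi hlarge)) (e : Edge n) (h : (dih hlarge e).D) :
    negIJ n M e.1.1 e.1.2 (phi hlarge e h) ↔ DNeg (dih hlarge e).x h := by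
  unfold negIJ DNeg
  have : ({(gen n M e.1.1)⁻¹, (gen n M e.1.2)⁻¹} : Set (ArtinGroup n M)) =
      phi hlarge e '' {((dih hlarge e).x true)⁻¹, ((dih hlarge e).x false)⁻¹} := by
    rw [Set.image_pair, map_inv, map_inv, phi_true, phi_false]
  rw [this, ← MonoidHom.map_mclosure]
  exact Submonoid.mem_map_iff_mem (phi_inj Md e)

theorem div_iff (Md : Sys.Model (artinSys hn hlarge) (gen n M) (phi hlarge)) (e : Edge n) (h k : (dih hlarge e).D) :
    IsLeftDiv (ℓA n M) (phi hlarge e h) (phi hlarge e k) ↔ IsLeftDiv (wl (dih hlarge e).x) h k := by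
  unfold IsLeftDiv
  rw [lA_eq, ← map_inv, ← map_mul, wl_phi' Md, wl_phi' Md, wl_phi' Md]

theorem DeltaIJ_eq (e : Edge n) (m : ℕ) : DeltaIJ n M e.1.1 e.1.2 m = phi hlarge e (DDel (dih hlarge e).x m) := by
  rw [DDel, map_altProd, phi_true, phi_false]; rfl

theorem max_imp (Md : Sys.Model (artinSys hn hlarge) (gen n M) (phi hlarge)) (e : Edge n) {m k : ℕ}
    {h : (dih hlarge e).D} (hh : IsMaxDPowIJ n M e.1.1 e.1.2 m k (phi hlarge e h)) :
    DMax (dih hlarge e).x m k h := by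
  obtain ⟨h1, h2⟩ := hh
  rw [DeltaIJ_eq (hlarge := hlarge)] at h1 h2
  simp only [← map_pow, div_iff Md] at h1 h2
  exact ⟨h1, h2⟩

theorem maxN_imp (Md : Sys.Model (artinSys hn hlarge) (gen n M) (phi hlarge)) (e : Edge n) {m k : ℕ}
    {h : (dih hlarge e).D} (hh : IsMaxNegDPowIJ n M e.1.1 e.1.2 m k (phi hlarge e h)) :
    DMaxN (dih hlarge e).x m k h := by
  obtain ⟨h1, h2⟩ := hh
  rw [DeltaIJ_eq (hlarge := hlarge)] at h1 h2
  simp only [← map_inv, ← map_pow, div_iff Md] at h1 h2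
  exact ⟨h1, h2⟩

theorem two_imp (Md : Sys.Model (artinSys hn hlarge) (gen n M) (phi hlarge)) (e : Edge n)
    {h : (dih hlarge e).D} (hh : TwoSyllIJ n M e.1.1 e.1.2 (phi hlarge e h)) : DTwo (dih hlarge e).x h := by
  have key : ∀ a ∈ lettersIJ n M e.1.1 e.1.2, ∃ b ∈ lset (dih hlarge e).x, a = phi hlarge e b := by
    rintro a (rfl | rfl | rfl | ha)
    · exact ⟨_, mem_lset true, (phi_true _ _).symm⟩
    · exact ⟨_, inv_mem_lset true, by rw [map_inv, phi_true]⟩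
    · exact ⟨_, mem_lset false, (phi_false _ _).symm⟩
    · rw [Set.mem_singleton_iff] at ha
      subst ha
      exact ⟨_, inv_mem_lset false, by rw [map_inv, phi_false]⟩
  obtain ⟨a, ha, b, hb, s, t, hst⟩ := hh
  obtain ⟨a', ha', rfl⟩ := key a ha
  obtain ⟨b', hb', rfl⟩ := key b hb
  refine ⟨a', ha', b', hb', s, t, phi_inj Md e ?_⟩
  rw [hst, map_mul, map_pow, map_pow]

theorem perm_imp (Md : Sys.Model (artinSys hn hlarge) (gen n M) (phi hlarge)) (e : Edge n)
    {h₁ h₂ : (dih hlarge e).D} (hh : PijMem n M e.1.1 e.1.2 (phi hlarge e h₁) (phi hlarge e h₂)) :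
    PermD (dih hlarge e).x (M e.1.1 e.1.2) h₁ h₂ := by
  obtain ⟨-, -, h3, h4⟩ := hh
  rw [← map_mul] at h3 h4
  rw [lA_eq, wl_phi' Md, wl_phi' Md, wl_phi' Md] at h3
  refine ⟨h3, ?_⟩
  intro m hm hp
  simp only [posIJ_iff Md, negIJ_iff Md] at h4
  rcases h4 m hm hp with h | h | ⟨p1, p2, p3, k₁, k₂, q1, q2, q3⟩ | ⟨p1, p2, p3, k₁, k₂, q1, q2, q3⟩
  · exact Or.inl (two_imp Md e h)
  · exact Or.inr (Or.inl (two_imp Md e h))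
  · exact Or.inr (Or.inr (Or.inl ⟨p1, p2, p3, k₁, k₂, max_imp Md e q1, max_imp Md e q2, max_imp Md e q3⟩))
  · exact Or.inr (Or.inr (Or.inr ⟨p1, p2, p3, k₁, k₂, maxN_imp Md e q1, maxN_imp Md e q2, maxN_imp Md e q3⟩))

end

theorem final_count
    (n : ℕ) (hn : 2 ≤ n) (M : Fin n → Fin n → ℕ∞)
    (hsymm : ∀ i j, M i j = M j i)
    (hlarge : ∀ i j, i ≠ j → 3 ≤ M i j)
    (h33m : ¬ ∃ i j k : Fin n, i ≠ j ∧ i ≠ k ∧ j ≠ k ∧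
        M i j = 3 ∧ M i k = 3 ∧ M j k < ⊤)
    (LD RD : Fin n → Fin n → ArtinGroup n M → ArtinGroup n M)
    (hLD : ∀ i j : Fin n, i ≠ j → ∀ g, IsMaxLD n M i j g (LD i j g))
    (hRD : ∀ i j : Fin n, i ≠ j → ∀ g, IsMaxRD n M i j g (RD i j g)) :
    ∃ A : ℕ, ∀ (k l : ℕ) (g : ArtinGroup n M), ℓA n M g = k + l →
      {q : ArtinGroup n M × ArtinGroup n M |
            PMem n M LD RD q ∧ q.1 * q.2 = g ∧ ℓA n M q.1 = k ∧ ℓA n M q.2 = l}.Finite ∧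
      {q : ArtinGroup n M × ArtinGroup n M |
            PMem n M LD RD q ∧ q.1 * q.2 = g ∧ ℓA n M q.1 = k ∧ ℓA n M q.2 = l}.ncard ≤ A * (min k l + 1) ^ 3 := by
  classical
  obtain ⟨Md⟩ := exists_artin_model hn hsymm hlarge
  obtain ⟨A, hA⟩ := artin_cnt hlarge
  have hy := gen_closure n M
  have e₀ : Edge n := ⟨(⟨0, by omega⟩, ⟨1, hn⟩), by rw [Fin.lt_def]; simp⟩
  have hcount := Md.count hy (phi_mem hn hlarge) (artin_H33 hn hsymm hlarge h33m)
    (fun e h₁ h₂ => PermD (dih hlarge e).x (M e.1.1 e.1.2) h₁ h₂) A hA e₀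
  have hP : ∀ q, PMem n M LD RD q → ∀ e : Edge n,
      PermD (dih hlarge e).x (M e.1.1 e.1.2) (Md.RD e q.1) (Md.RD e q.2⁻¹)⁻¹ := by
    intro q hq e
    have h := hq.2 e.1.1 e.1.2 e.2.ne
    rw [RD_eq Md e (hRD e.1.1 e.1.2 e.2.ne q.1), LD_eq Md e (hLD e.1.1 e.1.2 e.2.ne q.2)] at h
    exact perm_imp Md e h
  refine ⟨A, fun k l g hg => ?_⟩
  set Z := {q : ArtinGroup n M × ArtinGroup n M |
            PMem n M LD RD q ∧ q.1 * q.2 = g ∧ ℓA n M q.1 = k ∧ ℓA n M q.2 = l} with hZ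
  -- both counts
  have hfin : ∀ (F : Finset (ArtinGroup n M)) (f : ArtinGroup n M → ArtinGroup n M × ArtinGroup n M),
      Z ⊆ f '' F → Z.Finite ∧ Z.ncard ≤ F.card := by
    intro F f hsub
    have h1 : (f '' (F : Set (ArtinGroup n M))).Finite := F.finite_toSet.image f
    refine ⟨h1.subset hsub, (Set.ncard_le_ncard hsub h1).trans ((Set.ncard_image_le F.finite_toSet).trans ?_)⟩
    rw [Set.ncard_coe_finset]
  rcases le_total k l with hkl | hkl
  · obtain ⟨F, hc, hF⟩ := hcount k g
    have := hfin F (fun p => (p, p⁻¹ * g)) (by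
      rintro ⟨p, q⟩ ⟨h1, h2, h3, h4⟩
      simp only at h2 h3 h4
      subst h2
      refine ⟨p, hF p h3 ?_ ?_, by simp⟩
      · unfold Sys.Model.Dv
        rw [inv_mul_cancel_left]
        exact h1.1
      · intro e
        have := hP _ h1 e
        rwa [show (p * q)⁻¹ * p = q⁻¹ by group])
    rw [min_eq_left hkl]
    exact ⟨this.1, this.2.trans hc⟩
  · obtain ⟨F, hc, hF⟩ := hcount l g⁻¹
    have := hfin F (fun p => (g * p, p⁻¹)) (by
      rintro ⟨p, q⟩ ⟨h1, h2, h3, h4⟩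
      simp only at h2 h3 h4
      subst h2
      refine ⟨q⁻¹, hF q⁻¹ ?_ ?_ ?_, by simp⟩
      · rw [wl_inv hy]; exact h4
      · unfold Sys.Model.Dv
        have := h1.1
        rw [lA_eq] at this
        simp only at this
        rw [wl_inv hy, wl_inv hy, ← this, show q⁻¹⁻¹ * (p * q)⁻¹ = p⁻¹ by group, wl_inv hy, add_comm]
      · intro e
        have := (dih hlarge e).perm_inv _ _ (hP _ h1 e)
        rw [inv_inv] at this
        rwa [show (p * q)⁻¹⁻¹ * q⁻¹ = p by group])
    rw [min_eq_right hkl]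
    exact ⟨this.1, this.2.trans hc⟩

/-- **Proposition (D1).** For an Artin group of large type satisfying the
(3,3,m)-hypothesis, there is a polynomial `P₁` such that for every `g` of length
`k + l`, the number of permissible factorisations of `g` into elements of lengths
`k` and `l` is at most `P₁(min(k,l))`. -/
theorem largeType_D1
    (n : ℕ) (hn : 2 ≤ n) (M : Fin n → Fin n → ℕ∞)
    (hsymm : ∀ i j, M i j = M j i)
    (hdiag : ∀ i, M i i = 1)
    (hlarge : ∀ i j, i ≠ j → 3 ≤ M i j)
    (h33m : ¬ ∃ i j k : Fin n, i ≠ j ∧ i ≠ k ∧ j ≠ k ∧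
        M i j = 3 ∧ M i k = 3 ∧ M j k < ⊤)
    (LD RD : Fin n → Fin n → ArtinGroup n M → ArtinGroup n M)
    (hLD : ∀ i j : Fin n, i ≠ j → ∀ g, IsMaxLD n M i j g (LD i j g))
    (hRD : ∀ i j : Fin n, i ≠ j → ∀ g, IsMaxRD n M i j g (RD i j g)) :
    ∃ P₁ : Polynomial ℝ, (∀ c : ℕ, 0 ≤ P₁.coeff c) ∧
      ∀ (k l : ℕ) (g : ArtinGroup n M), ℓA n M g = k + l →
        {q : ArtinGroup n M × ArtinGroup n M |
            PMem n M LD RD q ∧ q.1 * q.2 = g ∧ ℓA n M q.1 = k ∧ ℓA n M q.2 = l}.Finite ∧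
        ({q : ArtinGroup n M × ArtinGroup n M |
            PMem n M LD RD q ∧ q.1 * q.2 = g ∧ ℓA n M q.1 = k ∧ ℓA n M q.2 = l}.ncard : ℝ) ≤
          P₁.eval ((min k l : ℕ) : ℝ) := by
  obtain ⟨A, hA⟩ := final_count n hn M hsymm hlarge h33m LD RD hLD hRD
  refine ⟨Polynomial.C (A : ℝ) * (Polynomial.X + 1) ^ 3, ?_, ?_⟩
  · intro c
    rw [Polynomial.coeff_C_mul, Polynomial.coeff_X_add_one_pow]
    positivity
  · intro k l g hg
    obtain ⟨h1, h2⟩ := hA k l g hg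
    refine ⟨h1, ?_⟩
    have h3 : (_ : ℝ) ≤ ((A * (min k l + 1) ^ 3 : ℕ) : ℝ) := Nat.cast_le.mpr h2
    refine h3.trans (le_of_eq ?_)
    simp only [Polynomial.eval_mul, Polynomial.eval_C, Polynomial.eval_pow, Polynomial.eval_add,
      Polynomial.eval_X, Polynomial.eval_one, Nat.cast_mul, Nat.cast_pow, Nat.cast_add, Nat.cast_one]

end ArtinRD
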